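/- arXiv:1405.5622 — 2 statements merged into one kernel-verified Lean document; each statement's English description precedes it below -/
import Mathlib

section
/- Let G be a graph on n vertices that does not contain any subgraph isomorphic to a subdivision of K_{2,3}. If no connected component of G is isomorphic to the 5-cycle C_5 and there is no vertex v of G such that G − v has a connected component isomorphic to C_5, then γ'_R(G) ≤ (3/4)·n. -/
open Finset SimpleGraph

/-- An edge Roman dominating function: values in {0,1,2} on edges (0 elsewhere),
and every edge with value 0 is adjacent to a distinct edge with value 2
sharing an endpoint with it. -/
def EdgeRDF {V : Type*} (G : SimpleGraph V) (f : Sym2 V → ℕ) : Prop :=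
  (∀ e, f e ≤ 2) ∧ (∀ e, e ∉ G.edgeSet → f e = 0) ∧
  (∀ e ∈ G.edgeSet, f e = 0 →
    ∃ e' ∈ G.edgeSet, f e' = 2 ∧ e' ≠ e ∧ ∃ v, v ∈ e ∧ v ∈ e')

/-- The edge Roman domination number: the minimum weight of an
edge Roman dominating function. -/
noncomputable def edgeRomanNumber (V : Type*) [Fintype V] [DecidableEq V]
    (G : SimpleGraph V) : ℕ :=
  sInf {w | ∃ f : Sym2 V → ℕ, EdgeRDF G f ∧ w = ∑ e : Sym2 V, f e}


/-- `G` contains a subgraph isomorphic to a subdivision of `H`: there is an injection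
`f` of the vertices of `H` (the branch vertices) into `G` and, for each edge of `H`,
a path in `G` between the corresponding branch vertices, such that the only branch
vertices on each such path are its two endpoints, and paths corresponding to distinct
edges of `H` share only branch vertices. -/
def ContainsSubdivision {V U : Type*} (G : SimpleGraph V) (H : SimpleGraph U) : Prop :=
  ∃ f : U → V, Function.Injective f ∧
    ∃ P : ∀ ⦃u w : U⦄, H.Adj u w → G.Walk (f u) (f w),
      (∀ ⦃u w : U⦄ (h : H.Adj u w), (P h).IsPath) ∧
      (∀ ⦃u w : U⦄ (h : H.Adj u w), ∀ x ∈ (P h).support,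
        x ∈ Set.range f → x = f u ∨ x = f w) ∧
      (∀ ⦃u w : U⦄ (h : H.Adj u w) ⦃u' w' : U⦄ (h' : H.Adj u' w'),
        s(u, w) ≠ s(u', w') →
          ∀ x ∈ (P h).support, x ∈ (P h').support → x ∈ Set.range f)


/-- `G − S`: the subgraph of `G` induced on the vertices outside of `S`. -/
def deleteVerts {V : Type*} [DecidableEq V] (G : SimpleGraph V) (S : Finset V) :
    SimpleGraph {v : V // v ∉ S} :=
  SimpleGraph.comap Subtype.val G

namespace EdgeRoman

section Sets

variable {V : Type*} {G : SimpleGraph V}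

/-- Some edge of `G` joins `A` and `B`. -/
def Touch (G : SimpleGraph V) (A B : Finset V) : Prop := ∃ a ∈ A, ∃ b ∈ B, G.Adj a b

lemma Touch.symm {A B : Finset V} (h : Touch G A B) : Touch G B A := by
  obtain ⟨a, ha, b, hb, hab⟩ := h
  exact ⟨b, hb, a, ha, hab.symm⟩

lemma Touch.mono {A B A' B' : Finset V} (h : Touch G A B) (hA : A ⊆ A') (hB : B ⊆ B') :
    Touch G A' B' := by
  obtain ⟨a, ha, b, hb, hab⟩ := h
  exact ⟨a, hA ha, b, hB hb, hab⟩

lemma touch_of_adj {A B : Finset V} {a b : V} (h : G.Adj a b) (ha : a ∈ A) (hb : b ∈ B) :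
    Touch G A B := ⟨a, ha, b, hb, h⟩

variable [DecidableEq V]

/-- `A` is nonempty and induces a connected subgraph (every cut of `A` is crossed by an edge). -/
def ConnSet (G : SimpleGraph V) (A : Finset V) : Prop :=
  A.Nonempty ∧ ∀ P ⊆ A, P.Nonempty → P ≠ A → Touch G P (A \ P)

lemma connSet_singleton (x : V) : ConnSet G {x} := by
  refine ⟨singleton_nonempty x, fun P hP hne hP' => ?_⟩
  exact absurd ((Finset.subset_singleton_iff.mp hP).resolve_left hne.ne_empty) hP'

lemma ConnSet.union {A B : Finset V} (hA : ConnSet G A) (hB : ConnSet G B)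
    (h : Touch G A B ∨ (A ∩ B).Nonempty) : ConnSet G (A ∪ B) := by
  refine ⟨hA.1.mono subset_union_left, fun P hP hne hP' => ?_⟩
  by_cases hPA : (P ∩ A).Nonempty ∧ P ∩ A ≠ A
  · obtain ⟨a, ha, b, hb, hab⟩ := hA.2 (P ∩ A) inter_subset_right hPA.1 hPA.2
    exact ⟨a, by grind, b, by grind, hab⟩
  by_cases hPB : (P ∩ B).Nonempty ∧ P ∩ B ≠ B
  · obtain ⟨a, ha, b, hb, hab⟩ := hB.2 (P ∩ B) inter_subset_right hPB.1 hPB.2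
    exact ⟨a, by grind, b, by grind, hab⟩
  have h1 : (∀ x ∈ A, x ∉ P) ∨ A ⊆ P := by
    rcases (P ∩ A).eq_empty_or_nonempty with h | h
    · left; intro x hx hx'; exact notMem_empty x (h ▸ mem_inter.mpr ⟨hx', hx⟩)
    · right; by_contra hc; exact hPA ⟨h, fun h' => hc (by rw [← h']; exact inter_subset_left)⟩
  have h2 : (∀ x ∈ B, x ∉ P) ∨ B ⊆ P := by
    rcases (P ∩ B).eq_empty_or_nonempty with h | h
    · left; intro x hx hx'; exact notMem_empty x (h ▸ mem_inter.mpr ⟨hx', hx⟩)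
    · right; by_contra hc; exact hPB ⟨h, fun h' => hc (by rw [← h']; exact inter_subset_left)⟩
  clear hPA hPB
  rcases h with ⟨a, ha, b, hb, hab⟩ | ⟨x, hx⟩
  · rcases h1 with h1 | h1 <;> rcases h2 with h2 | h2
    · obtain ⟨p, hp⟩ := hne; grind
    · exact ⟨b, h2 hb, a, by grind, hab.symm⟩
    · exact ⟨a, h1 ha, b, by grind, hab⟩
    · exact absurd (subset_antisymm hP (union_subset h1 h2)) hP'
  · obtain ⟨p, hp⟩ := hne
    rcases h1 with h1 | h1 <;> rcases h2 with h2 | h2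
    · grind
    · grind
    · grind
    · exact absurd (subset_antisymm hP (union_subset h1 h2)) hP'

lemma ConnSet.insert {A : Finset V} {x y : V} (hA : ConnSet G A) (hy : y ∈ A) (h : G.Adj x y) :
    ConnSet G (insert x A) := by
  rw [Finset.insert_eq]
  exact (connSet_singleton x).union hA (Or.inl ⟨x, by simp, y, hy, h⟩)

/-- A connected set meeting both sides of a set with no outgoing edges is inside it. -/
lemma ConnSet.subset_of_closed {A P : Finset V} (hA : ConnSet G A) (hne : (A ∩ P).Nonempty)
    (hcl : ∀ a ∈ A, a ∈ P → ∀ b ∈ A, G.Adj a b → b ∈ P) : A ⊆ P := by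
  by_contra hc
  obtain ⟨a, ha, b, hb, hab⟩ := hA.2 (A ∩ P) inter_subset_left hne (by grind)
  grind

lemma ConnSet.exists_adj {A P : Finset V} (hA : ConnSet G A) (hne : (A ∩ P).Nonempty)
    (hn : ¬ A ⊆ P) : ∃ a ∈ A, a ∈ P ∧ ∃ b ∈ A, b ∉ P ∧ G.Adj a b := by
  by_contra hc
  push Not at hc
  exact hn (hA.subset_of_closed hne (by grind))

open scoped Classical in
/-- The connected component of `m` in the subgraph induced on `A`. -/
noncomputable def comp (G : SimpleGraph V) (A : Finset V) (m : V) : Finset V :=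
  A.filter fun w => ∃ C ⊆ A, ConnSet G C ∧ m ∈ C ∧ w ∈ C

lemma mem_comp {A : Finset V} {m w : V} :
    w ∈ comp G A m ↔ ∃ C ⊆ A, ConnSet G C ∧ m ∈ C ∧ w ∈ C := by
  classical
  simp only [comp, mem_filter, and_iff_right_iff_imp]
  rintro ⟨C, hC, -, -, hw⟩
  exact hC hw

lemma comp_subset {A : Finset V} {m : V} : comp G A m ⊆ A := by
  classical exact filter_subset _ _

lemma self_mem_comp {A : Finset V} {m : V} (hm : m ∈ A) : m ∈ comp G A m :=
  mem_comp.mpr ⟨{m}, by simpa using hm, connSet_singleton m, by simp, by simp⟩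

lemma comp_closed {A : Finset V} {m a b : V} (ha : a ∈ comp G A m) (hb : b ∈ A)
    (h : G.Adj a b) : b ∈ comp G A m := by
  obtain ⟨C, hC, hc, hm, haC⟩ := mem_comp.mp ha
  exact mem_comp.mpr ⟨insert b C, by grind, hc.insert haC h.symm, by grind, by grind⟩

lemma connSet_comp {A : Finset V} {m : V} (hm : m ∈ A) : ConnSet G (comp G A m) := by
  refine ⟨⟨m, self_mem_comp hm⟩, fun P hP hne hP' => ?_⟩
  by_contra hc
  have key : ∀ C ⊆ A, ConnSet G C → m ∈ C → (C ∩ P).Nonempty → C ⊆ P := by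
    intro C hC hc' hmC hn
    refine hc'.subset_of_closed hn fun a _ ha b hb hab => ?_
    by_contra hbP
    refine hc ⟨a, ha, b, ?_, hab⟩
    exact mem_sdiff.mpr ⟨mem_comp.mpr ⟨C, hC, hc', hmC, hb⟩, hbP⟩
  obtain ⟨p, hp⟩ := hne
  obtain ⟨C, hC, hc1, hmC, hpC⟩ := mem_comp.mp (hP hp)
  have hmP : m ∈ P := key C hC hc1 hmC ⟨p, by grind⟩ hmC
  apply hP'
  apply subset_antisymm hP
  intro w hw
  obtain ⟨C, hC, hc1, hmC, hpC⟩ := mem_comp.mp hw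
  exact key C hC hc1 hmC ⟨m, by grind⟩ hpC

lemma ConnSet.subset_comp {A C : Finset V} {m w : V} (hC : ConnSet G C) (hCA : C ⊆ A)
    (hw : w ∈ C) (hw' : w ∈ comp G A m) : C ⊆ comp G A m :=
  hC.subset_of_closed ⟨w, by grind⟩ fun _ _ ha _ hb hab => comp_closed ha (hCA hb) hab

/-- Removing a vertex `y` from a connected set: every remaining vertex lies in a component
touching `y`. -/
lemma ConnSet.comp_touch {C A : Finset V} {y m : V} (hC : ConnSet G C) (hCA : C.erase y ⊆ A)
    (hy : y ∈ C) (hyA : y ∉ A) (hm : m ∈ C) (hmy : m ≠ y) :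
    Touch G {y} (comp G A m) := by
  have hmA : m ∈ A := hCA (by grind)
  have := self_mem_comp (G := G) hmA
  obtain ⟨a, ha, haP, b, hb, hbP, hab⟩ :=
    hC.exists_adj (P := comp G A m) ⟨m, by grind⟩
      (fun h => hyA (comp_subset (h hy)))
  by_cases hby : b = y
  · exact ⟨y, by simp, a, haP, hby ▸ hab.symm⟩
  · exact absurd (comp_closed haP (hCA (by grind)) hab) hbP

/-- Removing a part that hangs on the rest at a single vertex keeps connectedness. -/
lemma ConnSet.sdiff_pendant {A E : Finset V} {t : V} (hA : ConnSet G A) (ht : t ∈ A \ E)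
    (h : ∀ e ∈ E, ∀ a ∈ A \ E, G.Adj e a → a = t) : ConnSet G (A \ E) := by
  refine ⟨⟨t, ht⟩, fun P hP hne hP' => ?_⟩
  by_cases htP : t ∈ P
  · obtain ⟨a, ha, b, hb, hab⟩ := hA.2 (P ∪ (A ∩ E)) (by grind) ⟨t, by grind⟩
      (fun h' => hP' (subset_antisymm hP fun x hx => by have := h' ▸ (mem_sdiff.mp hx).1; grind))
    exact ⟨a, by grind, b, by grind, hab⟩
  · obtain ⟨a, ha, b, hb, hab⟩ := hA.2 P (by grind) hne (by grind)
    refine ⟨a, ha, b, ?_, hab⟩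
    have := hab.symm
    grind

lemma ConnSet.exists_erase {A : Finset V} (hA : ConnSet G A) (h2 : 2 ≤ A.card) :
    ∃ m ∈ A, ConnSet G (A.erase m) := by
  classical
  obtain ⟨a, ha⟩ := hA.1
  have hne : (A.powerset.filter fun M => ConnSet G M ∧ M ≠ A).Nonempty :=
    ⟨{a}, by
      simp only [mem_filter, mem_powerset, singleton_subset_iff]
      refine ⟨ha, connSet_singleton a, ?_⟩
      rintro rfl
      simp at h2⟩
  obtain ⟨M, hM, hmax⟩ := exists_max_image _ card hne
  simp only [mem_filter, mem_powerset] at hM hmax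
  obtain ⟨x, hx, y, hy, hxy⟩ := hA.2 M hM.1 hM.2.1.1 hM.2.2
  have hins : Insert.insert y M = A := by
    by_contra hc
    have := hmax (Insert.insert y M) ⟨by grind, hM.2.1.insert hx hxy.symm, hc⟩
    rw [card_insert_of_notMem (by grind)] at this
    omega
  refine ⟨y, by grind, ?_⟩
  rw [← hins, erase_insert (by grind)]
  exact hM.2.1

lemma touch_erase_or {M B : Finset V} {m : V} (h : Touch G M B) :
    Touch G (M.erase m) B ∨ Touch G {m} B := by
  obtain ⟨a, ha, b, hb, hab⟩ := h
  by_cases h : a = m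
  · exact Or.inr ⟨a, by simp [h], b, hb, hab⟩
  · exact Or.inl ⟨a, by grind, b, hb, hab⟩

/-- `B` is a connected set that avoids `u` and `M` and touches both. -/
structure Link (G : SimpleGraph V) (u : V) (M B : Finset V) : Prop where
  conn : ConnSet G B
  notMem : u ∉ B
  sep : ∀ x ∈ M, x ∉ B
  left : Touch G {u} B
  right : Touch G M B

/-- There are no two vertices joined by three disjoint connected sets. -/
def NoTheta (G : SimpleGraph V) : Prop :=
  ∀ u v : V, ∀ B₁ B₂ B₃ : Finset V, u ≠ v → Link G u {v} B₁ → Link G u {v} B₂ → Link G u {v} B₃ →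
    (∀ x ∈ B₁, x ∉ B₂) → (∀ x ∈ B₁, x ∉ B₃) → (∀ x ∈ B₂, x ∉ B₃) → False

lemma Link.union {u : V} {M N B C : Finset V} (h : Link G u M B) (hC : ConnSet G C)
    (huC : u ∉ C) (hsep : ∀ x ∈ N, x ∉ B ∪ C) (hBC : Touch G B C) (hN : Touch G N C) :
    Link G u N (B ∪ C) where
  conn := h.conn.union hC (Or.inl hBC)
  notMem := by have := h.notMem; grind
  sep := hsep
  left := h.left.mono subset_rfl subset_union_left
  right := hN.mono subset_rfl subset_union_right

lemma Link.of_subset {u : V} {M N B : Finset V} (h : Link G u M B) (hN : N ⊆ M)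
    (ht : Touch G N B) : Link G u N B :=
  ⟨h.conn, h.notMem, fun x hx => h.sep x (hN hx), h.left, ht⟩

/-- `NoTheta` with one of the two vertices replaced by a connected set. -/
lemma NoTheta.conn (hG : NoTheta G) (u : V) :
    ∀ M B₁ B₂ B₃ : Finset V, ConnSet G M → u ∉ M →
    Link G u M B₁ → Link G u M B₂ → Link G u M B₃ →
    (∀ x ∈ B₁, x ∉ B₂) → (∀ x ∈ B₁, x ∉ B₃) → (∀ x ∈ B₂, x ∉ B₃) → False := by
  intro M
  induction hn : M.card using Nat.strong_induction_on generalizing M with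
  | _ n ih =>
  intro B₁ B₂ B₃ hM huM h1 h2 h3 d12 d13 d23
  rcases Nat.lt_or_ge M.card 2 with hc | hc
  · obtain ⟨v, rfl⟩ : ∃ v, M = {v} := by
      rw [← card_eq_one]
      have := hM.1.card_pos
      omega
    exact hG u v B₁ B₂ B₃ (by simpa using huM) h1 h2 h3 d12 d13 d23
  · obtain ⟨m, hm, hMm⟩ := hM.exists_erase hc
    have hlt : (M.erase m).card < n := by rw [card_erase_of_mem hm]; omega
    have hmt : Touch G {m} (M.erase m) := by
      obtain ⟨a, ha, b, hb, hab⟩ := hM.2 {m} (by simpa using hm) (by simp)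
        (by rintro rfl; simp at hc)
      exact ⟨a, ha, b, by rwa [erase_eq], hab⟩
    have hum : u ≠ m := by rintro rfl; exact huM hm
    have hume : u ∉ M.erase m := fun h => huM (mem_of_mem_erase h)
    have sub : ({m} : Finset V) ⊆ M := by simpa using hm
    have one : ∀ C₁ C₂ C₃ : Finset V, Link G u M C₁ → Link G u M C₂ → Link G u M C₃ →
        (∀ x ∈ C₁, x ∉ C₂) → (∀ x ∈ C₁, x ∉ C₃) → (∀ x ∈ C₂, x ∉ C₃) →
        Touch G {m} C₁ → Touch G (M.erase m) C₂ → Touch G (M.erase m) C₃ → False := by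
      intro C₁ C₂ C₃ h1 h2 h3 d12 d13 d23 s1 s2 s3
      have e1 := h1.sep; have e2 := h2.sep; have e3 := h3.sep
      refine ih _ hlt (M.erase m) rfl (C₁ ∪ {m}) C₂ C₃ hMm hume
        (h1.union (connSet_singleton m) (by simpa using hum) ?_ s1.symm hmt.symm)
        (h2.of_subset (erase_subset _ _) s2) (h3.of_subset (erase_subset _ _) s3) ?_ ?_ d23
      all_goals clear ih hG; grind
    have two : ∀ C₁ C₂ C₃ : Finset V, Link G u M C₁ → Link G u M C₂ → Link G u M C₃ →
        (∀ x ∈ C₁, x ∉ C₂) → (∀ x ∈ C₁, x ∉ C₃) → (∀ x ∈ C₂, x ∉ C₃) →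
        Touch G {m} C₁ → Touch G {m} C₂ → Touch G M C₃ → False := by
      intro C₁ C₂ C₃ h1 h2 h3 d12 d13 d23 s1 s2 s3
      have e1 := h1.sep; have e2 := h2.sep; have e3 := h3.sep
      rcases touch_erase_or (m := m) s3 with s3 | s3
      · refine hG u m C₁ C₂ (C₃ ∪ M.erase m) hum (h1.of_subset sub s1) (h2.of_subset sub s2)
          (h3.union hMm hume ?_ s3.symm hmt) d12 ?_ ?_
        all_goals clear ih hG; grind
      · exact hG u m C₁ C₂ C₃ hum (h1.of_subset sub s1) (h2.of_subset sub s2)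
          (h3.of_subset sub s3) d12 d13 d23
    have d21 : ∀ x ∈ B₂, x ∉ B₁ := fun x h h' => d12 x h' h
    have d31 : ∀ x ∈ B₃, x ∉ B₁ := fun x h h' => d13 x h' h
    have d32 : ∀ x ∈ B₃, x ∉ B₂ := fun x h h' => d23 x h' h
    rcases touch_erase_or (m := m) h1.right with r1 | r1 <;>
      rcases touch_erase_or (m := m) h2.right with r2 | r2 <;>
      rcases touch_erase_or (m := m) h3.right with r3 | r3
    · exact ih _ hlt (M.erase m) rfl B₁ B₂ B₃ hMm hume (h1.of_subset (erase_subset _ _) r1)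
        (h2.of_subset (erase_subset _ _) r2) (h3.of_subset (erase_subset _ _) r3) d12 d13 d23
    · exact one B₃ B₁ B₂ h3 h1 h2 d31 d32 d12 r3 r1 r2
    · exact one B₂ B₁ B₃ h2 h1 h3 d21 d23 d13 r2 r1 r3
    · exact two B₂ B₃ B₁ h2 h3 h1 d23 d21 d31 r2 r3 h1.right
    · exact one B₁ B₂ B₃ h1 h2 h3 d12 d13 d23 r1 r2 r3
    · exact two B₁ B₃ B₂ h1 h3 h2 d13 d12 d32 r1 r3 h2.right
    · exact two B₁ B₂ B₃ h1 h2 h3 d12 d13 d23 r1 r2 h3.right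
    · exact two B₁ B₂ B₃ h1 h2 h3 d12 d13 d23 r1 r2 h3.right

end Sets

section Cost

variable {V : Type*} {G : SimpleGraph V}

/-- The vertices `a b c d e` induce a 5-cycle in this cyclic order. -/
structure Cyc5 (G : SimpleGraph V) (a b c d e : V) : Prop where
  ab : G.Adj a b
  bc : G.Adj b c
  cd : G.Adj c d
  de : G.Adj d e
  ea : G.Adj e a
  ac : ¬ G.Adj a c
  bd : ¬ G.Adj b d
  ce : ¬ G.Adj c e
  da : ¬ G.Adj d a
  eb : ¬ G.Adj e b

lemma Cyc5.rot {a b c d e : V} (h : Cyc5 G a b c d e) : Cyc5 G b c d e a :=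
  ⟨h.bc, h.cd, h.de, h.ea, h.ab, h.bd, h.ce, h.da, h.eb, h.ac⟩

lemma Cyc5.flip {a b c d e : V} (h : Cyc5 G a b c d e) : Cyc5 G a e d c b :=
  ⟨h.ea.symm, h.de.symm, h.cd.symm, h.bc.symm, h.ab.symm, fun h' => h.da h'.symm,
    fun h' => h.ce h'.symm, fun h' => h.bd h'.symm, fun h' => h.ac h'.symm, fun h' => h.eb h'.symm⟩

lemma Cyc5.nodup {a b c d e : V} (h : Cyc5 G a b c d e) : a ≠ b ∧ a ≠ c ∧ a ≠ d ∧ a ≠ e ∧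
    b ≠ c ∧ b ≠ d ∧ b ≠ e ∧ c ≠ d ∧ c ≠ e ∧ d ≠ e := by
  obtain ⟨h1, h2, h3, h4, h5, n1, n2, n3, n4, n5⟩ := h
  refine ⟨h1.ne, ?_, ?_, h5.ne.symm, h2.ne, ?_, ?_, h3.ne, ?_, h4.ne⟩ <;> rintro rfl
  · exact n4 h3.symm
  · exact n1 h3.symm
  · exact n5 h4.symm
  · exact n2 h4.symm
  · exact n1 h5.symm

variable [DecidableEq V]

/-- `Rom G W c`: a greedy elimination certificate for an edge Roman dominating function of
weight at most `c` on the subgraph induced on `W`. -/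
inductive Rom (G : SimpleGraph V) : Finset V → ℕ → Prop
  | empty (c : ℕ) : Rom G ∅ c
  | pair {W : Finset V} {c : ℕ} {u v : V} : u ∈ W → v ∈ W → G.Adj u v → Rom G (W \ {u, v}) c →
      Rom G W (c + 2)
  | iso {W : Finset V} {c : ℕ} {v : V} : v ∈ W → (∀ w ∈ W, ¬ G.Adj v w) → Rom G (W.erase v) c →
      Rom G W c
  | one {W : Finset V} {c : ℕ} {v w : V} : v ∈ W → w ∈ W → G.Adj v w →
      (∀ x ∈ W, G.Adj v x → x = w) → Rom G (W.erase v) c → Rom G W (c + 1)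

lemma Rom.mono {W : Finset V} {c d : ℕ} (h : Rom G W c) (hcd : c ≤ d) : Rom G W d := by
  induction h generalizing d with
  | empty => exact .empty d
  | pair hu hv huv _ ih =>
    obtain ⟨e, rfl⟩ : ∃ e, d = e + 2 := ⟨d - 2, by omega⟩
    exact .pair hu hv huv (ih (by omega))
  | iso hv hn _ ih => exact .iso hv hn (ih hcd)
  | one hv hw hvw hn _ ih =>
    obtain ⟨e, rfl⟩ : ∃ e, d = e + 1 := ⟨d - 1, by omega⟩
    exact .one hv hw hvw hn (ih (by omega))

lemma Rom.union {A B : Finset V} {c d : ℕ} (hA : Rom G A c) (hB : Rom G B d)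
    (hd : ∀ a ∈ A, a ∉ B) (hn : ∀ a ∈ A, ∀ b ∈ B, ¬ G.Adj a b) : Rom G (A ∪ B) (c + d) := by
  induction hA with
  | empty => simpa using hB.mono (by omega)
  | @pair A c u v hu hv huv _ ih =>
    have e : (A ∪ B) \ {u, v} = A \ {u, v} ∪ B := by
      have := hd u hu; have := hd v hv; clear ih; grind
    have := ih (fun a ha => hd a (mem_sdiff.mp ha).1) (fun a ha => hn a (mem_sdiff.mp ha).1)
    rw [← e] at this
    have := Rom.pair (mem_union_left _ hu) (mem_union_left _ hv) huv this
    rwa [Nat.add_right_comm] at this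
  | @iso A c v hv hv' _ ih =>
    have e : (A ∪ B).erase v = A.erase v ∪ B := by
      have := hd v hv; clear ih; grind
    have := ih (fun a ha => hd a (mem_of_mem_erase ha)) (fun a ha => hn a (mem_of_mem_erase ha))
    rw [← e] at this
    refine Rom.iso (mem_union_left _ hv) (fun w hw => ?_) this
    rcases mem_union.mp hw with h | h
    exacts [hv' w h, hn v hv w h]
  | @one A c v w hv hw hvw hv' _ ih =>
    have e : (A ∪ B).erase v = A.erase v ∪ B := by
      have := hd v hv; clear ih; grind
    have := ih (fun a ha => hd a (mem_of_mem_erase ha)) (fun a ha => hn a (mem_of_mem_erase ha))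
    rw [← e] at this
    have := Rom.one (mem_union_left _ hv) (mem_union_left _ hw) hvw (fun x hx hvx => ?_) this
    · rwa [Nat.add_right_comm] at this
    rcases mem_union.mp hx with h | h
    exacts [hv' x h hvx, absurd hvx (hn v hv x h)]

lemma sum_update_le {α : Type*} [Fintype α] [DecidableEq α] (f : α → ℕ) (a : α) (k : ℕ) :
    ∑ e, Function.update f a k e ≤ ∑ e, f e + k := by
  rw [Finset.sum_update_of_mem (mem_univ a), add_comm]
  exact Nat.add_le_add_right (sum_le_sum_of_subset (subset_univ _)) k

/-- Soundness of elimination certificates. -/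
lemma Rom.exists_fun [Fintype V] {W : Finset V} {c : ℕ} (h : Rom G W c) :
    ∃ f : Sym2 V → ℕ, (∀ e, f e ≤ 2) ∧ (∀ e, f e ≠ 0 → e ∈ G.edgeSet ∧ ∀ v ∈ e, v ∈ W) ∧
      (∀ e ∈ G.edgeSet, (∀ v ∈ e, v ∈ W) → f e = 0 →
        ∃ e' ∈ G.edgeSet, f e' = 2 ∧ e' ≠ e ∧ ∃ v, v ∈ e ∧ v ∈ e') ∧
      ∑ e, f e ≤ c := by
  induction h with
  | empty c =>
    refine ⟨fun _ => 0, by simp, by simp, ?_, by simp⟩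
    intro e
    induction e with
    | h x y => intro _ h; exact absurd (h x (by simp)) (by simp)
  | @pair W c u v hu hv huv _ ih =>
    obtain ⟨f, h1, h2, h3, h4⟩ := ih
    refine ⟨Function.update f s(u, v) 2, fun e => ?_, fun e he => ?_, fun e he hW h0 => ?_,
      (sum_update_le _ _ _).trans (by omega)⟩
    · by_cases h : e = s(u, v) <;> simp [h, h1]
    · by_cases h : e = s(u, v)
      · subst h
        refine ⟨huv, fun w hw => ?_⟩
        rcases Sym2.mem_iff.mp hw with rfl | rfl <;> assumption
      · rw [Function.update_of_ne h] at he
        exact ⟨(h2 e he).1, fun w hw => (mem_sdiff.mp ((h2 e he).2 w hw)).1⟩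
    · have hne : e ≠ s(u, v) := by rintro rfl; simp at h0
      rw [Function.update_of_ne hne] at h0
      by_cases hue : u ∈ e
      · exact ⟨s(u, v), huv, by simp, hne.symm, u, hue, by simp⟩
      by_cases hve : v ∈ e
      · exact ⟨s(u, v), huv, by simp, hne.symm, v, hve, by simp⟩
      obtain ⟨e', he', h5, h6, h7⟩ := h3 e he (fun w hw => by
        rw [mem_sdiff]; refine ⟨hW w hw, ?_⟩
        simp only [mem_insert, mem_singleton, not_or]
        constructor <;> rintro rfl <;> contradiction) h0
      refine ⟨e', he', ?_, h6, h7⟩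
      by_cases h : e' = s(u, v) <;> simp [h, h5]
  | @iso W c v hv hv' _ ih =>
    obtain ⟨f, h1, h2, h3, h4⟩ := ih
    refine ⟨f, h1, fun e he => ⟨(h2 e he).1, fun w hw => mem_of_mem_erase ((h2 e he).2 w hw)⟩,
      fun e he hW h0 => h3 e he (fun w hw => mem_erase.mpr ⟨?_, hW w hw⟩) h0, h4⟩
    rintro rfl
    obtain ⟨x, rfl⟩ := Sym2.mem_iff_exists.mp hw
    exact hv' x (hW x (by simp)) he
  | @one W c v w hv hw hvw hv' _ ih =>
    obtain ⟨f, h1, h2, h3, h4⟩ := ih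
    refine ⟨Function.update f s(v, w) 1, fun e => ?_, fun e he => ?_, fun e he hW h0 => ?_,
      (sum_update_le _ _ _).trans (by omega)⟩
    · by_cases h : e = s(v, w) <;> simp [h, h1]
    · by_cases h : e = s(v, w)
      · subst h
        refine ⟨hvw, fun w hw => ?_⟩
        rcases Sym2.mem_iff.mp hw with rfl | rfl <;> assumption
      · rw [Function.update_of_ne h] at he
        exact ⟨(h2 e he).1, fun w hw => mem_of_mem_erase ((h2 e he).2 w hw)⟩
    · have hne : e ≠ s(v, w) := by rintro rfl; simp at h0
      rw [Function.update_of_ne hne] at h0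
      obtain ⟨e', he', h5, h6, h7⟩ := h3 e he (fun x hx => by
        refine mem_erase.mpr ⟨?_, hW x hx⟩
        rintro rfl
        obtain ⟨y, rfl⟩ := Sym2.mem_iff_exists.mp hx
        exact hne (by rw [hv' y (hW y (by simp)) he])) h0
      refine ⟨e', he', ?_, h6, h7⟩
      have : e' ≠ s(v, w) := by
        rintro rfl
        have := (h2 _ (by rw [h5]; decide)).2 v (by simp)
        simp at this
      rw [Function.update_of_ne this, h5]

lemma Rom.edgeRomanNumber_le [Fintype V] {c : ℕ} (h : Rom G univ c) :
    edgeRomanNumber V G ≤ c := by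
  obtain ⟨f, h1, h2, h3, h4⟩ := h.exists_fun
  have hf : EdgeRDF G f := by
    refine ⟨h1, fun e he => ?_, fun e he => h3 e he (by simp)⟩
    by_contra hc
    exact he (h2 e hc).1
  have hm : ∑ e, f e ∈ {w | ∃ f : Sym2 V → ℕ, EdgeRDF G f ∧ w = ∑ e, f e} := ⟨f, hf, rfl⟩
  exact (Nat.sInf_le hm).trans h4

/-- Deleting `X` from `W` costs at most `k`. -/
def Del (G : SimpleGraph V) (W X : Finset V) (k : ℕ) : Prop :=
  ∀ c, Rom G (W \ X) c → Rom G W (c + k)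

lemma Del.trans {W X Y Z : Finset V} {k l : ℕ} (h : Del G W X k) (h' : Del G (W \ X) Y l)
    (hZ : Z = X ∪ Y) : Del G W Z (k + l) := by
  intro c hc
  subst hZ
  rw [show W \ (X ∪ Y) = (W \ X) \ Y by grind] at hc
  have := h _ (h' _ hc)
  rwa [add_assoc, add_comm l k] at this

lemma Del.congr {W X Y : Finset V} {k l : ℕ} (h : Del G W X k) (hX : Y = X) (hk : k ≤ l) :
    Del G W Y l := by
  subst hX
  exact fun c hc => (h c hc).mono (by omega)

lemma Del.pair {W : Finset V} {u v : V} (hu : u ∈ W) (hv : v ∈ W) (huv : G.Adj u v) :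
    Del G W {u, v} 2 := fun _ hc => .pair hu hv huv hc

lemma Rom.del {W C : Finset V} {k : ℕ} (h : Rom G C k) (hC : C ⊆ W)
    (hcl : ∀ x ∈ C, ∀ w ∈ W, G.Adj x w → w ∈ C) : Del G W C k := by
  intro c hc
  have := h.union hc (by grind) (fun a ha b hb hab => by
    have := hcl a ha b (mem_sdiff.mp hb).1 hab; grind)
  rwa [union_sdiff_of_subset hC, add_comm] at this

/-- `T` induces a path with end vertex `x`. -/
inductive Chain (G : SimpleGraph V) : V → Finset V → Prop
  | single (x : V) : Chain G x {x}
  | cons {x y : V} {T : Finset V} : Chain G y T → x ∉ T → G.Adj x y →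
      (∀ t ∈ T, G.Adj x t → t = y) → Chain G x (insert x T)

lemma Chain.mem {x : V} {T : Finset V} (h : Chain G x T) : x ∈ T := by
  cases h <;> simp

lemma Chain.conn {x : V} {T : Finset V} (h : Chain G x T) : ConnSet G T := by
  induction h with
  | single x => exact connSet_singleton x
  | cons hT _ hxy _ ih => exact ih.insert hT.mem hxy

lemma Chain.rom {x : V} {T : Finset V} (h : Chain G x T) : Rom G T (2 * T.card / 3) := by
  induction hn : T.card using Nat.strong_induction_on generalizing T x with
  | _ n ih =>
  cases h with
  | single =>
    exact .iso (mem_singleton_self x) (by simp) (by simpa using Rom.empty _)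
  | @cons _ y T hT hx hxy hxT =>
    cases hT with
    | single =>
      have h2 : n = 2 := by rw [← hn]; exact card_pair hxy.ne
      subst h2
      refine Rom.one (v := x) (w := y) (by simp) (by simp) hxy (fun t ht h => ?_) ?_
      · rcases mem_insert.mp ht with rfl | ht
        exacts [absurd rfl h.ne, hxT t ht h]
      rw [erase_insert hx]
      exact .iso (v := y) (by simp) (by simp) (by simpa using Rom.empty 0)
    | @cons _ z T hT hy hyz hyT =>
      have key : Rom G (T.erase z) (2 * (n - 3) / 3) := by
        cases hT with
        | single => simpa using Rom.empty _
        | @cons _ w T hT hz hzw hzT =>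
          rw [erase_insert hz]
          have hc : n = T.card + 3 := by
            rw [← hn, card_insert_of_notMem hx, card_insert_of_notMem hy, card_insert_of_notMem hz]
          have := ih T.card (by omega) hT rfl
          rwa [hc, Nat.add_sub_cancel]
      have hz := hT.mem
      have hc : 3 ≤ n := by
        rw [← hn, card_insert_of_notMem hx, card_insert_of_notMem hy]
        have := hT.conn.1.card_pos
        omega
      have := Rom.pair (W := insert x (insert y T)) (by simp) (by simp [hz]) hyz
        (c := 2 * (n - 3) / 3) ?_
      · exact this.mono (by omega)
      have hxz : ¬ G.Adj x z := fun h => by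
        have := hxT z (by simp [hz]) h
        grind
      have e : insert x (insert y T) \ {y, z} = insert x (T.erase z) := by grind
      rw [e]
      refine .iso (v := x) (by simp) ?_ (by rwa [erase_insert (by grind)])
      intro w hw hxw
      rcases mem_insert.mp hw with rfl | hw
      · exact hxw.ne rfl
      · have := hxT w (by grind) hxw
        grind

/-- `D` induces a 5-cycle. -/
def C5 (G : SimpleGraph V) (D : Finset V) : Prop :=
  ∃ a b c d e, Cyc5 G a b c d e ∧ D = {a, b, c, d, e}

lemma C5.rot {D : Finset V} (h : C5 G D) {x : V} (hx : x ∈ D) :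
    ∃ b c d e, Cyc5 G x b c d e ∧ D = {x, b, c, d, e} := by
  obtain ⟨a, b, c, d, e, h, rfl⟩ := h
  simp only [mem_insert, mem_singleton] at hx
  rcases hx with rfl | rfl | rfl | rfl | rfl
  · exact ⟨_, _, _, _, h, rfl⟩
  · exact ⟨_, _, _, _, h.rot, by grind⟩
  · exact ⟨_, _, _, _, h.rot.rot, by grind⟩
  · exact ⟨_, _, _, _, h.rot.rot.rot, by grind⟩
  · exact ⟨_, _, _, _, h.rot.rot.rot.rot, by grind⟩

lemma C5.card {D : Finset V} (h : C5 G D) : D.card = 5 := by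
  obtain ⟨a, b, c, d, e, h, rfl⟩ := h
  obtain ⟨h1, h2, h3, h4, h5, h6, h7, h8, h9, h10⟩ := h.nodup
  simp [card_insert_of_notMem, *]

lemma Cyc5.chain {a b c d e : V} (h : Cyc5 G a b c d e) : Chain G b {b, c, d, e} := by
  have hn := h.nodup
  refine .cons (.cons (.cons (.single e) (by grind) h.de (by grind)) (by grind) h.cd ?_)
    (by grind) h.bc ?_
  · have := h.ce; grind
  · have := h.bd; have := h.eb; have := @G.adj_symm; grind

lemma Cyc5.chain3 {a b c d e : V} (h : Cyc5 G a b c d e) : Chain G c {c, d, e} := by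
  have hn := h.nodup
  refine .cons (.cons (.single e) (by grind) h.de (by grind)) (by grind) h.cd ?_
  have := h.ce; grind

lemma Cyc5.erase {a b c d e : V} (h : Cyc5 G a b c d e) :
    ({a, b, c, d, e} : Finset V).erase a = {b, c, d, e} := by
  have hn := h.nodup
  grind

lemma C5.chain_erase {D : Finset V} (h : C5 G D) {x : V} (hx : x ∈ D) :
    ∃ y, Chain G y (D.erase x) := by
  obtain ⟨b, c, d, e, h', rfl⟩ := h.rot hx
  exact ⟨b, by rw [h'.erase]; exact h'.chain⟩

lemma C5.rom_erase {D : Finset V} (h : C5 G D) {x : V} (hx : x ∈ D) : Rom G (D.erase x) 2 := by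
  obtain ⟨y, hy⟩ := h.chain_erase hx
  have := hy.rom
  rwa [card_erase_of_mem hx, h.card] at this

lemma C5.conn_erase {D : Finset V} (h : C5 G D) {x : V} (hx : x ∈ D) : ConnSet G (D.erase x) := by
  obtain ⟨y, hy⟩ := h.chain_erase hx
  exact hy.conn

lemma C5.nonempty {D : Finset V} (h : C5 G D) : D.Nonempty := by
  rw [← card_pos, h.card]; decide

lemma C5.conn {D : Finset V} (h : C5 G D) : ConnSet G D := by
  obtain ⟨x, hx⟩ := h.nonempty
  obtain ⟨b, c, d, e, h', rfl⟩ := h.rot hx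
  exact h'.chain.conn.insert (by simp) h'.ab

lemma C5.rom {D : Finset V} (h : C5 G D) : Rom G D 4 := by
  obtain ⟨a, b, c, d, e, h, rfl⟩ := h
  refine .pair (u := a) (v := b) (by simp) (by simp) h.ab (c := 2) ?_
  have hn := h.nodup
  have e1 : ({a, b, c, d, e} : Finset V) \ {a, b} = {c, d, e} := by grind
  have := h.chain3.rom
  rw [e1]
  exact this.mono (by have := card_le_three (a := c) (b := d) (c := e); omega)

open scoped Classical in
/-- The vertices of `W` outside `D` with a neighbour in `D`. -/
noncomputable def nb (G : SimpleGraph V) (W D : Finset V) : Finset V :=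
  W.filter fun w => w ∉ D ∧ ∃ d ∈ D, G.Adj d w

lemma mem_nb {W D : Finset V} {w : V} : w ∈ nb G W D ↔ w ∈ W ∧ w ∉ D ∧ ∃ d ∈ D, G.Adj d w := by
  classical
  simp [nb]

lemma mem_or_mem_nb {W D : Finset V} {d w : V} (hd : d ∈ D) (hw : w ∈ W) (h : G.Adj d w) :
    w ∈ D ∨ w ∈ nb G W D := by
  by_cases hD : w ∈ D
  · exact Or.inl hD
  · exact Or.inr (mem_nb.mpr ⟨hw, hD, d, hd, h⟩)

lemma C5.del_insert {W D : Finset V} {z d : V} (h : C5 G D) (hD : D ⊆ W)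
    (hnb : nb G W D ⊆ {z}) (hz : z ∈ W) (hd : d ∈ D) (hzd : G.Adj z d) (hzD : z ∉ D) :
    Del G W (insert z D) 4 := by
  refine (Del.pair hz (hD hd) hzd).trans ((h.rom_erase hd).del ?_ ?_) ?_
  · grind
  · intro x hx w hw hxw
    have := mem_or_mem_nb (mem_of_mem_erase hx) (mem_sdiff.mp hw).1 hxw
    grind
  · grind

end Cost

section Crit

variable {V : Type*} [DecidableEq V] {G : SimpleGraph V}

open scoped Classical in
/-- The induced 5-cycles in `W` with at most one neighbour in `W`. -/
noncomputable def poor (G : SimpleGraph V) (W : Finset V) : Finset (Finset V) :=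
  W.powerset.filter fun D => C5 G D ∧ (nb G W D).card ≤ 1

lemma mem_poor {W D : Finset V} : D ∈ poor G W ↔ D ⊆ W ∧ C5 G D ∧ (nb G W D).card ≤ 1 := by
  classical
  simp [poor]

/-- The bound `3/4 |W|`, corrected by the number of poor 5-cycles. -/
def Good (G : SimpleGraph V) (W : Finset V) : Prop :=
  ∃ c, Rom G W c ∧ 4 * c ≤ 3 * W.card + (poor G W).card

/-- `W` is a minimal counterexample. -/
structure Crit (G : SimpleGraph V) (W : Finset V) : Prop where
  noTheta : NoTheta G
  good : ∀ W' ⊂ W, Good G W'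
  bad : ¬ Good G W

open scoped Classical in
/-- The induced 5-cycles with at least two neighbours, all of them in `X`. -/
noncomputable def hang (G : SimpleGraph V) (W X : Finset V) : Finset (Finset V) :=
  (W \ X).powerset.filter fun D => C5 G D ∧ nb G W D ⊆ X ∧ 2 ≤ (nb G W D).card

lemma mem_hang {W X D : Finset V} :
    D ∈ hang G W X ↔ D ⊆ W \ X ∧ C5 G D ∧ nb G W D ⊆ X ∧ 2 ≤ (nb G W D).card := by
  classical
  simp [hang]

lemma C5.eq_of_subset {D D' : Finset V} (h : C5 G D) (h' : C5 G D') (hs : D ⊆ D') : D = D' :=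
  eq_of_subset_of_card_le hs (by rw [h.card, h'.card])

/-- A connected set avoiding the neighbours of `D` and meeting `D` is inside `D`. -/
lemma ConnSet.subset_of_nb {W C D : Finset V} (hC : ConnSet G C) (hCW : C ⊆ W)
    (hCD : (C ∩ D).Nonempty) (h : ∀ x ∈ C, x ∉ nb G W D) : C ⊆ D :=
  hC.subset_of_closed hCD fun _ _ ha b hb hab =>
    (mem_or_mem_nb ha (hCW hb) hab).resolve_right (h b hb)

lemma C5.eq_of_nb {W D D' : Finset V} (h : C5 G D) (h' : C5 G D') (hW : D' ⊆ W)
    (hn : ∀ x ∈ D', x ∉ nb G W D) (hi : ¬ ∀ x ∈ D, x ∉ D') : D = D' := by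
  push Not at hi
  obtain ⟨x, hx, hx'⟩ := hi
  exact (h'.eq_of_subset h (h'.conn.subset_of_nb hW ⟨x, mem_inter.mpr ⟨hx', hx⟩⟩ hn)).symm

lemma touch_of_mem_nb {W D : Finset V} {z : V} (h : z ∈ nb G W D) : Touch G {z} D := by
  obtain ⟨-, -, d, hd, hdz⟩ := mem_nb.mp h
  exact ⟨z, by simp, d, hd, hdz.symm⟩

/-- Deleting a connected set `X` cheaply is impossible in a minimal counterexample. -/
lemma Crit.false_of_del {W X : Finset V} {k : ℕ} (hW : Crit G W) (hX : X ⊆ W)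
    (hc : ConnSet G X) (hd : Del G W X k) (hk : 4 * k + (hang G W X).card ≤ 3 * X.card) :
    False := by
  induction hn : (W \ X).card using Nat.strong_induction_on generalizing X k with
  | _ n ih =>
  have hss : W \ X ⊂ W := by
    obtain ⟨x, hx⟩ := hc.1
    exact ⟨sdiff_subset, fun h => (mem_sdiff.mp (h (hX hx))).2 hx⟩
  by_cases hsub : poor G (W \ X) ⊆ poor G W ∪ hang G W X
  · obtain ⟨c, hr, hcc⟩ := hW.good _ hss
    refine hW.bad ⟨_, hd _ hr, ?_⟩
    have h1 := card_le_card hsub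
    have h2 := card_union_le (poor G W) (hang G W X)
    have h3 := card_sdiff_add_card_eq_card hX
    omega
  · obtain ⟨D, hD, hDn⟩ := not_subset.mp hsub
    obtain ⟨hDW, hD5, hD1⟩ := mem_poor.mp hD
    have hDW' : D ⊆ W := hDW.trans sdiff_subset
    have hDX : ∀ x ∈ X, x ∉ D := fun x hx h => (mem_sdiff.mp (hDW h)).2 hx
    have hD2 : 2 ≤ (nb G W D).card := by
      by_contra hlt
      exact hDn (mem_union_left _ (mem_poor.mpr ⟨hDW', hD5, by omega⟩))
    have hDnX : ¬ nb G W D ⊆ X := fun h =>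
      hDn (mem_union_right _ (mem_hang.mpr ⟨hDW, hD5, h, hD2⟩))
    obtain ⟨z, hz, hzX⟩ := not_subset.mp hDnX
    obtain ⟨hzW, hzD, d, hdD, hdz⟩ := mem_nb.mp hz
    have hz' : z ∈ nb G (W \ X) D := mem_nb.mpr ⟨mem_sdiff.mpr ⟨hzW, hzX⟩, hzD, d, hdD, hdz⟩
    have hnb : nb G (W \ X) D ⊆ {z} := fun w hw =>
      mem_singleton.mpr (card_le_one.mp hD1 w hw z hz')
    obtain ⟨y, hy, hyz⟩ : ∃ y ∈ nb G W D, y ≠ z := by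
      obtain ⟨y, hy, hyz⟩ := exists_mem_ne hD2 z
      exact ⟨y, hy, hyz⟩
    have hyX : y ∈ X := by
      by_contra hyX
      obtain ⟨h1, h2, h3⟩ := mem_nb.mp hy
      exact hyz (mem_singleton.mp (hnb (mem_nb.mpr ⟨mem_sdiff.mpr ⟨h1, hyX⟩, h2, h3⟩)))
    have hXD : Touch G X D := (touch_of_mem_nb hy).mono (by simpa using hyX) subset_rfl
    have hX1 : X ∪ insert z D ⊆ W := union_subset hX (insert_subset hzW hDW')
    have hcard : (X ∪ insert z D).card = X.card + 6 := by
      rw [card_union_of_disjoint, card_insert_of_notMem hzD, hD5.card]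
      rw [Finset.disjoint_left]
      intro x hx hx'
      rcases mem_insert.mp hx' with rfl | h
      exacts [hzX hx, hDX x hx h]
    have new : ∀ E ∈ hang G W (X ∪ insert z D) \ hang G W X, C5 G E ∧ E ⊆ W ∧ z ∉ E ∧
        (∀ x ∈ X, x ∉ E) ∧ (∀ x ∈ D, x ∉ E) ∧ nb G W E ⊆ insert z X ∧ z ∈ nb G W E ∧
        Touch G X E := by
      intro E hE
      obtain ⟨hE, hE'⟩ := mem_sdiff.mp hE
      obtain ⟨hEW, hE5, hEn, hE2⟩ := mem_hang.mp hE
      have hEW' : E ⊆ W := hEW.trans sdiff_subset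
      have hEX : ∀ x ∈ X, x ∉ E := fun x hx h => by
        have := (mem_sdiff.mp (hEW h)).2
        exact this (mem_union_left _ hx)
      have hEz : z ∉ E := fun h => (mem_sdiff.mp (hEW h)).2 (by simp)
      have hED : ∀ x ∈ D, x ∉ E := fun x hx h => (mem_sdiff.mp (hEW h)).2 (by simp [hx])
      have h1 : nb G W E ⊆ insert z X := by
        intro w hw
        have hw' := hEn hw
        obtain ⟨hwW, -, e, he, hew⟩ := mem_nb.mp hw
        simp only [mem_union, mem_insert] at hw' ⊢
        rcases hw' with h | h | h
        · exact Or.inr h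
        · exact Or.inl h
        · exfalso
          have : e ∈ nb G (W \ X) D := mem_nb.mpr
            ⟨mem_sdiff.mpr ⟨hEW' he, fun h => hEX e h he⟩, fun h' => hED e h' he, w, h, hew.symm⟩
          exact hEz (mem_singleton.mp (hnb this) ▸ he)
      have h2 : z ∈ nb G W E := by
        by_contra hz
        refine hE' (mem_hang.mpr ⟨fun e he => mem_sdiff.mpr ⟨hEW' he, fun h => hEX e h he⟩, hE5,
          fun w hw => ?_, hE2⟩)
        rcases mem_insert.mp (h1 hw) with rfl | h
        exacts [absurd hw hz, h]
      obtain ⟨y, hy, hyz⟩ := exists_mem_ne hE2 z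
      have hyX : y ∈ X := (mem_insert.mp (h1 hy)).resolve_left hyz
      exact ⟨hE5, hEW', hEz, hEX, hED, h1, h2,
        (touch_of_mem_nb hy).mono (by simpa using hyX) subset_rfl⟩
    have hle : (hang G W (X ∪ insert z D) \ hang G W X).card ≤ 1 := by
      rw [card_le_one]
      intro E hE F hF
      obtain ⟨e1, e2, e3, e4, e5, e6, e7, e8⟩ := new E hE
      obtain ⟨f1, f2, f3, f4, f5, f6, f7, f8⟩ := new F hF
      by_contra hne
      refine hW.noTheta.conn z X D E F hc hzX ⟨hD5.conn, hzD, hDX, touch_of_mem_nb hz, hXD⟩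
        ⟨e1.conn, e3, e4, touch_of_mem_nb e7, e8⟩ ⟨f1.conn, f3, f4, touch_of_mem_nb f7, f8⟩ e5 f5 ?_
      by_contra hi
      refine hne (e1.eq_of_nb f1 f2 (fun x hx hx' => ?_) hi)
      rcases mem_insert.mp (e6 hx') with rfl | h
      exacts [f3 hx, f4 x h hx]
    refine ih (W \ (X ∪ insert z D)).card ?_ hX1 ?_ (hd.trans (hD5.del_insert hDW hnb
      (mem_sdiff.mpr ⟨hzW, hzX⟩) hdD hdz.symm hzD) rfl) ?_ rfl
    · have h1 := card_sdiff_add_card_eq_card hX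
      have h2 := card_sdiff_add_card_eq_card hX1
      omega
    · exact hc.union (hD5.conn.insert hdD hdz.symm)
        (Or.inl (hXD.mono subset_rfl (subset_insert _ _)))
    · have := card_le_card_sdiff_add_card (s := hang G W (X ∪ insert z D)) (t := hang G W X)
      omega

lemma nb_of_closed {W A D : Finset V} (hA : A ⊆ W) (hDA : D ⊆ A)
    (hcl : ∀ a ∈ A, ∀ w ∈ W, G.Adj a w → w ∈ A) : nb G W D = nb G A D := by
  ext w
  simp only [mem_nb]
  constructor
  · rintro ⟨h1, h2, d, hd, h⟩
    exact ⟨hcl d (hDA hd) w h1 h, h2, d, hd, h⟩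
  · rintro ⟨h1, h⟩
    exact ⟨hA h1, h⟩

lemma Crit.nonempty {W : Finset V} (hW : Crit G W) : W.Nonempty := by
  rw [nonempty_iff_ne_empty]
  rintro rfl
  exact hW.bad ⟨0, .empty 0, by simp⟩

lemma Crit.conn {W : Finset V} (hW : Crit G W) : ConnSet G W := by
  refine ⟨hW.nonempty, fun P hP hne hPW => ?_⟩
  by_contra ht
  have hcl : ∀ a ∈ P, ∀ w ∈ W, G.Adj a w → w ∈ P := fun a ha w hw h => by
    by_contra hwP
    exact ht ⟨a, ha, w, mem_sdiff.mpr ⟨hw, hwP⟩, h⟩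
  have hcl' : ∀ a ∈ W \ P, ∀ w ∈ W, G.Adj a w → w ∈ W \ P := fun a ha w hw h => by
    by_contra hwP
    exact (mem_sdiff.mp ha).2 (hcl w (by simpa [hw] using hwP) a (mem_sdiff.mp ha).1 h.symm)
  have hss : W \ P ⊂ W := by
    obtain ⟨x, hx⟩ := hne
    exact ⟨sdiff_subset, fun h => (mem_sdiff.mp (h (hP hx))).2 hx⟩
  obtain ⟨c, hc, hc'⟩ := hW.good P (hP.ssubset_of_ne hPW)
  obtain ⟨d, hd, hd'⟩ := hW.good _ hss
  have hr := hc.del hP hcl d hd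
  refine hW.bad ⟨_, hr, ?_⟩
  have h1 : Disjoint (poor G P) (poor G (W \ P)) := by
    rw [Finset.disjoint_left]
    intro D h h'
    obtain ⟨h1, h2, -⟩ := mem_poor.mp h
    obtain ⟨h3, -, -⟩ := mem_poor.mp h'
    obtain ⟨x, hx⟩ := h2.nonempty
    exact (mem_sdiff.mp (h3 hx)).2 (h1 hx)
  have h2 : poor G P ∪ poor G (W \ P) ⊆ poor G W := by
    intro D h
    rcases mem_union.mp h with h | h
    · obtain ⟨h1, h2, h3⟩ := mem_poor.mp h
      exact mem_poor.mpr ⟨h1.trans hP, h2, by rwa [nb_of_closed hP h1 hcl]⟩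
    · obtain ⟨h1, h2, h3⟩ := mem_poor.mp h
      exact mem_poor.mpr ⟨h1.trans sdiff_subset, h2, by rwa [nb_of_closed sdiff_subset h1 hcl']⟩
  have h3 := card_le_card h2
  rw [card_union_of_disjoint h1] at h3
  have h4 := card_sdiff_add_card_eq_card hP
  omega

lemma hang_eq_empty {W X : Finset V}
    (h : ∀ D, D ⊆ W \ X → C5 G D → nb G W D ⊆ X → 2 ≤ (nb G W D).card → False) :
    (hang G W X).card = 0 := by
  rw [card_eq_zero, eq_empty_iff_forall_notMem]
  intro D hD
  obtain ⟨h1, h2, h3, h4⟩ := mem_hang.mp hD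
  exact h D h1 h2 h3 h4

/-- Every 5-cycle has at least two neighbours. -/
lemma Crit.two_le_nb {W D : Finset V} (hW : Crit G W) (hDW : D ⊆ W) (hD : C5 G D) :
    2 ≤ (nb G W D).card := by
  by_contra hlt
  rcases (nb G W D).eq_empty_or_nonempty with he | ⟨z, hz⟩
  · have hcl : W ⊆ D := hW.conn.subset_of_nb subset_rfl
      (by rw [inter_eq_right.mpr hDW]; exact hD.nonempty) (by simp [he])
    obtain rfl := subset_antisymm hDW hcl
    refine hW.bad ⟨4, hD.rom, ?_⟩
    have : 0 < (poor G D).card := card_pos.mpr ⟨D, mem_poor.mpr ⟨hDW, hD, by omega⟩⟩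
    have := hD.card
    omega
  · obtain ⟨hzW, hzD, d, hdD, hdz⟩ := mem_nb.mp hz
    have hnb : nb G W D ⊆ {z} := fun w hw =>
      mem_singleton.mpr (card_le_one.mp (by omega) w hw z hz)
    refine hW.false_of_del (insert_subset hzW hDW) (hD.conn.insert hdD hdz.symm)
      (hD.del_insert hDW hnb hzW hdD hdz.symm hzD) ?_
    rw [hang_eq_empty, card_insert_of_notMem hzD, hD.card]
    · decide
    · intro E hE hE5 hEn hE2
      obtain ⟨y, hy, hyz⟩ := exists_mem_ne hE2 z
      obtain ⟨hyW, hyE, e, he, hey⟩ := mem_nb.mp hy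
      have hyD : y ∈ D := (mem_insert.mp (hEn hy)).resolve_left hyz
      have heE := mem_sdiff.mp (hE he)
      have : e ∈ nb G W D := mem_nb.mpr ⟨heE.1, fun h => heE.2 (mem_insert_of_mem h), y, hyD,
        hey.symm⟩
      exact heE.2 (mem_insert.mpr (Or.inl (mem_singleton.mp (hnb this))))

lemma Crit.exists_hang {W X : Finset V} {k : ℕ} (hW : Crit G W) (hX : X ⊆ W)
    (hc : ConnSet G X) (hd : Del G W X k) (hk : 4 * k ≤ 3 * X.card) :
    ∃ D, D ⊆ W \ X ∧ C5 G D ∧ nb G W D ⊆ X := by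
  by_contra hno
  push Not at hno
  refine hW.false_of_del hX hc hd ?_
  rw [hang_eq_empty fun D h1 h2 h3 _ => hno D h1 h2 h3]
  exact hk

lemma notMem_of_mem_nb {W D E : Finset V} {x : V} (hE : E ⊆ W) (hED : ∀ e ∈ E, e ∉ D)
    (hn : ∀ e ∈ E, e ∉ nb G W D) (hx : x ∈ nb G W E) : x ∉ D := by
  intro hxD
  obtain ⟨hxW, hxE, e, he, hex⟩ := mem_nb.mp hx
  rcases mem_or_mem_nb hxD (hE he) hex.symm with h | h
  exacts [hED e he h, hn e he h]

lemma link_of_nb {W B : Finset V} {u v : V} (hB : ConnSet G B) (hu : u ∈ nb G W B)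
    (hv : v ∈ nb G W B) : Link G u {v} B :=
  ⟨hB, (mem_nb.mp hu).2.1, by simpa using (mem_nb.mp hv).2.1, touch_of_mem_nb hu,
    touch_of_mem_nb hv⟩

lemma C5.exists_two {D : Finset V} (h : C5 G D) {x : V} (hx : x ∈ D) :
    ∃ a ∈ D, ∃ b ∈ D, a ≠ b ∧ G.Adj x a ∧ G.Adj x b := by
  obtain ⟨b, c, d, e, h', rfl⟩ := h.rot hx
  exact ⟨b, by simp, e, by simp, h'.nodup.2.2.2.2.2.2.1, h'.ab, h'.ea.symm⟩

lemma Crit.eq_of_nb_pair {W D D' : Finset V} {u v : V} (hW : Crit G W) (hDW : D ⊆ W)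
    (hD : C5 G D) (huv : u ≠ v) (hn : nb G W D = {u, v}) (hDW' : D' ⊆ W) (hD' : C5 G D')
    (hn' : nb G W D' ⊆ {u, v}) : D = D' := by
  by_contra hne
  have eqn : ∀ E ⊆ W, C5 G E → nb G W E ⊆ {u, v} → nb G W E = {u, v} := fun E h1 h2 h3 =>
    eq_of_subset_of_card_le h3 (by rw [card_pair huv]; exact hW.two_le_nb h1 h2)
  replace hn' := eqn D' hDW' hD' hn'
  have hu : u ∈ nb G W D := by simp [hn]
  have hv : v ∈ nb G W D := by simp [hn]
  have hu' : u ∈ nb G W D' := by simp [hn']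
  have hv' : v ∈ nb G W D' := by simp [hn']
  have hdj : ∀ x ∈ D, x ∉ D' := by
    by_contra hi
    refine hne (hD.eq_of_nb hD' hDW' (fun x hx => ?_) hi)
    rw [hn, ← hn']
    exact fun h => (mem_nb.mp h).2.1 hx
  obtain ⟨huW, huD, d, hd, hdu⟩ := mem_nb.mp hu
  obtain ⟨hvW, hvD, c, hc, hcv⟩ := mem_nb.mp hv
  obtain ⟨-, huD', -⟩ := mem_nb.mp hu'
  obtain ⟨-, hvD', d', hd', hdv'⟩ := mem_nb.mp hv'
  have hdD' := hdj d hd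
  have p1 : Del G W {u, d} 2 := Del.pair huW (hDW hd) hdu.symm
  have p2 : Del G (W \ {u, d}) (insert v D') 4 := by
    refine hD'.del_insert (by grind) (fun w hw => ?_) (by grind) hd' hdv'.symm hvD'
    obtain ⟨h1, h2, e, he, hew⟩ := mem_nb.mp hw
    have := mem_or_mem_nb he (mem_sdiff.mp h1).1 hew
    rw [hn'] at this
    grind
  have p3 : Del G (W \ ({u, d} ∪ insert v D')) (D.erase d) 2 := by
    refine (hD.rom_erase hd).del (by grind) (fun x hx w hw hxw => ?_)
    have := mem_or_mem_nb (mem_of_mem_erase hx) (W := W) (by grind) hxw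
    rw [hn] at this
    grind
  have p := (p1.trans p2 rfl).trans p3 rfl
  obtain ⟨E, hE, hE5, hEn⟩ := hW.exists_hang (X := insert u D ∪ insert v D') (by grind)
    ((hD.conn.insert hd hdu.symm).union (hD'.conn.insert hd' hdv'.symm)
      (Or.inl ⟨c, by simp [hc], v, by simp, hcv⟩)) (p.congr (by grind) le_rfl) (by
        rw [card_union_of_disjoint (by rw [Finset.disjoint_left]; grind),
          card_insert_of_notMem huD, card_insert_of_notMem hvD', hD.card, hD'.card]
        decide)
  have hEW : E ⊆ W := by grind
  have hEn2 : nb G W E ⊆ {u, v} := by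
    intro x hx
    have h1 := notMem_of_mem_nb hEW (D := D) (by grind) (by rw [hn]; grind) hx
    have h2 := notMem_of_mem_nb hEW (D := D') (by grind) (by rw [hn']; grind) hx
    have := hEn hx
    grind
  have hEn3 := eqn E hEW hE5 hEn2
  exact hW.noTheta u v D D' E huv (link_of_nb hD.conn hu hv) (link_of_nb hD'.conn hu' hv')
    (link_of_nb (W := W) hE5.conn (by simp [hEn3]) (by simp [hEn3])) hdj (by grind) (by grind)

/-- Two induced 5-cycles sharing exactly four vertices form a theta. -/
lemma NoTheta.false_of_erase_subset {D' D'' : Finset V} {d' : V} (hG : NoTheta G) (hD' : C5 G D')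
    (hD'' : C5 G D'') (hd' : d' ∈ D') (hdD : d' ∉ D'') (hsub : D'.erase d' ⊆ D'') : False := by
  obtain ⟨t, ht⟩ : ∃ t, D'' \ D'.erase d' = {t} := by
    rw [← card_eq_one]
    have := card_sdiff_add_card_eq_card hsub
    rw [card_erase_of_mem hd', hD'.card, hD''.card] at this
    omega
  obtain ⟨a, b, f, g, h5, rfl⟩ := hD'.rot hd'
  have hnd := h5.nodup
  rw [h5.erase] at hsub ht
  have hDt : D'' = {t, a, b, f, g} := by
    rw [← sdiff_union_of_subset hsub, ht]; rfl
  have hta : G.Adj t a := by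
    obtain ⟨r, hr, s, hs, hrs, har, has⟩ := hD''.exists_two (x := a) (by grind)
    rw [hDt] at hr hs
    have := h5.bd; have h2 := h5.eb; have := G.adj_comm g a; have := har.ne; have := has.ne
    have := G.adj_comm t a
    grind
  have htg : G.Adj t g := by
    obtain ⟨r, hr, s, hs, hrs, har, has⟩ := hD''.exists_two (x := g) (by grind)
    rw [hDt] at hr hs
    have := h5.ce; have h2 := h5.eb; have := G.adj_comm g b; have := har.ne; have := has.ne
    have := G.adj_comm t g
    grind
  have htn : t ∉ ({a, b, f, g} : Finset V) := by
    have : t ∈ D'' \ {a, b, f, g} := by simp [ht]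
    exact (mem_sdiff.mp this).2
  have single : ∀ z, G.Adj z a → G.Adj z g → Link G a {g} {z} := fun z h1 h2 =>
    ⟨connSet_singleton z, by simpa using h1.ne', by simpa using h2.ne',
      ⟨a, by simp, z, by simp, h1.symm⟩, ⟨g, by simp, z, by simp, h2.symm⟩⟩
  refine hG a g {d'} {t} {b, f} (by grind) (single d' h5.ab h5.ea.symm)
    (single t hta htg) ⟨(connSet_singleton f).insert (by simp) h5.cd, by grind, by grind,
      ⟨a, by simp, b, by simp, h5.bc⟩, ⟨g, by simp, f, by simp, h5.de.symm⟩⟩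
      ?_ (by grind) (by grind)
  simp only [mem_singleton, forall_eq]
  rintro rfl
  exact hdD (by simp [hDt])

/-- A further neighbour of one of the two neighbours of a 5-cycle is impossible. -/
lemma Crit.not_adj_of_nb_pair {W D : Finset V} {u v y : V} (hW : Crit G W) (hDW : D ⊆ W)
    (hD : C5 G D) (huv : u ≠ v) (hn : nb G W D = {u, v}) (hyW : y ∈ W) (hyD : y ∉ D)
    (hyu : y ≠ u) (hyv : y ≠ v) : ¬ G.Adj v y := by
  intro hvy
  have hu : u ∈ nb G W D := by simp [hn]
  have hv : v ∈ nb G W D := by simp [hn]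
  obtain ⟨huW, huD, d, hd, hdu⟩ := mem_nb.mp hu
  obtain ⟨hvW, hvD, c, hc, hcv⟩ := mem_nb.mp hv
  have p1 : Del G W {v, y} 2 := Del.pair hvW hyW hvy
  have p2 : Del G (W \ {v, y}) (insert u D) 4 := by
    refine hD.del_insert (by grind) (fun w hw => ?_) (by grind) hd hdu.symm huD
    obtain ⟨h1, h2, e, he, hew⟩ := mem_nb.mp hw
    have := mem_or_mem_nb he (mem_sdiff.mp h1).1 hew
    rw [hn] at this
    grind
  obtain ⟨D', hD', hD5', hDn'⟩ := hW.exists_hang (X := insert y (insert u (insert v D)))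
    (by grind) (((hD.conn.insert hc hcv.symm).insert (by simp [hd]) hdu.symm).insert (y := v)
      (by simp) hvy.symm) ((p1.trans p2 rfl).congr (by grind) le_rfl)
    (by
      rw [card_insert_of_notMem (by grind), card_insert_of_notMem (by grind),
        card_insert_of_notMem hvD, hD.card])
  have hDW' : D' ⊆ W := by grind
  have hDn2 : nb G W D' ⊆ {u, v, y} := by
    intro x hx
    have h1 := notMem_of_mem_nb hDW' (D := D) (by grind) (by rw [hn]; grind) hx
    have := hDn' hx
    grind
  obtain ⟨p, q, hpq, hpq', hp⟩ : ∃ p q, p ≠ q ∧ nb G W D = {p, q} ∧ p ∈ nb G W D' := by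
    obtain ⟨x, hx, hxy⟩ := exists_mem_ne (hW.two_le_nb hDW' hD5') y
    have := hDn2 hx
    simp only [mem_insert, mem_singleton, hxy, or_false] at this
    rcases this with rfl | rfl
    exacts [⟨x, v, huv, hn, hx⟩, ⟨x, u, huv.symm, by rw [hn, pair_comm], hx⟩]
  have huvpq : ({u, v} : Finset V) = {p, q} := by rw [← hn, hpq']
  have memuv : ∀ x, x = u ∨ x = v ↔ x = p ∨ x = q := fun x => by
    have : x ∈ ({u, v} : Finset V) ↔ x ∈ ({p, q} : Finset V) := by rw [huvpq]
    simpa using this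
  have hfull := fun E h1 h2 h3 => hW.eq_of_nb_pair (D' := E) hDW hD hpq hpq' h1 h2 h3
  have hpD : p ∈ nb G W D := by simp [hpq']
  have hqD : q ∈ nb G W D := by simp [hpq']
  clear hu hv hd hdu d hc hcv c huW huD hvW hvD p1 p2
  obtain ⟨hpW, hpD, d, hd, hdp⟩ := mem_nb.mp hpD
  obtain ⟨hqW, hqD, c, hc, hcq⟩ := mem_nb.mp hqD
  obtain ⟨-, hpD', d', hd', hdp'⟩ := mem_nb.mp hp
  have hDD' : ∀ x ∈ D, x ∉ D' := by grind
  have hqD' : q ∉ D' := fun h => by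
    have := (memuv q).mpr (Or.inr rfl); have := hD' h; grind
  have hDn3 : nb G W D' ⊆ {p, q, y} := fun x hx => by
    have := hDn2 hx; have := memuv x; grind
  clear hDn2 hDn' hD' memuv huvpq hn hyu hyv hvy huv
  clear u v
  have hd'D : d' ∉ D := fun h => hDD' _ h hd'
  have p1 : Del G W {p, d'} 2 := Del.pair hpW (hDW' hd') hdp'.symm
  have p2 : Del G (W \ {p, d'}) (insert q D) 4 := by
    refine hD.del_insert (by grind) (fun w hw => ?_) (by grind) hc hcq.symm hqD
    obtain ⟨h1, h2, e, he, hew⟩ := mem_nb.mp hw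
    have := mem_or_mem_nb he (mem_sdiff.mp h1).1 hew
    rw [hpq'] at this
    grind
  have p12 := (p1.trans p2 rfl)
  have hc1 : ConnSet G (insert p (insert q D)) :=
    (hD.conn.insert hc hcq.symm).insert (by simp [hd]) hdp.symm
  obtain ⟨D'', hD'', hD5'', hDn''⟩ := hW.exists_hang (X := insert d' (insert p (insert q D)))
    (by grind) (hc1.insert (y := p) (by simp) hdp') (p12.congr (by grind) le_rfl)
    (by
      rw [card_insert_of_notMem (by grind), card_insert_of_notMem (by grind),
        card_insert_of_notMem hqD, hD.card])
  have hDW'' : D'' ⊆ W := by grind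
  have hDn4 : nb G W D'' ⊆ {p, q, d'} := by
    intro x hx
    have h1 := notMem_of_mem_nb hDW'' (D := D) (by grind) (by rw [hpq']; grind) hx
    have := hDn'' hx
    grind
  have hd'n : d' ∈ nb G W D'' := by
    by_contra hno
    have : D = D'' := hfull D'' hDW'' hD5'' fun x hx => by have := hDn4 hx; grind
    obtain ⟨x, hx⟩ := hD.nonempty
    grind
  obtain ⟨-, hdD, e, he, hed'⟩ := mem_nb.mp hd'n
  have hDD'' : ∀ x ∈ D, x ∉ D'' := by grind
  have hpD'' : p ∉ D'' := by grind
  have hqD'' : q ∉ D'' := by grind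
  clear hDn'' hD''
  by_cases hi : ∀ x ∈ D', x ∉ D''
  · have hyD'' : y ∈ D'' := by
      rcases mem_or_mem_nb hd' (hDW'' he) hed'.symm with h | h
      · exact absurd he (hi e h)
      · have := hDn3 h; grind
    have p3 : Del G (W \ ({p, d'} ∪ insert q D)) D'' 4 := by
      refine hD5''.rom.del (by grind) (fun x hx w hw hxw => ?_)
      have := mem_or_mem_nb hx (W := W) (by grind) hxw
      grind
    have p123 := p12.trans p3 rfl
    have p4 : Del G (W \ ({p, d'} ∪ insert q D ∪ D'')) (D'.erase d') 2 := by
      refine (hD5'.rom_erase hd').del (by grind) (fun x hx w hw hxw => ?_)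
      have := mem_or_mem_nb (mem_of_mem_erase hx) (W := W) (by grind) hxw
      grind
    have hcX : ConnSet G (insert p (insert q D) ∪ D' ∪ D'') :=
      (hc1.union hD5'.conn (Or.inl ⟨p, by simp, d', hd', hdp'.symm⟩)).union hD5''.conn
        (Or.inl ⟨d', by simp [hd'], e, he, hed'.symm⟩)
    obtain ⟨E, hE, hE5, hEn⟩ := hW.exists_hang (X := insert p (insert q D) ∪ D' ∪ D'')
      (by grind) hcX ((p123.trans p4 rfl).congr (by grind) le_rfl)
      (by
        rw [card_union_of_disjoint (by rw [Finset.disjoint_left]; grind),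
          card_union_of_disjoint (by rw [Finset.disjoint_left]; grind),
          card_insert_of_notMem (by grind),
          card_insert_of_notMem hqD, hD.card, hD5'.card, hD5''.card]
        decide)
    have hEW : E ⊆ W := by grind
    have : D = E := hfull E hEW hE5 fun x hx => by
      have h1 := notMem_of_mem_nb hEW (D := D) (by grind) (by rw [hpq']; grind) hx
      have h2 := notMem_of_mem_nb hEW (D := D') (by grind) (by grind) hx
      have h3 := notMem_of_mem_nb hEW (D := D'') (by grind) (by grind) hx
      have := hEn hx
      grind
    obtain ⟨x, hx⟩ := hD.nonempty
    grind
  · have hsub : D'.erase d' ⊆ D'' := by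
      refine (hD5'.conn_erase hd').subset_of_nb (W := W) (by grind) ?_ ?_
      · push Not at hi
        obtain ⟨x, hx, hx'⟩ := hi
        exact ⟨x, by grind⟩
      · intro x hx hx'
        have := hDn4 hx'
        grind
    exact hW.noTheta.false_of_erase_subset hD5' hD5'' hd' hdD hsub

lemma Rom.iso_pair {w x y : V} (hxy : G.Adj x y) (hx : ¬ G.Adj w x) (hy : ¬ G.Adj w y) :
    Rom G {w, x, y} 1 := by
  have hp : Rom G {x, y} 1 := by
    refine .one (v := x) (w := y) (by simp) (by simp) hxy ?_ (c := 0) ?_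
    · simp only [mem_insert, mem_singleton]
      rintro t (rfl | rfl) h
      exacts [absurd rfl h.ne, rfl]
    · refine .iso (v := y) (by simp [hxy.ne']) ?_ ?_
      · simp only [mem_erase, mem_insert, mem_singleton]
        rintro t ⟨h1, rfl | rfl⟩ h
        exacts [h1 rfl, h.ne rfl]
      · have : (({x, y} : Finset V).erase x).erase y = ∅ := by grind
        rw [this]; exact .empty 0
  by_cases h : w = x ∨ w = y
  · have : ({w, x, y} : Finset V) = {x, y} := by grind
    rwa [this]
  · refine .iso (v := w) (by simp) ?_ ?_
    · simp only [mem_insert, mem_singleton]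
      rintro t (rfl | rfl | rfl)
      exacts [G.loopless.irrefl _, hx, hy]
    · rwa [erase_insert (by simpa using h)]

lemma Cyc5.rom_seven {a b c d e u v : V} (h : Cyc5 G a b c d e)
    (hu : u ∉ ({a, b, c, d, e} : Finset V))
    (hv : v ∉ ({a, b, c, d, e} : Finset V)) (huv : u ≠ v) (hua : G.Adj u a)
    (hc : G.Adj v c ∨ ¬ G.Adj v d ∧ ¬ G.Adj v e) : Rom G {u, v, a, b, c, d, e} 5 := by
  have hnd := h.nodup
  simp only [mem_insert, mem_singleton, not_or] at hu hv
  refine .pair (u := u) (v := a) (by simp) (by simp) hua (c := 3) ?_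
  have e1 : ({u, v, a, b, c, d, e} : Finset V) \ {u, a} = {v, b, c, d, e} := by grind
  rw [e1]
  rcases hc with hvc | ⟨hvd, hve⟩
  · refine .pair (u := v) (v := c) (by simp) (by simp) hvc (c := 1) ?_
    have e2 : ({v, b, c, d, e} : Finset V) \ {v, c} = {b, d, e} := by grind
    rw [e2]
    exact Rom.iso_pair h.de h.bd fun h' => h.eb h'.symm
  · refine .pair (u := b) (v := c) (by simp) (by simp) h.bc (c := 1) ?_
    have e2 : ({v, b, c, d, e} : Finset V) \ {b, c} = {v, d, e} := by grind
    rw [e2]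
    exact Rom.iso_pair h.de hvd hve

lemma link_singleton {a b z : V} (h1 : G.Adj z a) (h2 : G.Adj z b) : Link G a {b} {z} :=
  ⟨connSet_singleton z, by simpa using h1.ne', by simpa using h2.ne',
    ⟨a, by simp, z, by simp, h1.symm⟩, ⟨b, by simp, z, by simp, h2.symm⟩⟩

lemma link_pair {a b x y : V} (hxy : G.Adj x y) (h1 : G.Adj a x) (h2 : G.Adj y b) (ha : a ≠ y)
    (hb : b ≠ x) : Link G a {b} {x, y} :=
  ⟨(connSet_singleton y).insert (by simp) hxy, by have := h1.ne; simp_all, by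
    have := h2.ne'; simp_all, ⟨a, by simp, x, by simp, h1⟩, ⟨b, by simp, y, by simp, h2.symm⟩⟩

/-- Every 5-cycle has at least three neighbours. -/
lemma Crit.three_le_nb {W D : Finset V} (hW : Crit G W) (hDW : D ⊆ W) (hD : C5 G D) :
    3 ≤ (nb G W D).card := by
  by_contra hlt
  have h2 : (nb G W D).card = 2 := by
    have := hW.two_le_nb hDW hD
    omega
  obtain ⟨u, v, huv, hn⟩ := card_eq_two.mp h2
  have hu : u ∈ nb G W D := by simp [hn]
  have hv : v ∈ nb G W D := by simp [hn]
  obtain ⟨huW, huD, a, ha, hau⟩ := mem_nb.mp hu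
  obtain ⟨hvW, hvD, -⟩ := mem_nb.mp hv
  have hWe : W = insert u (insert v D) := by
    refine subset_antisymm ?_ (by grind)
    refine hW.conn.subset_of_closed ⟨u, by grind⟩ fun x hxW hx y hyW hxy => ?_
    by_contra hy
    have hy' : y ≠ u ∧ y ≠ v ∧ y ∉ D := by simpa using hy
    rcases mem_insert.mp hx with rfl | hx
    · exact hW.not_adj_of_nb_pair hDW hD huv.symm (by rw [hn, pair_comm]) hyW hy'.2.2 hy'.2.1
        hy'.1 hxy
    rcases mem_insert.mp hx with rfl | hx
    · exact hW.not_adj_of_nb_pair hDW hD huv hn hyW hy'.2.2 hy'.1 hy'.2.1 hxy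
    · have := mem_or_mem_nb hx hyW hxy
      rw [hn] at this
      grind
  have hcard : W.card = 7 := by
    rw [hWe, card_insert_of_notMem (by grind), card_insert_of_notMem hvD, hD.card]
  have hr : Rom G W 5 := by
    obtain ⟨b, c, d, e, h, rfl⟩ := hD.rot ha
    rw [hWe]
    by_cases h1 : G.Adj v c ∨ ¬ G.Adj v d ∧ ¬ G.Adj v e
    · exact h.rom_seven huD hvD huv hau.symm h1
    have e1 : ({a, b, c, d, e} : Finset V) = {a, e, d, c, b} := by grind
    rw [e1] at huD hvD ⊢
    refine h.flip.rom_seven huD hvD huv hau.symm ?_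
    by_contra h2
    push Not at h1 h2
    have hve := h1.2 h2.1
    have hvb := h2.2 h1.1
    have hnd := h.nodup
    refine hW.noTheta b e {v} {a} {c, d} hnd.2.2.2.2.2.2.1 (link_singleton hvb hve)
      (link_singleton h.ab h.ea.symm) (link_pair h.cd h.bc h.de hnd.2.2.2.2.2.1
      hnd.2.2.2.2.2.2.2.2.1.symm) ?_ ?_ ?_
    all_goals grind
  exact hW.bad ⟨5, hr, by omega⟩

lemma Del.add_rom {W X C : Finset V} {k l : ℕ} (h : Del G W X k) (hC : Rom G C l) (hCW : C ⊆ W)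
    (hCX : ∀ x ∈ C, x ∉ X) (hn : nb G W C ⊆ X) : Del G W (X ∪ C) (k + l) := by
  refine h.trans (hC.del (fun x hx => mem_sdiff.mpr ⟨hCW hx, hCX x hx⟩) ?_) rfl
  intro x hx w hw hxw
  obtain ⟨hwW, hwX⟩ := mem_sdiff.mp hw
  exact (mem_or_mem_nb hx hwW hxw).resolve_right fun h' => hwX (hn h')

lemma Del.add_pair {W X : Finset V} {k : ℕ} {u v : V} (h : Del G W X k) (hu : u ∈ W) (hv : v ∈ W)
    (huX : u ∉ X) (hvX : v ∉ X) (huv : G.Adj u v) : Del G W (X ∪ {u, v}) (k + 2) :=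
  h.trans (.pair (mem_sdiff.mpr ⟨hu, huX⟩) (mem_sdiff.mpr ⟨hv, hvX⟩) huv) rfl

lemma nb_erase_subset {W D : Finset V} {z : V} : nb G W (D.erase z) ⊆ insert z (nb G W D) := by
  intro w hw
  obtain ⟨h1, h2, d, hd, h⟩ := mem_nb.mp hw
  rcases mem_or_mem_nb (mem_of_mem_erase hd) h1 h with h | h
  · have : w = z := by
      by_contra hz
      exact h2 (mem_erase.mpr ⟨hz, h⟩)
    simp [this]
  · exact mem_insert_of_mem h

/-- If all neighbours of a 5-cycle lie in a pair, we have a contradiction. -/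
lemma Crit.false_of_nb_subset {W D : Finset V} {u v : V} (hW : Crit G W) (hDW : D ⊆ W)
    (hD : C5 G D) (hn : nb G W D ⊆ {u, v}) : False := by
  have := hW.three_le_nb hDW hD
  have := card_le_card hn
  have := card_le_two (a := u) (b := v)
  omega

/-- A connected set `S` whose neighbours are among the ends of an edge `uv`. -/
structure Piece (G : SimpleGraph V) (W : Finset V) (u v : V) (S : Finset V) : Prop where
  left : u ∈ W
  right : v ∈ W
  adj : G.Adj u v
  subset : S ⊆ W
  left_notMem : u ∉ S
  right_notMem : v ∉ S
  conn : ConnSet G S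
  nb_subset : nb G W S ⊆ {u, v}

lemma Piece.symm {W S : Finset V} {u v : V} (h : Piece G W u v S) : Piece G W v u S :=
  ⟨h.right, h.left, h.adj.symm, h.subset, h.right_notMem, h.left_notMem, h.conn,
    by rw [pair_comm]; exact h.nb_subset⟩

lemma Crit.exists_nb {W S : Finset V} {u : V} (hW : Crit G W) (hS : S ⊆ W) (hne : S.Nonempty)
    (hu : u ∈ W) (huS : u ∉ S) : (nb G W S).Nonempty := by
  obtain ⟨a, _, haS, b, hb, hbS, hab⟩ := hW.conn.exists_adj (P := S)
    (by rwa [inter_eq_right.mpr hS]) fun h => huS (h hu)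
  exact ⟨b, mem_nb.mpr ⟨hb, hbS, a, haS, hab⟩⟩

lemma Piece.conn_insert {W S : Finset V} {u v : V} (hW : Crit G W) (h : Piece G W u v S) :
    ConnSet G ({u, v} ∪ S) := by
  have huv : ConnSet G {u, v} := (connSet_singleton v).insert (by simp) h.adj
  obtain ⟨b, hb⟩ := hW.exists_nb h.subset h.conn.1 h.left h.left_notMem
  exact huv.union h.conn
    (Or.inl ((touch_of_mem_nb hb).mono (by simpa using h.nb_subset hb) subset_rfl))

/-- A piece is not cheap. -/
lemma Piece.false_of_rom {W S : Finset V} {u v : V} {c : ℕ} (hW : Crit G W) (h : Piece G W u v S)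
    (hr : Rom G S c) (hc : 4 * c + 2 ≤ 3 * S.card) : False := by
  have h1 := h.left; have h2 := h.right; have h3 := h.subset; have h4 := h.left_notMem
  have h5 := h.right_notMem
  obtain ⟨D, hD, hD5, hDn⟩ := hW.exists_hang (by grind) (h.conn_insert hW)
    ((Del.pair h.left h.right h.adj).add_rom hr h.subset (by grind) h.nb_subset) (by
      rw [card_union_of_disjoint (by rw [Finset.disjoint_left]; grind), card_pair h.adj.ne]
      omega)
  have h6 := h.nb_subset
  refine hW.false_of_nb_subset (u := u) (v := v) (by grind) hD5 fun x hx => ?_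
  have := notMem_of_mem_nb (D := S) (by grind) (by grind) (by grind) hx
  grind

lemma Piece.card_eq_three {W S : Finset V} {u v x : V} (hW : Crit G W) (h : Piece G W u v S)
    (hx : Chain G x S) : S.card = 3 := by
  by_contra h3
  have hpos := h.conn.1.card_pos
  refine h.false_of_rom hW hx.rom ?_
  generalize S.card = n at *
  rcases Nat.lt_or_ge n 3 with hn | hn
  · interval_cases n <;> decide
  · omega

lemma ConnSet.chain_of_card_le_two {S : Finset V} (hS : ConnSet G S) (h2 : S.card ≤ 2) :
    ∃ x, Chain G x S := by
  have hpos := hS.1.card_pos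
  rcases (show S.card = 1 ∨ S.card = 2 by omega) with h | h
  · obtain ⟨x, rfl⟩ := card_eq_one.mp h
    exact ⟨x, .single x⟩
  · obtain ⟨x, y, hxy, rfl⟩ := card_eq_two.mp h
    obtain ⟨a, ha, b, hb, hab⟩ := hS.2 {x} (by simp) (by simp) (by grind)
    have ha' : a = x := by simpa using ha
    have hb' : b = y := by grind
    subst ha' hb'
    exact ⟨a, .cons (.single b) (by simpa using hxy) hab (by simp)⟩

lemma Piece.three_le_card {W S : Finset V} {u v : V} (hW : Crit G W) (h : Piece G W u v S) :
    3 ≤ S.card := by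
  by_contra hlt
  obtain ⟨x, hx⟩ := h.conn.chain_of_card_le_two (by omega)
  have := h.card_eq_three hW hx
  omega

/-- A piece of three vertices that forms an induced 5-cycle with its base edge. -/
def Ear (G : SimpleGraph V) (W : Finset V) (a b : V) (T : Finset V) : Prop :=
  Piece G W a b T ∧ ∃ p q r, Cyc5 G a p q r b ∧ T = {p, q, r}

lemma Ear.symm {W T : Finset V} {a b : V} (h : Ear G W a b T) : Ear G W b a T := by
  obtain ⟨h, p, q, r, h5, rfl⟩ := h
  exact ⟨h.symm, r, q, p, h5.flip.rot, by grind⟩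

lemma Ear.card {W T : Finset V} {a b : V} (h : Ear G W a b T) : T.card = 3 := by
  obtain ⟨-, p, q, r, h5, rfl⟩ := h
  have := h5.nodup
  exact card_eq_three.mpr ⟨p, q, r, by tauto, by tauto, by tauto, rfl⟩

lemma Ear.c5 {W T : Finset V} {a b : V} (h : Ear G W a b T) : C5 G ({a, b} ∪ T) := by
  obtain ⟨-, p, q, r, h5, rfl⟩ := h
  exact ⟨_, _, _, _, _, h5, by grind⟩

/-- A base vertex of an ear has a neighbour outside the 5-cycle. -/
lemma Ear.exists_adj {W T : Finset V} {x y : V} (hW : Crit G W) (h : Ear G W x y T) :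
    ∃ w ∈ W, G.Adj x w ∧ w ∉ T ∧ w ≠ y := by
  by_contra hno
  push Not at hno
  have h5 := h.c5
  obtain ⟨hp, p, q, r, hc, rfl⟩ := h
  have hnd := hc.nodup
  have h1 := hp.left; have h2 := hp.right; have h3 := hp.subset; have h4 := hp.nb_subset
  have hch : Chain G x {x, p, q, r} := hc.flip.rot.flip.chain
  have hnS : nb G W {x, p, q, r} ⊆ {y} := by
    intro w hw
    obtain ⟨hwW, hwS, d, hd, hdw⟩ := mem_nb.mp hw
    rcases mem_insert.mp hd with rfl | hd
    · have := hno w hwW hdw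
      grind
    · have := mem_or_mem_nb hd hwW hdw
      grind
  obtain ⟨t, ht⟩ : ∃ t, t ∈ nb G W ({x, y} ∪ {p, q, r}) := by
    have := hW.three_le_nb (by grind) h5
    exact card_pos.mp (by omega)
  obtain ⟨htW, htD, d, hd, hdt⟩ := mem_nb.mp ht
  have hdy : d = y := by
    by_contra hdy
    have : d ∈ ({x, p, q, r} : Finset V) := by grind
    have := mem_or_mem_nb this htW hdt
    grind
  subst hdy
  have hpc : Piece G W d t {x, p, q, r} := ⟨h2, htW, hdt, by grind, by grind, by grind, hch.conn,
    hnS.trans (by simp)⟩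
  have := hpc.card_eq_three hW hch
  rw [card_insert_of_notMem (by grind), card_insert_of_notMem (by grind),
    card_pair (by grind)] at this
  omega

lemma Ear.base_exists {W T : Finset V} {x y : V} (hW : Crit G W) (h : Ear G W x y T) (m n : V) :
    ∃ w ∈ W, G.Adj x w ∧ w ≠ m ∧ w ≠ n := by
  obtain ⟨w, hwW, hxw, hwT, hwy⟩ := h.exists_adj hW
  obtain ⟨hp, p, q, r, hc, rfl⟩ := h
  by_contra hno
  push Not at hno
  have h1 := hno w hwW hxw
  have h2 := hno y hp.right hp.adj
  have h3 := hno p (hp.subset (by simp)) hc.ab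
  have h4 := hp.right_notMem
  have h5 := hp.adj.ne
  clear hno hp hW
  simp only [mem_insert, mem_singleton, not_or] at hwT h4
  by_cases h6 : w = m <;> by_cases h7 : y = m <;> by_cases h8 : p = m <;> grind

lemma Ear.interior_nbrs {W T : Finset V} {x y t : V} (h : Ear G W x y T) (ht : t ∈ T) :
    ∃ m n, ∀ w ∈ W, G.Adj t w → w = m ∨ w = n := by
  obtain ⟨hp, p, q, r, hc, rfl⟩ := h
  have key : ∀ w ∈ W, G.Adj t w → w ∈ ({x, p, q, r, y} : Finset V) := fun w hw htw => by
    have := mem_or_mem_nb ht hw htw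
    have := hp.nb_subset
    grind
  have hcomm := fun a b => G.adj_comm a b
  simp only [mem_insert, mem_singleton] at ht key
  rcases ht with rfl | rfl | rfl
  · refine ⟨x, q, fun w hw h => ?_⟩
    rcases key w hw h with rfl | rfl | rfl | rfl | rfl
    exacts [Or.inl rfl, absurd rfl h.ne, Or.inr rfl, absurd h hc.bd, absurd h.symm hc.eb]
  · refine ⟨p, r, fun w hw h => ?_⟩
    rcases key w hw h with rfl | rfl | rfl | rfl | rfl
    exacts [absurd h.symm hc.ac, Or.inl rfl, absurd rfl h.ne, Or.inr rfl, absurd h hc.ce]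
  · refine ⟨q, y, fun w hw h => ?_⟩
    rcases key w hw h with rfl | rfl | rfl | rfl | rfl
    exacts [absurd h hc.da, absurd h.symm hc.bd, Or.inl rfl, absurd rfl h.ne, Or.inr rfl]

lemma Ear.base_notMem {W T T' : Finset V} {x y x' y' : V} (hW : Crit G W) (h : Ear G W x y T)
    (h' : Ear G W x' y' T') : x ∉ T' := by
  intro hx
  obtain ⟨m, n, hmn⟩ := h'.interior_nbrs hx
  obtain ⟨w, hw, hxw, h1, h2⟩ := h.base_exists hW m n
  have := hmn w hw hxw
  tauto

lemma Ear.rom {W T : Finset V} {x y : V} (h : Ear G W x y T) : Rom G T 2 := by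
  have h3 := h.card
  obtain ⟨-, p, q, r, hc, rfl⟩ := h
  have h4 : Chain G p {p, q, r} := by
    have hnd := hc.nodup
    refine .cons (.cons (.single r) (by grind) hc.cd (by grind)) (by grind) hc.bc ?_
    have := hc.bd; grind
  have := h4.rom
  rwa [h3] at this

lemma Ear.disjoint {W T T' : Finset V} {x y x' z : V} (hW : Crit G W) (h : Ear G W x y T)
    (h' : Ear G W x' z T') (hne : T ≠ T') : ∀ t ∈ T, t ∉ T' := by
  have hx := h.base_notMem hW h'
  have hx' := h'.base_notMem hW h
  have hyT' := h.symm.base_notMem hW h'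
  have hzT := h'.symm.base_notMem hW h
  by_contra hi
  push Not at hi
  obtain ⟨t, ht, ht'⟩ := hi
  exact hne (subset_antisymm
    (h.1.conn.subset_of_nb h.1.subset ⟨t, by simp [ht, ht']⟩ fun w hw hw' => by
      have := h'.1.nb_subset hw'; grind)
    (h'.1.conn.subset_of_nb h'.1.subset ⟨t, by simp [ht, ht']⟩ fun w hw hw' => by
      have := h.1.nb_subset hw'; grind))

lemma Ear.del {W T : Finset V} {x y : V} (h : Ear G W x y T) : Del G W ({x, y} ∪ T) 4 := by
  have := h.1.left_notMem
  have := h.1.right_notMem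
  exact (Del.pair h.1.left h.1.right h.1.adj).add_rom h.rom h.1.subset (by grind) h.1.nb_subset

lemma Ear.card_union {W T : Finset V} {x y : V} (h : Ear G W x y T) : ({x, y} ∪ T).card = 5 := by
  have := h.1.left_notMem
  have := h.1.right_notMem
  rw [card_union_of_disjoint (by rw [Finset.disjoint_left]; grind), card_pair h.1.adj.ne, h.card]

lemma Ear.notMem_of_mem_nb {W D T : Finset V} {x y w : V} (h : Ear G W x y T) (hDW : D ⊆ W)
    (hD : ∀ t ∈ T, t ∉ D) (hx : x ∉ D) (hy : y ∉ D) (hw : w ∈ nb G W D) : w ∉ T := by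
  have h1 := h.1.nb_subset
  exact EdgeRoman.notMem_of_mem_nb hDW (by grind) (by grind) hw

lemma Ear.del_two {W T T' : Finset V} {x y z : V} (hW : Crit G W) (h : Ear G W x y T)
    (h' : Ear G W x z T') (hne : T ≠ T') : Del G W ({x, y} ∪ T ∪ T') 6 := by
  have hdj := h.disjoint hW h' hne
  have hxT' := h'.1.left_notMem
  have hzT' := h'.1.right_notMem
  have hyT' := h.symm.base_notMem hW h'
  have hTW' := h'.1.subset
  have d := h.del
  have hn := h'.1.nb_subset
  obtain ⟨-, a, b, c, hc', rfl⟩ := id h'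
  obtain ⟨-, -, -, -, hab, hac, -, hbc, -, -⟩ := hc'.nodup
  have d2 := d.add_pair (u := b) (v := c) (hTW' (by simp)) (hTW' (by simp)) (by grind)
    (by grind) hc'.cd
  refine (d2.add_rom (C := {a}) (l := 0)
    (.iso (v := a) (by simp) (by simp) (by simpa using .empty 0)) (by grind) (by grind) ?_).congr
    (by grind) le_rfl
  intro w hw
  obtain ⟨hwW, -, d, hd, hdw⟩ := mem_nb.mp hw
  rw [mem_singleton] at hd
  subst hd
  have h1 := mem_or_mem_nb (D := {d, b, c}) (by simp) hwW hdw
  have h2 : w ≠ z := by rintro rfl; exact hc'.eb hdw.symm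
  have h3 := hdw.ne
  clear hW h h' d2 hc'
  grind

lemma Ear.exists_hang_two {W T T' : Finset V} {x y z : V} (hW : Crit G W) (h : Ear G W x y T)
    (h' : Ear G W x z T') (hne : T ≠ T') :
    ∃ D ⊆ W \ ({x, y} ∪ T ∪ T'), C5 G D ∧ z ∈ D ∧ nb G W D ⊆ {x, y} ∪ T' := by
  have hcX : ConnSet G ({x, y} ∪ T ∪ T') := by
    obtain ⟨-, a, b, c, hc', hT'⟩ := id h'
    have := ((h.1.conn_insert hW).union h'.1.conn
      (Or.inl ⟨x, by simp, a, by simp [hT'], hc'.ab⟩))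
    convert this using 1
  have hdj := h.disjoint hW h' hne
  have hxT' := h'.1.left_notMem
  have hyT' := h.symm.base_notMem hW h'
  have hTW := h.1.subset; have hTW' := h'.1.subset
  have hxW := h.1.left; have hyW := h.1.right
  obtain ⟨D, hD, hD5, hDn⟩ := hW.exists_hang (by grind) hcX (h.del_two hW h' hne) (by
    rw [card_union_of_disjoint (by rw [Finset.disjoint_left]; grind), h.card_union, h'.card])
  have hDW : D ⊆ W := by grind
  have h1 : ∀ w ∈ nb G W D, w ∉ T := fun w hw =>
    h.notMem_of_mem_nb hDW (by grind) (by grind) (by grind) hw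
  refine ⟨D, hD, hD5, ?_, by grind⟩
  by_contra hzD
  refine hW.false_of_nb_subset (u := x) (v := y) hDW hD5 fun w hw => ?_
  have h1 := h1 w hw
  have h2 := h'.notMem_of_mem_nb hDW (by grind) (by grind) (by grind) hw
  have h3 := hDn hw
  simp only [mem_union] at h3
  tauto

lemma Ear.del_three {W T T' D : Finset V} {x y z : V} (hW : Crit G W) (h : Ear G W x y T)
    (h' : Ear G W x z T') (hne : T ≠ T') (hD : D ⊆ W \ ({x, y} ∪ T ∪ T'))
    (hD5 : C5 G D) (hzD : z ∈ D) (hDn : nb G W D ⊆ {x, y} ∪ T') :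
    Del G W ({x, y} ∪ T ∪ T' ∪ D) 9 := by
  have hdj := h.disjoint hW h' hne
  have hxT := h.1.left_notMem
  have hyT := h.1.right_notMem
  have hzT := h'.symm.base_notMem hW h
  have hxT' := h'.1.left_notMem
  have hyT' := h.symm.base_notMem hW h'
  have hzT' := h'.1.right_notMem
  have hTW := h.1.subset; have hTW' := h'.1.subset
  have hxW := h.1.left; have hyW := h.1.right; have hzW := h'.1.right
  have hn := h.1.nb_subset
  have hn' := h'.1.nb_subset
  have hxz := h'.1.adj
  have d5 := nb_erase_subset (G := G) (W := W) (D := D) (z := z)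
  have hcard := h'.rom
  obtain ⟨-, p, q, r, hc, rfl⟩ := id h
  obtain ⟨hxp, hxq, hxr, hxy, hpq, hpr, hpy, hqr, hqy, hry⟩ := hc.nodup
  have hpq' : Rom G {p, q} 1 := by
    have : Chain G p {p, q} := .cons (.single q) (by grind) hc.bc (by grind)
    have := this.rom
    rwa [card_pair hpq] at this
  have e1 := (Del.pair hyW (hTW (show r ∈ _ by simp)) hc.de.symm).add_pair hzW hxW
    (by grind) (by grind) hxz.symm
  have e2 := e1.add_rom hpq' (by grind) (by grind) (by
    intro w hw
    obtain ⟨hwW, hwS, d, hd, hdw⟩ := mem_nb.mp hw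
    have h1 := mem_or_mem_nb (D := {p, q, r}) (show d ∈ _ by grind) hwW hdw
    have h2 : w = y → False := by
      rintro rfl
      simp only [mem_insert, mem_singleton] at hd
      rcases hd with rfl | rfl
      exacts [hc.eb hdw.symm, hc.ce hdw]
    clear hW h h' hc e1
    grind)
  have e3 := e2.add_rom hcard hTW' (by grind) (by grind)
  refine (e3.add_rom (hD5.rom_erase hzD) (by grind) (by grind) fun w hw => ?_).congr ?_ le_rfl
  swap
  · ext w
    simp only [mem_union, mem_insert, mem_singleton, mem_erase]
    by_cases hwz : w = z
    · simp [hwz, hzD]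
    · tauto
  have h1 := d5 hw
  have h2 := (mem_nb.mp hw).2.1
  clear hW h h' hc e1 e2 e3
  grind

/-- Distinct ears share no base vertex. -/
lemma Ear.eq_of_base {W T T' : Finset V} {x y z : V} (hW : Crit G W) (h : Ear G W x y T)
    (h' : Ear G W x z T') : T = T' := by
  by_contra hne
  obtain ⟨D, hD, hD5, hzD, hDn⟩ := h.exists_hang_two hW h' hne
  have d := h.del_three hW h' hne hD hD5 hzD hDn
  have hc : ConnSet G ({x, y} ∪ T ∪ T' ∪ D) := by
    have := (h.1.conn_insert hW).union ((h'.1.conn_insert hW).union hD5.conn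
      (Or.inr ⟨z, by simp [hzD]⟩)) (Or.inr ⟨x, by simp⟩)
    convert this using 1
    grind
  have hdj := h.disjoint hW h' hne
  have hxT' := h'.1.left_notMem
  have hyT' := h.symm.base_notMem hW h'
  have hTW := h.1.subset; have hTW' := h'.1.subset
  have hxW := h.1.left; have hyW := h.1.right
  obtain ⟨F, hF, hF5, hFn⟩ := hW.exists_hang (by grind) hc d (by
    rw [card_union_of_disjoint (by rw [Finset.disjoint_left]; grind),
      card_union_of_disjoint (by rw [Finset.disjoint_left]; grind), h.card_union, h'.card, hD5.card]
    decide)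
  have hFW : F ⊆ W := by grind
  refine hW.false_of_nb_subset (u := x) (v := y) hFW hF5 fun w hw => ?_
  have g1 := h.notMem_of_mem_nb hFW (by grind) (by grind) (by grind) hw
  have g2 := h'.notMem_of_mem_nb hFW (by grind) (by grind) (by grind) hw
  have g3 := EdgeRoman.notMem_of_mem_nb (D := D) (by grind) (by grind) (by grind) hw
  have h3 := hFn hw
  simp only [mem_union] at h3
  tauto

end Crit

section Theta

variable {V : Type*} [DecidableEq V] {G : SimpleGraph V}

lemma NoTheta.adj_of_touch_comp (hG : NoTheta G) {T B : Finset V} {x v y y' : V}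
    (hT : ConnSet G T) (hy : y ∈ T) (hy' : y' ∈ T) (hne : y ≠ y') (hxy : G.Adj x y)
    (hxy' : G.Adj x y') (hxT : x ∉ T) (hB : ConnSet G B) (hv : v ∈ B) (hxB : x ∉ B)
    (hTB : ∀ a ∈ T, a ∉ B) (hBx : Touch G {x} B)
    (h1 : Touch G {v} (comp G (T.erase y') y)) (h2 : Touch G {v} (comp G (T.erase y) y')) :
    G.Adj y v := by
  by_contra hyv
  obtain ⟨v', hv', c, hc, hvc⟩ := h1
  rw [mem_singleton] at hv'
  subst hv'
  have hcy : c ≠ y := by rintro rfl; exact hyv hvc.symm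
  have hC := connSet_comp (G := G) (show y ∈ T.erase y' from mem_erase.mpr ⟨hne, hy⟩)
  have hCs := comp_subset (G := G) (A := T.erase y') (m := y)
  have hyC := self_mem_comp (G := G) (show y ∈ T.erase y' from mem_erase.mpr ⟨hne, hy⟩)
  have hC' := connSet_comp (G := G) (show y' ∈ T.erase y from mem_erase.mpr ⟨hne.symm, hy'⟩)
  have hCs' := comp_subset (G := G) (A := T.erase y) (m := y')
  have hyC' := self_mem_comp (G := G) (show y' ∈ T.erase y from mem_erase.mpr ⟨hne.symm, hy'⟩)
  have hcA : c ∈ T \ {y, y'} := by grind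
  have hM := connSet_comp hcA (G := G)
  have hMs := comp_subset (G := G) (A := T \ {y, y'}) (m := c)
  have hcM := self_mem_comp (G := G) hcA
  have hyM := hC.comp_touch (A := T \ {y, y'}) (by grind) hyC (by simp) hc hcy
  have hMcl := fun a b => comp_closed (G := G) (A := T \ {y, y'}) (m := c) (a := a) (b := b)
  set M := comp G (T \ {y, y'}) c
  set C' := comp G (T.erase y) y'
  have hMv : Touch G B M := ⟨v', hv, c, hcM, hvc⟩
  have hy'M : ¬ Touch G {y'} M := fun h => hG.conn x M {y} {y'} B hM (by grind)
    ⟨connSet_singleton y, by simpa using hxy.ne, by grind, touch_of_adj hxy (by simp) (by simp),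
      hyM.symm⟩
    ⟨connSet_singleton y', by simpa using hxy'.ne, by grind,
      touch_of_adj hxy' (by simp) (by simp), h.symm⟩
    ⟨hB, hxB, by grind, hBx, hMv.symm⟩ (by simpa using hne) (by grind) (by grind)
  have hdis : ∀ a ∈ M, a ∉ C' := by
    by_contra hcon
    push Not at hcon
    obtain ⟨a, ha, haC⟩ := hcon
    have : C' ⊆ M := hC'.subset_of_closed ⟨a, by grind⟩ fun a _ haM b hbC hab => by
      refine hMcl a b haM (mem_sdiff.mpr ⟨by grind, ?_⟩) hab
      have : b ≠ y' := by
        rintro rfl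
        exact hy'M ⟨b, by simp, a, haM, hab.symm⟩
      grind
    grind
  refine hG.conn y B M {x} C' hB (by grind) ⟨hM, by grind, by grind, hyM, hMv⟩
    ⟨connSet_singleton x, by simpa using hxy.ne.symm, by grind,
      touch_of_adj hxy.symm (by simp) (by simp), hBx.symm⟩
    ⟨hC', by grind, by grind, ?_, h2.mono (by simpa using hv) subset_rfl⟩
    (by grind) hdis (by grind)
  exact hT.comp_touch subset_rfl hy (by simp) hy' hne.symm

lemma NoTheta.adj_of_adj (hG : NoTheta G) {T B : Finset V} {x y y' : V}
    (hT : ConnSet G T) (hy : y ∈ T) (hy' : y' ∈ T) (hne : y ≠ y') (hxy : G.Adj x y)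
    (hxy' : G.Adj x y') (hxT : x ∉ T) (hB : ConnSet G B) (hxB : x ∉ B)
    (hTB : ∀ a ∈ T, a ∉ B) (h1 : Touch G {y} B) (h2 : Touch G {y'} B) :
    G.Adj y y' := by
  by_contra hyy
  obtain ⟨a, ha, c, hc, hac⟩ := hT.comp_touch (A := T.erase y) subset_rfl hy (by simp) hy' hne.symm
  rw [mem_singleton] at ha
  subst ha
  have hC' := connSet_comp (G := G) (show y' ∈ T.erase a from mem_erase.mpr ⟨hne.symm, hy'⟩)
  have hCs' := comp_subset (G := G) (A := T.erase a) (m := y')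
  have hyC' := self_mem_comp (G := G) (show y' ∈ T.erase a from mem_erase.mpr ⟨hne.symm, hy'⟩)
  have hcy : c ≠ y' := by rintro rfl; exact hyy hac
  have hcA : c ∈ T \ {a, y'} := by grind
  have hM := connSet_comp hcA (G := G)
  have hMs := comp_subset (G := G) (A := T \ {a, y'}) (m := c)
  have hcM := self_mem_comp (G := G) hcA
  have hyM := hC'.comp_touch (A := T \ {a, y'}) (by grind) hyC' (by simp) hc hcy
  set M := comp G (T \ {a, y'}) c
  exact hG a y' M {x} B hne
    ⟨hM, by grind, by grind, touch_of_adj hac (by simp) hcM, hyM⟩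
    ⟨connSet_singleton x, by simpa using hxy.ne.symm, by simpa using hxy'.ne.symm,
      touch_of_adj hxy.symm (by simp) (by simp), touch_of_adj hxy'.symm (by simp) (by simp)⟩
    ⟨hB, by grind, by grind, h1, h2⟩ (by grind) (by grind) (by grind)

lemma NoTheta.erase_conn (hG : NoTheta G) {T L : Finset V} {y v : V} (hT : ConnSet G T)
    (hy : y ∈ T) (hvT : v ∉ T) (hL : ConnSet G L) (hvL : v ∉ L) (hTL : ∀ a ∈ T, a ∉ L)
    (hLy : Touch G {y} L) (hLv : Touch G {v} L)
    (h : ∀ m ∈ T.erase y, Touch G {v} (comp G (T.erase y) m)) :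
    T.erase y = ∅ ∨ ConnSet G (T.erase y) := by
  refine (T.erase y).eq_empty_or_nonempty.imp_right fun ⟨m, hm⟩ => ?_
  by_contra hcon
  have h1 := connSet_comp (G := G) hm
  have hs := comp_subset (G := G) (A := T.erase y) (m := m)
  obtain ⟨m', hm', hm'1⟩ : ∃ m' ∈ T.erase y, m' ∉ comp G (T.erase y) m := by
    by_contra hno
    push Not at hno
    exact hcon (subset_antisymm hs hno ▸ h1)
  have h2 := connSet_comp (G := G) hm'
  have hs' := comp_subset (G := G) (A := T.erase y) (m := m')
  have hself := self_mem_comp (G := G) hm'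
  refine hG y v _ _ L (by grind)
    ⟨h1, by grind, by grind, hT.comp_touch subset_rfl hy (by simp) (by grind) (by grind), h m hm⟩
    ⟨h2, by grind, by grind, hT.comp_touch subset_rfl hy (by simp) (by grind) (by grind), h m' hm'⟩
    ⟨hL, by grind, by grind, hLy, hLv⟩ ?_ (by grind) (by grind)
  intro w hw hw'
  exact hm'1 (h2.subset_comp hs' hw' hw hself)

lemma NoTheta.exists_unique_adj (hG : NoTheta G) {T B : Finset V} {x v : V} (hT : ConnSet G T)
    (hxT : x ∉ T) (hvT : v ∉ T) (hxv : x ≠ v) (hTx : Touch G {x} T) (hB : ConnSet G B)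
    (hxB : x ∉ B) (hvB : v ∉ B) (hTB : ∀ a ∈ T, a ∉ B) (hBx : Touch G {x} B)
    (hBv : Touch G {v} B)
    (h : ∀ s ∈ T, G.Adj x s → ∀ m ∈ T.erase s, Touch G {v} (comp G (T.erase s) m)) :
    ∃ y ∈ T, G.Adj x y ∧ (∀ t ∈ T, G.Adj x t → t = y) ∧
      (T.erase y = ∅ ∨ ConnSet G (T.erase y)) := by
  obtain ⟨x', hx', y, hy, hxy⟩ := hTx
  rw [mem_singleton] at hx'
  subst hx'
  have hBc : ConnSet G (insert v B) := by
    obtain ⟨a, ha, b, hb, hab⟩ := hBv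
    rw [mem_singleton] at ha
    subst ha
    exact hB.insert hb hab
  refine ⟨y, hy, hxy, fun t ht hxt => ?_, ?_⟩
  · by_contra hne
    have h1 := h t ht hxt y (by grind)
    have h2 := h y hy hxy t (by grind)
    have hyv := hG.adj_of_touch_comp hT hy ht (Ne.symm hne) hxy hxt hxT hBc (by simp) (by grind)
      (by grind) (hBx.mono subset_rfl (by simp)) h1 h2
    have htv := hG.adj_of_touch_comp hT ht hy hne hxt hxy hxT hBc (by simp) (by grind)
      (by grind) (hBx.mono subset_rfl (by simp)) h2 h1
    exact hG x' v {y} {t} B hxv (link_singleton hxy.symm hyv) (link_singleton hxt.symm htv)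
      ⟨hB, hxB, by simpa using hvB, hBx, hBv⟩ (by grind) (by grind) (by grind)
  · have hBx' : ConnSet G (insert x' B) := by
      obtain ⟨a, ha, b, hb, hab⟩ := hBx
      rw [mem_singleton] at ha
      subst ha
      exact hB.insert hb hab
    exact hG.erase_conn hT hy hvT hBx' (by grind) (by grind)
      (touch_of_adj hxy.symm (by simp) (by simp)) (hBv.mono subset_rfl (by simp)) (h y hy hxy)

end Theta

section Crit

variable {V : Type*} [DecidableEq V] {G : SimpleGraph V}

lemma piece_comp {W : Finset V} {u v m : V} (hu : u ∈ W) (hv : v ∈ W) (huv : G.Adj u v)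
    (hm : m ∈ W \ {u, v}) : Piece G W u v (comp G (W \ {u, v}) m) := by
  have hs := comp_subset (G := G) (A := W \ {u, v}) (m := m)
  refine ⟨hu, hv, huv, by grind, by grind, by grind, connSet_comp hm, fun w hw => ?_⟩
  obtain ⟨hwW, hwS, d, hd, hdw⟩ := mem_nb.mp hw
  by_contra hwuv
  exact hwS (comp_closed hd (mem_sdiff.mpr ⟨hwW, hwuv⟩) hdw)

lemma Crit.exists_piece {W : Finset V} (hW : Crit G W) :
    ∃ u v S, Piece G W u v S ∧ ¬ Ear G W u v S := by
  have h3 : 3 ≤ W.card := by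
    by_contra hlt
    obtain ⟨x, hx⟩ := hW.conn.chain_of_card_le_two (by omega)
    refine hW.bad ⟨_, hx.rom, ?_⟩
    generalize W.card = n at *
    interval_cases n <;> omega
  obtain ⟨u, hu⟩ := hW.nonempty
  obtain ⟨a, ha, hau, v, hv, hvu, hav⟩ := hW.conn.exists_adj
    (P := {u}) ⟨u, by simp [hu]⟩ fun h => by
    have := card_le_card h
    simp at this
    omega
  rw [mem_singleton] at hau
  subst hau
  obtain ⟨m, hm⟩ : (W \ {a, v}).Nonempty := by
    rw [← card_pos]
    have := le_card_sdiff {a, v} W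
    have := card_le_two (a := a) (b := v)
    omega
  have hp := piece_comp hu hv hav hm
  set T := comp G (W \ {a, v}) m
  by_cases he : Ear G W a v T
  swap
  · exact ⟨a, v, T, hp, he⟩
  obtain ⟨w, hwW, haw, hwT, hwv⟩ := he.exists_adj hW
  obtain ⟨-, p, q, r, hc, hT⟩ := he
  obtain ⟨hxp, hxq, hxr, hxy, hpq, hpr, hpy, hqr, hqy, hry⟩ := hc.nodup
  have hTW := hp.subset
  have hrm : r ∈ W \ {p, q} := by grind
  have hp' := piece_comp (G := G) (W := W) (u := p) (v := q) (by grind) (by grind) hc.bc hrm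
  refine ⟨p, q, _, hp', fun he' => ?_⟩
  have h1 := self_mem_comp (G := G) hrm
  have h2 := comp_closed h1 (b := v) (by grind) hc.de
  have h3 := comp_closed h2 (b := a) (by grind) hc.ea
  have h4 := comp_closed h3 (b := w) (by grind) haw
  have hcard := he'.card
  have : ({r, v, a, w} : Finset V) ⊆ comp G (W \ {p, q}) r := by grind
  have := card_le_card this
  rw [card_insert_of_notMem (by grind), card_insert_of_notMem (by grind),
    card_pair haw.ne] at this
  omega

/-- Every piece with fewer than `N` vertices is an ear. -/
def SmallEars (G : SimpleGraph V) (W : Finset V) (N : ℕ) : Prop :=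
  ∀ u v S, Piece G W u v S → S.card < N → Ear G W u v S

lemma Ear.chain {W T : Finset V} {x y : V} (h : Ear G W x y T) : Chain G x (insert x T) := by
  obtain ⟨-, p, q, r, hc, rfl⟩ := h
  exact hc.flip.rot.flip.chain

lemma Ear.touch {W T : Finset V} {x y : V} (h : Ear G W x y T) : Touch G {x} T := by
  obtain ⟨-, p, q, r, hc, rfl⟩ := h
  exact touch_of_adj hc.ab (by simp) (by simp)

/-- Components left after removing a neighbour of `x` reach `v`, as otherwise they would be ears
at `x`. -/
lemma SmallEars.touch_comp {W T E : Finset V} {N : ℕ} {x v t s m : V} (hN : SmallEars G W N)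
    (hTW : T ⊆ W) (hxW : x ∈ W) (hxT : x ∉ T) (hnb : nb G W (T ∪ E) ⊆ {x, v})
    (hcard : (T ∪ E).card ≤ N) (hTE : ∀ a ∈ T, a ∉ E) (hE : E = ∅ ∨ Ear G W x t E ∧ t ∈ T)
    (huniq : ∀ s' E', Ear G W x s' E' → E' ⊆ T ∪ E → E' = E) (hs : s ∈ T) (hxs : G.Adj x s)
    (hm : m ∈ T.erase s) : Touch G {v} (comp G (T.erase s) m) := by
  by_contra hv
  have hC := connSet_comp (G := G) hm
  have hCs := comp_subset (G := G) (A := T.erase s) (m := m)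
  have hself := self_mem_comp (G := G) hm
  have hCcl := fun a b => comp_closed (G := G) (A := T.erase s) (m := m) (a := a) (b := b)
  set C := comp G (T.erase s) m
  have hnbC : nb G W C ⊆ {x, s} ∪ E := fun w hw => by
    obtain ⟨hwW, hwC, d, hd, hdw⟩ := mem_nb.mp hw
    have h1 := mem_or_mem_nb (show d ∈ T ∪ E by grind) hwW hdw
    have h2 : w ≠ v := by
      rintro rfl
      exact hv ⟨w, by simp, d, hd, hdw.symm⟩
    have h3 := fun h => hwC (hCcl d w hd h hdw)
    grind
  have key : ∀ P, Piece G W x s P → P ⊆ C ∪ E → m ∈ P → False := fun P hP hPs hmP => by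
    have hlt : P.card < N := by
      refine (card_lt_card ?_).trans_le hcard
      refine ⟨by grind, fun h => ?_⟩
      have h1 := hP.right_notMem
      have h2 : s ∈ T ∪ E := by grind
      exact h1 (h h2)
    have := huniq s P (hN x s P hP hlt) (by grind)
    grind
  rcases hE with rfl | ⟨hE, ht⟩
  · exact key C ⟨hxW, hTW hs, hxs, by grind, by grind, by grind, hC, by simpa using hnbC⟩
      (by simp) hself
  have hEn := hE.1.nb_subset
  have hxE := hE.1.left_notMem
  have hEW := hE.1.subset
  by_cases htC : t ∈ C
  · refine key (C ∪ E) ⟨hxW, hTW hs, hxs, by grind, by grind, by grind, hC.union hE.1.conn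
      (Or.inl (hE.symm.touch.mono (by simpa using htC) subset_rfl)), fun w hw => ?_⟩
      subset_rfl (by simp [hself])
    obtain ⟨hwW, hwC, d, hd, hdw⟩ := mem_nb.mp hw
    rcases mem_union.mp hd with hd | hd
    · have := mem_or_mem_nb hd hwW hdw
      grind
    · have := mem_or_mem_nb hd hwW hdw
      grind
  · refine key C ⟨hxW, hTW hs, hxs, by grind, by grind, by grind, hC, fun w hw => ?_⟩
      (by simp) hself
    obtain ⟨hwW, hwC, d, hd, hdw⟩ := mem_nb.mp hw
    have h1 := hnbC hw
    have h2 : w ∉ E := fun hwE => by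
      have := mem_or_mem_nb hwE (show d ∈ W by grind) hdw.symm
      grind
    grind

lemma Ear.sdiff_conn {W T E : Finset V} {x t : V} (hT : ConnSet G T) (hTW : T ⊆ W) (hxT : x ∉ T)
    (hE : Ear G W x t E) (ht : t ∈ T) : ConnSet G (T \ E) := by
  have hEn := hE.1.nb_subset
  have htE := hE.1.right_notMem
  refine hT.sdiff_pendant (t := t) (by grind) fun e he a ha hea => ?_
  have := mem_or_mem_nb he (hTW (mem_sdiff.mp ha).1) hea
  grind

/-- If `x` has at most one neighbour other than those in `T`, then no ear at `x` lies in `T`. -/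
lemma SmallEars.false_of_ear {W T B E : Finset V} {N : ℕ} {x v t p : V} (hW : Crit G W)
    (hN : SmallEars G W N) (hTW : T ⊆ W) (hcard : T.card ≤ N) (hxW : x ∈ W) (hvW : v ∈ W)
    (hxT : x ∉ T) (hvT : v ∉ T) (hxv : x ≠ v) (hadj : ¬ G.Adj x v) (hnb : nb G W T ⊆ {x, v})
    (hT : ConnSet G T) (hB : ConnSet G B) (hxB : x ∉ B) (hvB : v ∉ B) (hTB : ∀ a ∈ T, a ∉ B)
    (hBx : Touch G {x} B) (hBv : Touch G {v} B)
    (hp : ∀ w ∈ W, G.Adj x w → w ∈ T ∨ w = p ∨ w = v) (hE : Ear G W x t E) (hET : E ⊆ T) :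
    False := by
  have hEn := hE.1.nb_subset
  have hxt := hE.1.adj
  have htE := hE.1.right_notMem
  have htW := hE.1.right
  have htT : t ∈ T := by
    obtain ⟨a, ha, e, he, hae⟩ := hE.symm.touch
    rw [mem_singleton] at ha
    subst ha
    have h1 := mem_or_mem_nb (hET he) htW hae.symm
    have h2 : a ≠ v := by rintro rfl; exact hadj hxt
    have := hxt.ne
    grind
  have hT1 := hE.sdiff_conn hT hTW hxT htT
  have hcov : T \ E ∪ E = T := sdiff_union_of_subset hET
  obtain ⟨y, hy, hxy, hyu, hTy⟩ := hW.noTheta.exists_unique_adj (T := T \ E) (x := x) (v := v) hT1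
    (by grind) (by grind) hxv (touch_of_adj hxt (by simp) (by simp [htT, htE])) hB hxB hvB
    (by grind) hBx hBv fun s hs hxs m hm =>
      hN.touch_comp (E := E) (t := t) (by grind) hxW (by grind) (by rwa [hcov]) (by rwa [hcov])
        (by grind) (Or.inr ⟨hE, by simp [htT, htE]⟩)
        (fun s' E' hE' _ => hE'.eq_of_base hW hE) hs hxs hm
  obtain rfl : t = y := hyu t (by simp [htT, htE]) hxt
  obtain ⟨w, hw⟩ : ∃ w, ∀ a ∈ W, G.Adj t a → a ∈ E ∨ a = x ∨ a = w := by
    have hta : ∀ a ∈ W, G.Adj t a → a ∈ (T \ E).erase t ∨ a ∈ E ∨ a = x ∨ a = v := fun a ha h => by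
      have h1 := mem_or_mem_nb htT ha h
      have h2 := h.ne
      grind
    rcases hTy with h0 | hTy
    · exact ⟨v, fun a ha h => by have := hta a ha h; grind⟩
    have hnb' : nb G W ((T \ E).erase t) ⊆ {t, v} := fun a ha => by
      obtain ⟨haW, haT, d, hd, hda⟩ := mem_nb.mp ha
      have h1 := mem_or_mem_nb (show d ∈ T by grind) haW hda
      have h2 : a = x → d = t := by
        rintro rfl
        exact hyu d (by grind) hda.symm
      have h3 : a ∉ E := fun haE => by
        have := mem_or_mem_nb haE (show d ∈ W by grind) hda.symm
        grind
      grind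
    by_cases htv : G.Adj t v
    · have hpc : Piece G W t v ((T \ E).erase t) := ⟨htW, hvW, htv, by grind, by grind, by grind,
        hTy, hnb'⟩
      have hlt : ((T \ E).erase t).card < T.card := card_lt_card ⟨by grind, fun h => by grind⟩
      have := (hN _ _ _ hpc (by omega)).eq_of_base hW hE.symm
      have := hTy.1
      grind
    have hBx' : ConnSet G (insert x B) := by
      obtain ⟨a, ha, b, hb, hab⟩ := hBx
      rw [mem_singleton] at ha
      subst ha
      exact hB.insert hb hab
    have htT' : Touch G {t} ((T \ E).erase t) := by
      obtain ⟨a, ha, had, b, hb, hbd, hab⟩ := hT1.exists_adj (P := {t})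
        ⟨t, by simp [htT, htE]⟩ fun h => by have := hTy.1; grind
      exact ⟨a, had, b, by grind, hab⟩
    have hlt : ((T \ E).erase t).card < T.card := card_lt_card ⟨by grind, fun h => by grind⟩
    obtain ⟨w, hw, htw, hwu, -⟩ := hW.noTheta.exists_unique_adj (T := (T \ E).erase t) (x := t)
      (v := v) hTy (by simp) (by grind) (by grind) htT' hBx' (by grind) (by grind) (by grind)
      (touch_of_adj hxt.symm (by simp) (by simp)) (hBv.mono subset_rfl (by simp))
      fun s hs hxs m hm => hN.touch_comp (E := ∅) (t := t) (by grind) htW (by simp)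
        (by simpa using hnb') (by simp; omega) (by simp) (Or.inl rfl)
        (fun s' E' hE' h' => by
          have := hE'.eq_of_base hW hE.symm
          have := hE.1.conn.1
          grind) hs hxs hm
    refine ⟨w, fun a ha h => ?_⟩
    have h1 := hta a ha h
    have h2 : a ≠ v := by rintro rfl; exact htv h
    have h3 := fun h' => hwu a h' h
    tauto
  have hEW := hE.1.subset
  refine hW.false_of_nb_subset (u := p) (v := w) (D := {x, t} ∪ E) (by grind) hE.c5 fun a ha => ?_
  obtain ⟨haW, haT, d, hd, hda⟩ := mem_nb.mp ha
  have h1 : a ∉ E := by grind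
  have h2 : a ≠ x := by grind
  have h3 : a ≠ t := by grind
  by_cases hdE : d ∈ E
  · have := mem_or_mem_nb hdE haW hda
    grind
  by_cases hdt : d = t
  · subst hdt
    have := hw a haW hda
    grind
  · obtain rfl : d = x := by grind
    have h4 : a ≠ v := by rintro rfl; exact hadj hda
    have h5 := fun h => hyu a h hda
    have := hp a haW hda
    grind

/-- A set of vertices attached only to `x` and `v` is a chain starting at `x`. -/
lemma SmallEars.chain {W T B : Finset V} {N : ℕ} {x v : V} (hW : Crit G W)
    (hN : SmallEars G W N) (hTW : T ⊆ W) (hcard : T.card < N) (hxW : x ∈ W) (hvW : v ∈ W)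
    (hxT : x ∉ T) (hvT : v ∉ T) (hxv : x ≠ v) (hnb : nb G W T ⊆ {x, v})
    (hT : T = ∅ ∨ ConnSet G T ∧ Touch G {x} T) (hB : ConnSet G B) (hxB : x ∉ B) (hvB : v ∉ B)
    (hTB : ∀ a ∈ T, a ∉ B) (hBx : Touch G {x} B) (hBv : Touch G {v} B)
    (hp : (∃ p, ∀ w ∈ W, G.Adj x w → w ∈ T ∨ w = p ∨ w = v) ∨ ∀ t E, Ear G W x t E → ¬ E ⊆ T) :
    Chain G x (insert x T) := by
  induction hn : T.card using Nat.strong_induction_on generalizing T B x with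
  | _ n ih =>
  rcases hT with rfl | ⟨hT, hxT'⟩
  · exact .single x
  by_cases hadj : G.Adj x v
  · exact (hN x v T ⟨hxW, hvW, hadj, hTW, hxT, hvT, hT, hnb⟩ hcard).chain
  have hno : ∀ t E, Ear G W x t E → ¬ E ⊆ T := by
    rcases hp with ⟨p, hp⟩ | hp
    · exact fun t E hE hET => hN.false_of_ear hW hTW hcard.le hxW hvW hxT hvT hxv hadj hnb hT hB hxB
        hvB hTB hBx hBv hp hE hET
    · exact hp
  obtain ⟨y, hy, hxy, hyu, hTy⟩ := hW.noTheta.exists_unique_adj hT hxT hvT hxv hxT' hB hxB hvB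
    hTB hBx hBv fun s hs hxs m hm =>
      hN.touch_comp (E := ∅) (t := x) hTW hxW hxT (by simpa using hnb)
      (by simpa using hcard.le) (by simp) (Or.inl rfl)
      (fun s' E' hE' h' => absurd (by simpa using h') (hno s' E' hE')) hs hxs hm
  have hBx' : ConnSet G (insert x B) := by
    obtain ⟨a, ha, b, hb, hab⟩ := hBx
    rw [mem_singleton] at ha
    subst ha
    exact hB.insert hb hab
  have hlt : (T.erase y).card < T.card := card_erase_lt_of_mem hy
  have := ih _ (hn ▸ hlt) (T := T.erase y) (x := y) (B := insert x B) (by grind) (by omega)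
    (hTW hy) (by simp) (by grind) (by grind) (fun a ha => by
      obtain ⟨haW, haT, d, hd, hda⟩ := mem_nb.mp ha
      have h1 := mem_or_mem_nb (show d ∈ T by grind) haW hda
      have h2 : a = x → d = y := by
        rintro rfl
        exact hyu d (by grind) hda.symm
      grind)
    (hTy.imp_right fun h => ⟨h, by
      obtain ⟨a, ha, had, b, hb, hbd, hab⟩ := hT.exists_adj (P := {y})
        ⟨y, by simp [hy]⟩ fun h' => by have := h.1; grind
      exact ⟨a, had, b, by grind, hab⟩⟩)
    hBx' (by grind) (by grind) (by grind) (touch_of_adj hxy.symm (by simp) (by simp))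
    (hBv.mono subset_rfl (by simp))
    (Or.inl ⟨x, fun w hw hyw => by
      have h1 := mem_or_mem_nb hy hw hyw
      have h2 := hyw.ne
      grind⟩) rfl
  rw [insert_erase hy] at this
  exact .cons this hxT hxy hyu

/-- A small connected set attached only to a 4-clique is impossible. -/
lemma SmallEars.false_of_clique {W C : Finset V} {N : ℕ} {a b c d : V} (hW : Crit G W)
    (hN : SmallEars G W N) (hCW : C ⊆ W) (hcard : C.card < N) (hC : ConnSet G C)
    (haW : a ∈ W) (hbW : b ∈ W) (hcW : c ∈ W) (hdW : d ∈ W)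
    (haC : a ∉ C) (hbC : b ∉ C) (hcC : c ∉ C) (hdC : d ∉ C)
    (hnb : nb G W C ⊆ {a, b, c, d}) (hab : G.Adj a b) (hac : G.Adj a c) (had : G.Adj a d)
    (hbc : G.Adj b c) (hbd : G.Adj b d) (hcd : G.Adj c d) : False := by
  have key : ∀ w x y z : V, G.Adj w x → G.Adj w y → G.Adj w z → G.Adj x y → G.Adj x z →
      G.Adj y z → y ∉ C → z ∉ C → w ∈ nb G W C → x ∈ nb G W C → False :=
    fun w x y z hwx hwy hwz hxy hxz hyz hy hz hw hx =>
      hW.noTheta w x C {y} {z} hwx.ne (link_of_nb hC hw hx) (link_singleton hwy.symm hxy.symm)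
        (link_singleton hwz.symm hxz.symm) (by grind) (by grind) (by simpa using hyz.ne)
  have main : ∀ w x y z : V, G.Adj w x → G.Adj w y → G.Adj w z → G.Adj x y → G.Adj x z →
      G.Adj y z → w ∈ W → x ∈ W → w ∉ C → x ∉ C → y ∉ C → z ∉ C → nb G W C ⊆ {w, x, y, z} →
      w ∉ nb G W C := by
    intro w x y z hwx hwy hwz hxy hxz hyz hwW hxW hwC hxC hyC hzC hn hw
    have k1 : x ∉ nb G W C := key w x y z hwx hwy hwz hxy hxz hyz hyC hzC hw
    have k2 : y ∉ nb G W C := key w y x z hwy hwx hwz hxy.symm hyz hxz hxC hzC hw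
    have k3 : z ∉ nb G W C := key w z x y hwz hwx hwy hxz.symm hyz.symm hxy hxC hyC hw
    obtain ⟨x', hx', e, he, hxe⟩ := (hN w x C ⟨hwW, hxW, hwx, hCW, hwC, hxC, hC, fun a ha => by
      have := hn ha
      simp only [mem_insert, mem_singleton] at this ⊢
      rcases this with rfl | rfl | rfl | rfl <;> tauto⟩ hcard).symm.touch
    rw [mem_singleton] at hx'
    exact k1 (mem_nb.mpr ⟨hxW, hxC, e, he, hx' ▸ hxe.symm⟩)
  obtain ⟨x, hx⟩ := hW.exists_nb hCW hC.1 haW haC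
  have hx' := hnb hx
  simp only [mem_insert, mem_singleton] at hx'
  rcases hx' with rfl | rfl | rfl | rfl
  · exact main x b c d hab hac had hbc hbd hcd haW hbW haC hbC hcC hdC hnb hx
  · exact main x a c d hab.symm hbc hbd hac had hcd hbW haW hbC haC hcC hdC
      (hnb.trans (by intro; simp; tauto)) hx
  · exact main x a b d hac.symm hbc.symm hcd hab had hbd hcW haW hcC haC hbC hdC
      (hnb.trans (by intro; simp; tauto)) hx
  · exact main x a b c had.symm hbd.symm hcd.symm hab hac hbc hdW haW hdC haC hbC hcC
      (hnb.trans (by intro; simp; tauto)) hx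

lemma SmallEars.adj_unique {W S T E : Finset V} {u v t y y' : V} (hW : Crit G W)
    (h : Piece G W u v S) (hN : SmallEars G W S.card) (hTE : ∀ a ∈ T, a ∉ E) (hS : T ∪ E = S)
    (hT : ConnSet G T) (hE : E = ∅ ∨ Ear G W u t E ∧ t ∈ T)
    (huniq : ∀ s' E', Ear G W u s' E' → E' ⊆ S → E' = E) (hy : y ∈ T) (hy' : y' ∈ T)
    (huy : G.Adj u y) (huy' : G.Adj u y') : y = y' := by
  by_contra hne
  have hu := h.left; have hv := h.right; have hSW := h.subset; have huS := h.left_notMem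
  have hvS := h.right_notMem
  have hnb := h.nb_subset
  have htc := fun s hs hus m hm => hN.touch_comp (T := T) (E := E) (t := t) (x := u) (v := v)
    (s := s) (m := m) (by grind) hu (by grind) (by rwa [hS]) (by rw [hS]) hTE hE (by rwa [hS])
    hs hus hm
  have h1 := htc y hy huy y' (by grind)
  have h2 := htc y' hy' huy' y (by grind)
  have huT : u ∉ T := by grind
  have hvT : ∀ a ∈ T, a ∉ ({v} : Finset V) := by grind
  have huv : u ∉ ({v} : Finset V) := by simpa using h.adj.ne
  have htuv : Touch G {u} {v} := touch_of_adj h.adj (by simp) (by simp)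
  have hyv := hW.noTheta.adj_of_touch_comp hT hy hy' hne huy huy' huT (connSet_singleton v)
    (by simp) huv hvT htuv h2 h1
  have hy'v := hW.noTheta.adj_of_touch_comp hT hy' hy (Ne.symm hne) huy' huy huT
    (connSet_singleton v) (by simp) huv hvT htuv h1 h2
  have hyy := hW.noTheta.adj_of_adj hT hy hy' hne huy huy' huT (connSet_singleton v) huv hvT
    (touch_of_adj hyv (by simp) (by simp)) (touch_of_adj hy'v (by simp) (by simp))
  obtain ⟨m, hm⟩ : (S \ {y, y'}).Nonempty := by
    rw [← card_pos]
    have := le_card_sdiff {y, y'} S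
    have := card_le_two (a := y) (b := y')
    have := h.three_le_card hW
    omega
  have hC := connSet_comp (G := G) hm
  have hCs := comp_subset (G := G) (A := S \ {y, y'}) (m := m)
  have hCcl := fun a b => comp_closed (G := G) (A := S \ {y, y'}) (m := m) (a := a) (b := b)
  set C := comp G (S \ {y, y'}) m
  refine hN.false_of_clique hW (by grind)
    (card_lt_card (s := C) ⟨by grind, fun h => by have := h (show y ∈ S by grind); grind⟩) hC
    hu hv (hSW (by grind : y ∈ S)) (hSW (by grind : y' ∈ S)) (by grind) (by grind) (by grind)
    (by grind) (fun w hw => ?_) h.adj huy huy' hyv.symm hy'v.symm hyy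
  obtain ⟨hwW, hwC, d, hd, hdw⟩ := mem_nb.mp hw
  have h3 := mem_or_mem_nb (show d ∈ S by grind) hwW hdw
  have h4 := fun h => hCcl d w hd h hdw
  grind

/-- Apart from the ear at `u`, a smallest piece is a chain. -/
lemma SmallEars.chain_sdiff {W S T E : Finset V} {u v t : V} (hW : Crit G W)
    (h : Piece G W u v S) (hN : SmallEars G W S.card) (hTE : ∀ a ∈ T, a ∉ E) (hS : T ∪ E = S)
    (hT : ConnSet G T) (hE : E = ∅ ∨ Ear G W u t E ∧ t ∈ T)
    (huniq : ∀ s' E', Ear G W u s' E' → E' ⊆ S → E' = E) (hTu : Touch G {u} T) :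
    ∃ y, Chain G y T ∧ G.Adj u y ∧ ∀ y' ∈ T, G.Adj u y' → y' = y := by
  obtain ⟨u', hu', y, hy, huy⟩ := hTu
  rw [mem_singleton] at hu'
  subst hu'
  have hu := h.left; have hv := h.right; have hSW := h.subset; have huS := h.left_notMem
  have hvS := h.right_notMem
  have hnb := h.nb_subset
  have hyu : ∀ y' ∈ T, G.Adj u' y' → y' = y := fun y' hy' huy' =>
    hN.adj_unique hW h hTE hS hT hE huniq hy' hy huy' huy
  refine ⟨y, ?_, huy, hyu⟩
  have hty : E ≠ ∅ → t = y := fun hne => by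
    obtain ⟨hE, ht⟩ := hE.resolve_left hne
    exact hyu t ht hE.1.adj
  have hET : ∀ e ∈ E, ∀ a ∈ W, G.Adj e a → a ∈ E ∨ a = u' ∨ a = y := fun e he a ha hea => by
    have hne : E ≠ ∅ := ne_empty_of_mem he
    have h1 := hty hne
    subst h1
    have := (hE.resolve_left hne).1.1.nb_subset
    have := mem_or_mem_nb he ha hea
    grind
  have hconn := hW.noTheta.erase_conn hT hy (v := v) (by grind) (connSet_singleton u')
    (by simpa using h.adj.ne') (by grind) (touch_of_adj huy.symm (by simp) (by simp))
    (touch_of_adj h.adj.symm (by simp) (by simp)) fun m hm =>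
      hN.touch_comp (T := T) (E := E) (t := t) (x := u') (v := v)
        (by grind) hu (by grind) (by rwa [hS]) (by rw [hS]) hTE hE (by rwa [hS]) hy huy hm
  have hlt : (T.erase y).card < S.card :=
    (card_erase_lt_of_mem hy).trans_le (card_le_card (by grind))
  have := hN.chain hW (T := T.erase y) (B := {u'}) (x := y) (v := v) (by grind) hlt
    (hSW (by grind)) hv (by simp) (by grind) (by grind) (fun w hw => by
      obtain ⟨hwW, hwC, d, hd, hdw⟩ := mem_nb.mp hw
      have h1 := mem_or_mem_nb (show d ∈ S by grind) hwW hdw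
      have h2 : w = u' → d = y := by
        rintro rfl
        exact hyu d (by grind) hdw.symm
      have h3 : w ∈ E → d = y := fun hwE => by
        have := hET w hwE d (by grind) hdw.symm
        grind
      grind)
    (hconn.imp_right fun h => ⟨h, by
      obtain ⟨a, ha, had, b, hb, hbd, hab⟩ := hT.exists_adj (P := {y})
        ⟨y, by simp [hy]⟩ fun h' => by have := h.1; grind
      exact ⟨a, had, b, by grind, hab⟩⟩)
    (connSet_singleton u') (by simpa using huy.ne') (by simpa using h.adj.ne') (by grind)
    (touch_of_adj huy.symm (by simp) (by simp)) (touch_of_adj h.adj.symm (by simp) (by simp))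
    (by
      rcases hE with rfl | ⟨hE, ht⟩
      · refine Or.inl ⟨u', fun w hw hyw => ?_⟩
        have h1 := mem_or_mem_nb (show y ∈ S by grind) hw hyw
        have h2 := hyw.ne
        grind
      · have h1 := hty hE.1.conn.1.ne_empty
        subst h1
        refine Or.inr fun s E' hE' hs => ?_
        have := hE'.eq_of_base hW hE.symm
        have := hE.1.conn.1
        grind)
  rwa [insert_erase hy] at this

lemma SmallEars.ear_of_chain {W S : Finset V} {u v y : V} (hW : Crit G W)
    (h : Piece G W u v S) (hN : SmallEars G W S.card) (hS : Chain G y S) (huy : G.Adj u y)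
    (hyu : ∀ y' ∈ S, G.Adj u y' → y' = y) : Ear G W u v S := by
  have h3 := h.card_eq_three hW hS
  refine ⟨h, ?_⟩
  cases hS with
  | single => simp at h3
  | @cons _ q T hT hyT hyq hq =>
  cases hT with
  | single => rw [card_pair (by grind)] at h3; omega
  | @cons _ r T hT hqT hqr hr =>
  cases hT with
  | @cons _ s T hT hrT hrs hs =>
    have := card_pos.mpr ⟨s, hT.mem⟩
    rw [card_insert_of_notMem hyT, card_insert_of_notMem hqT, card_insert_of_notMem hrT] at h3
    omega
  | single =>
  have hv := h.right; have hSW := h.subset; have huS := h.left_notMem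
  have hvS := h.right_notMem
  have hnb := h.nb_subset
  have hyr : ¬ G.Adj y r := fun h => by have := hq r (by simp) h; grind
  have huq : ¬ G.Adj u q := fun h => by have := hyu q (by simp) h; grind
  have hur : ¬ G.Adj u r := fun h => by have := hyu r (by simp) h; grind
  have hno : ∀ a b P, Piece G W a b P → 3 ≤ P.card := fun a b P hP => hP.three_le_card hW
  have n1 : ∀ w ∈ W, G.Adj r w → w = q ∨ w = v := fun w hw hrw => by
    have h1 := mem_or_mem_nb (D := {y, q, r}) (by simp) hw hrw
    have h2 : w ≠ y := by rintro rfl; exact hyr hrw.symm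
    have h3 : w ≠ u := by rintro rfl; exact hur hrw.symm
    have h4 := hrw.ne
    clear hN hno
    grind
  have n2 : ∀ w ∈ W, G.Adj q w → w = y ∨ w = r ∨ w = v := fun w hw hrw => by
    have h1 := mem_or_mem_nb (D := {y, q, r}) (by simp) hw hrw
    have h3 : w ≠ u := by rintro rfl; exact huq hrw.symm
    have h4 := hrw.ne
    clear hN hno
    grind
  have nr : nb G W {r} ⊆ {q, v} := fun w hw => by
    obtain ⟨hwW, -, d, hd, hdw⟩ := mem_nb.mp hw
    rw [mem_singleton] at hd
    subst hd
    simpa using n1 w hwW hdw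
  have hqW : q ∈ W := hSW (by simp)
  have hyW : y ∈ W := hSW (by simp)
  have hrW : r ∈ W := hSW (by simp)
  have hqv : ¬ G.Adj v q := fun hvq => by
    have := hno q v {r} ⟨hqW, hv, hvq.symm, by simpa using hrW, by grind, by grind,
      connSet_singleton r, nr⟩
    simp at this
  have hrv : G.Adj r v := by
    by_contra hrv
    have := hno y q {r} ⟨hyW, hqW, hyq, by simpa using hrW, by grind, by grind,
      connSet_singleton r, fun w hw => by
        have h1 := nr hw
        obtain ⟨-, -, d, hd, hdw⟩ := mem_nb.mp hw
        have h2 : w ≠ v := by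
          rintro rfl
          rw [mem_singleton] at hd
          exact hrv (hd ▸ hdw)
        grind⟩
    simp at this
  have hvy : ¬ G.Adj v y := fun hvy => by
    have := hno y v {q, r} ⟨hyW, hv, hvy.symm, by grind, by grind, by grind,
      (connSet_singleton r).insert (by simp) hqr, fun w hw => by
        obtain ⟨hwW, hwS, d, hd, hdw⟩ := mem_nb.mp hw
        have h1 := n1 w hwW
        have h2 := n2 w hwW
        grind⟩
    rw [card_pair (by grind)] at this
    omega
  exact ⟨y, q, r, ⟨huy, hyq, hqr, hrv, h.adj.symm, huq, hyr, fun h => hqv h.symm,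
    fun h => hur h.symm, hvy⟩, rfl⟩

lemma SmallEars.ear_of_touch {W S : Finset V} {u v : V} (hW : Crit G W)
    (h : Piece G W u v S) (hN : SmallEars G W S.card) (hu : Touch G {u} S) : Ear G W u v S := by
  by_contra hne
  have hS := h.subset
  have huS := h.left_notMem
  have hvS := h.right_notMem
  have hnb := h.nb_subset
  by_cases hex : ∃ t E, Ear G W u t E ∧ E ⊆ S
  · obtain ⟨t, E, hE, hES⟩ := hex
    have hEn := hE.1.nb_subset
    have htE := hE.1.right_notMem
    have htu := hE.1.adj.ne
    have htS : t ∈ S := by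
      obtain ⟨a, ha, e, he, hae⟩ := hE.symm.touch
      rw [mem_singleton] at ha
      subst ha
      have h1 := mem_or_mem_nb (hES he) hE.1.right hae.symm
      have h2 : a ≠ v := by
        rintro rfl
        obtain ⟨w, hw⟩ := hE.1.conn.1
        have := h.conn.subset_of_nb (W := W) (D := E) hS ⟨w, by grind⟩ (by grind)
        exact hne (subset_antisymm this hES ▸ hE)
      grind
    obtain ⟨y, hy, -, hyu⟩ := hN.chain_sdiff hW h (T := S \ E) (E := E) (t := t) (by grind)
      (by grind) (hE.sdiff_conn h.conn hS huS htS) (Or.inr ⟨hE, by grind⟩)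
      (fun s' E' hE' _ => hE'.eq_of_base hW hE) (touch_of_adj hE.1.adj (by simp) (by grind))
    obtain rfl : t = y := hyu t (by grind) hE.1.adj
    have hEa : ∀ e ∈ E, ∀ a ∈ S \ E, G.Adj e a → a = t := fun e he a ha hea => by
      have := mem_or_mem_nb he (show a ∈ W by grind) hea
      grind
    obtain ⟨-, p, q, r, hc, rfl⟩ := hE
    obtain ⟨-, -, -, -, hpq, hpr, hpy, hqr, hqy, hry⟩ := hc.nodup
    have c1 : Chain G r (insert r (S \ {p, q, r})) :=
      .cons hy (by simp) hc.de (hEa r (by simp))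
    have c2 : Chain G q (insert q (insert r (S \ {p, q, r}))) :=
      .cons c1 (by grind) hc.cd fun a ha hqa => by
        rcases mem_insert.mp ha with rfl | ha
        · rfl
        · have := hEa q (by simp) a ha hqa
          exact absurd (this ▸ hqa) hc.ce
    have c3 : Chain G p (insert p (insert q (insert r (S \ {p, q, r})))) :=
      .cons c2 (by grind) hc.bc fun a ha hpa => by
        rcases mem_insert.mp ha with rfl | ha
        · rfl
        rcases mem_insert.mp ha with rfl | ha
        · exact absurd hpa hc.bd
        · have := hEa p (by simp) a ha hpa
          exact absurd (this ▸ hpa.symm) hc.eb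
    have e : insert p (insert q (insert r (S \ {p, q, r}))) = S := by
      ext a
      simp only [mem_insert, mem_sdiff, mem_singleton]
      have h1 := @hES a
      simp only [mem_insert, mem_singleton] at h1
      tauto
    rw [e] at c3
    have h3 := h.card_eq_three hW c3
    have h4 : ({p, q, r, t} : Finset V) ⊆ S := by grind
    have h5 := card_le_card h4
    rw [card_insert_of_notMem (by grind), card_insert_of_notMem (by grind),
      card_pair hry] at h5
    omega
  · push Not at hex
    obtain ⟨y, hy, huy, hyu⟩ := hN.chain_sdiff hW h (T := S) (E := ∅) (t := u) (by simp)
      (by simp) h.conn (Or.inl rfl) (fun s' E' hE' h' => absurd h' (hex s' E' hE')) hu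
    exact hne (hN.ear_of_chain hW h hy huy hyu)

lemma SmallEars.ear {W S : Finset V} {u v : V} (hW : Crit G W) (h : Piece G W u v S)
    (hN : SmallEars G W S.card) : Ear G W u v S := by
  obtain ⟨a, ha⟩ := hW.exists_nb h.subset h.conn.1 h.left h.left_notMem
  have ht := touch_of_mem_nb ha
  have ha' := h.nb_subset ha
  simp only [mem_insert, mem_singleton] at ha'
  rcases ha' with rfl | rfl
  · exact hN.ear_of_touch hW h ht
  · exact (hN.ear_of_touch hW h.symm ht).symm

lemma Crit.smallEars {W : Finset V} (hW : Crit G W) (N : ℕ) : SmallEars G W N := by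
  induction N with
  | zero => exact fun _ _ _ _ h => absurd h (by omega)
  | succ n ih =>
    intro u v S h hS
    exact SmallEars.ear hW h fun u' v' S' h' hS' => ih u' v' S' h' (by omega)

lemma not_crit {W : Finset V} : ¬ Crit G W := by
  intro hW
  obtain ⟨u, v, S, h, hS⟩ := hW.exists_piece
  exact hS (hW.smallEars (S.card + 1) u v S h (by omega))

lemma NoTheta.good (hG : NoTheta G) (W : Finset V) : Good G W := by
  induction W using Finset.strongInductionOn with
  | _ W ih =>
  by_contra hbad
  exact not_crit ⟨hG, ih, hbad⟩

end Crit

section Bridge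

variable {V : Type*} [DecidableEq V] {G : SimpleGraph V}

lemma ConnSet.exists_path {A : Finset V} (hA : ConnSet G A) {a b : V} (ha : a ∈ A) (hb : b ∈ A) :
    ∃ p : G.Walk a b, p.IsPath ∧ ∀ x ∈ p.support, x ∈ A := by
  classical
  have h : A ⊆ A.filter fun w => ∃ p : G.Walk a w, ∀ x ∈ p.support, x ∈ A := by
    refine hA.subset_of_closed ⟨a, ?_⟩ ?_
    · simp only [mem_inter, mem_filter]
      exact ⟨ha, ha, Walk.nil, by simpa using ha⟩
    · intro x _ hx y hy hxy
      obtain ⟨p, hp⟩ := (mem_filter.mp hx).2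
      refine mem_filter.mpr ⟨hy, p.concat hxy, fun z hz => ?_⟩
      rw [Walk.support_concat] at hz
      simp only [List.mem_append, List.mem_singleton] at hz
      rcases hz with hz | rfl
      · exact hp z hz
      · exact hy
  obtain ⟨p, hp⟩ := (mem_filter.mp (h hb)).2
  exact ⟨p.bypass, p.bypass_isPath, fun x hx => hp x (p.support_bypass_subset_support hx)⟩

lemma Link.exists_path {u v : V} {B : Finset V} (h : Link G u {v} B) :
    ∃ a ∈ B, G.Adj u a ∧ ∃ p : G.Walk v a, p.IsPath ∧ ∀ x ∈ p.support, x = v ∨ x ∈ B := by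
  obtain ⟨_, hu, a, ha, hua⟩ := h.left
  obtain ⟨_, hv, b, hb, hvb⟩ := h.right
  rw [mem_singleton] at hu hv
  subst hu hv
  obtain ⟨p, hp, hpB⟩ := h.conn.exists_path hb ha
  refine ⟨a, ha, hua, Walk.cons hvb p, ?_, ?_⟩
  · rw [Walk.cons_isPath_iff]
    exact ⟨hp, fun hx => h.sep _ (mem_singleton_self _) (hpB _ hx)⟩
  · intro x hx
    rw [Walk.support_cons, List.mem_cons] at hx
    exact hx.imp_right (hpB x)

lemma containsSubdivision_of_links {u v : V} {B : Fin 3 → Finset V} (huv : u ≠ v)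
    (hB : ∀ j, Link G u {v} (B j)) (hd : ∀ i j x, x ∈ B i → x ∈ B j → i = j) :
    ContainsSubdivision G (completeBipartiteGraph (Fin 2) (Fin 3)) := by
  choose a haB hua p hp hpB using fun j => (hB j).exists_path
  have hu : ∀ j, u ∉ B j := fun j => (hB j).notMem
  have hv : ∀ j, v ∉ B j := fun j => (hB j).sep v (mem_singleton_self v)
  let h : Fin 2 → V := ![u, v]
  have hh : ∀ i j, h i ∉ B j := by
    intro i j
    fin_cases i
    · exact hu j
    · exact hv j
  have hinj : ∀ i i', h i = h i' → i = i' := by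
    intro i i'
    fin_cases i <;> fin_cases i' <;> simp [h, huv, huv.symm]
  let f : Fin 2 ⊕ Fin 3 → V := Sum.elim h a
  have hQ : ∀ i j, ∃ q : G.Walk (h i) (a j), q.IsPath ∧
      ∀ x ∈ q.support, x = h i ∨ x = a j ∨ i = 1 ∧ x ∈ B j := by
    intro i j
    fin_cases i
    · refine ⟨(hua j).toWalk, Walk.IsPath.of_adj (hua j), fun x hx => ?_⟩
      simpa [h] using hx
    · refine ⟨p j, hp j, fun x hx => ?_⟩
      have := hpB j x hx
      simp only [h]
      tauto
  have hP : ∀ x w, (completeBipartiteGraph (Fin 2) (Fin 3)).Adj x w →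
      ∃ q : G.Walk (f x) (f w), q.IsPath ∧ ∃ i j, s(x, w) = s(Sum.inl i, Sum.inr j) ∧
        ∀ y ∈ q.support, y = h i ∨ y = a j ∨ i = 1 ∧ y ∈ B j := by
    rintro (i | j) (i' | j') hadj
    · simp at hadj
    · obtain ⟨q, h1, h2⟩ := hQ i j'
      exact ⟨q, h1, i, j', rfl, h2⟩
    · obtain ⟨q, h1, h2⟩ := hQ i' j
      refine ⟨q.reverse, h1.reverse, i', j, Sym2.eq_swap, fun y hy => h2 y ?_⟩
      replace hy : y ∈ q.reverse.support := hy
      rwa [Walk.support_reverse, List.mem_reverse] at hy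
    · simp at hadj
  choose P hPath I J hs hsup using hP
  have hr : ∀ y, y ∈ Set.range f ↔ (∃ i, y = h i) ∨ ∃ j, y = a j := by
    intro y
    simp only [Set.mem_range, Sum.exists, f, Sum.elim_inl, Sum.elim_inr, eq_comm]
  refine ⟨f, ?_, fun x w hxw => P x w hxw, fun x w hxw => hPath x w hxw, ?_, ?_⟩
  · rintro (i | j) (i' | j') hxy
    · exact congrArg _ (hinj _ _ hxy)
    · change h i = a j' at hxy
      exact absurd (hxy ▸ haB j') (hh i j')
    · change a j = h i' at hxy
      exact absurd (hxy ▸ haB j) (hh i' j)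
    · change a j = a j' at hxy
      exact congrArg _ (hd _ _ _ (haB j) (hxy ▸ haB j'))
  · intro x w hxw y hy hyr
    have h1 := hsup x w hxw y hy
    have h2 : y = h (I x w hxw) ∨ y = a (J x w hxw) := by
      rw [hr] at hyr
      rcases hyr with ⟨i, rfl⟩ | ⟨j, rfl⟩
      · grind
      · grind
    rcases Sym2.eq_iff.mp (hs x w hxw) with ⟨e1, e2⟩ | ⟨e1, e2⟩
    · exact h2.imp (·.trans (congrArg f e1.symm)) (·.trans (congrArg f e2.symm))
    · exact h2.symm.imp (·.trans (congrArg f e1.symm)) (·.trans (congrArg f e2.symm))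
  · intro x w hxw x' w' hxw' hne y hy hy'
    have h1 := hsup x w hxw y hy
    have h1' := hsup x' w' hxw' y hy'
    rw [hr]
    rw [hs x w hxw, hs x' w' hxw'] at hne
    by_contra hc
    push Not at hc
    have e : I x w hxw = I x' w' hxw' := by grind
    have e' : J x w hxw = J x' w' hxw' := by grind
    rw [e, e'] at hne
    exact hne rfl

lemma noTheta_of_not_containsSubdivision
    (h : ¬ ContainsSubdivision G (completeBipartiteGraph (Fin 2) (Fin 3))) : NoTheta G := by
  intro u v B₁ B₂ B₃ huv h₁ h₂ h₃ h₁₂ h₁₃ h₂₃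
  refine h (containsSubdivision_of_links (B := ![B₁, B₂, B₃]) huv ?_ ?_)
  · intro j
    fin_cases j
    · exact h₁
    · exact h₂
    · exact h₃
  · intro i j x hi hj
    fin_cases i <;> fin_cases j <;> simp at hi hj ⊢ <;> grind

/-- A closed induced five-cycle is a component isomorphic to `cycleGraph 5`. -/
lemma Cyc5.exists_component {a b c d e : V} (h : Cyc5 G a b c d e)
    (hcl : ∀ x ∈ ({a, b, c, d, e} : Finset V), ∀ y, G.Adj x y →
      y ∈ ({a, b, c, d, e} : Finset V)) :
    ∃ C : G.ConnectedComponent, Nonempty (G.induce C.supp ≃g cycleGraph 5) := by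
  have hsupp : ∀ x, x ∈ (G.connectedComponentMk a).supp ↔
      x ∈ ({a, b, c, d, e} : Finset V) := by
    intro x
    rw [ConnectedComponent.mem_supp_iff, ConnectedComponent.eq]
    constructor
    · rintro ⟨p⟩
      have key : ∀ {s t : V} (q : G.Walk s t), t ∈ ({a, b, c, d, e} : Finset V) →
          s ∈ ({a, b, c, d, e} : Finset V) := by
        intro s t q
        induction q with
        | nil => exact id
        | cons hst _ ih => exact fun ht => hcl _ (ih ht) _ hst.symm
      exact key p (by simp)
    · have hb := h.ab.reachable
      have hc := hb.trans h.bc.reachable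
      have hd := hc.trans h.cd.reachable
      have he := hd.trans h.de.reachable
      simp only [mem_insert, mem_singleton]
      rintro (rfl | rfl | rfl | rfl | rfl)
      · exact Reachable.refl _
      · exact hb.symm
      · exact hc.symm
      · exact hd.symm
      · exact he.symm
  let g : Fin 5 → V := ![a, b, c, d, e]
  have hg : ∀ i, g i ∈ (G.connectedComponentMk a).supp := by
    intro i
    rw [hsupp]
    fin_cases i <;> simp [g]
  obtain ⟨h1, h2, h3, h4, h5, h6, h7, h8, h9, h10⟩ := h.nodup
  let F : Fin 5 → (G.connectedComponentMk a).supp := fun i => ⟨g i, hg i⟩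
  have hF : Function.Bijective F := by
    constructor
    · intro i j hij
      have : g i = g j := congrArg Subtype.val hij
      fin_cases i <;> fin_cases j <;> simp [g] at this ⊢ <;> grind
    · rintro ⟨x, hx⟩
      have := (hsupp x).mp hx
      simp only [mem_insert, mem_singleton] at this
      rcases this with rfl | rfl | rfl | rfl | rfl
      exacts [⟨0, rfl⟩, ⟨1, rfl⟩, ⟨2, rfl⟩, ⟨3, rfl⟩, ⟨4, rfl⟩]
  refine ⟨_, ⟨(⟨Equiv.ofBijective F hF, ?_⟩ : cycleGraph 5 ≃g _).symm⟩⟩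
  intro i j
  change G.Adj (g i) (g j) ↔ _
  have := h.ab; have := h.bc; have := h.cd; have := h.de; have := h.ea
  have := h.ac; have := h.bd; have := h.ce; have := h.da; have := h.eb
  rw [cycleGraph_adj]
  fin_cases i <;> fin_cases j <;> simp [g] <;> grind [SimpleGraph.adj_comm]

lemma poor_univ_eq_empty [Fintype V]
    (hC5 : ∀ c : G.ConnectedComponent, ¬ Nonempty (G.induce c.supp ≃g cycleGraph 5))
    (hC5' : ∀ v : V, ∀ c : (deleteVerts G {v}).ConnectedComponent,
      ¬ Nonempty ((deleteVerts G {v}).induce c.supp ≃g cycleGraph 5)) :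
    poor G univ = ∅ := by
  rw [eq_empty_iff_forall_notMem]
  intro D hD
  obtain ⟨-, ⟨a, b, c, d, e, h, rfl⟩, hnb⟩ := mem_poor.mp hD
  rcases Nat.le_one_iff_eq_zero_or_eq_one.mp hnb with h0 | h1
  · rw [card_eq_zero] at h0
    obtain ⟨C, hC⟩ := h.exists_component fun x hx y hxy => by
      have := mem_or_mem_nb hx (mem_univ y) hxy
      simpa [h0] using this
    exact hC5 C hC
  · obtain ⟨v, hv⟩ := card_eq_one.mp h1
    have hvD : v ∉ ({a, b, c, d, e} : Finset V) :=
      (mem_nb.mp (hv ▸ mem_singleton_self v : v ∈ nb G univ _)).2.1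
    simp only [mem_insert, mem_singleton, not_or] at hvD
    obtain ⟨C, hC⟩ := Cyc5.exists_component (G := deleteVerts G {v})
      (a := ⟨a, by simp; tauto⟩) (b := ⟨b, by simp; tauto⟩) (c := ⟨c, by simp; tauto⟩)
      (d := ⟨d, by simp; tauto⟩) (e := ⟨e, by simp; tauto⟩)
      ⟨h.ab, h.bc, h.cd, h.de, h.ea, h.ac, h.bd, h.ce, h.da, h.eb⟩ <| by
        rintro ⟨x, hxv⟩ hx ⟨y, hyv⟩ hxy
        have hx' : x ∈ ({a, b, c, d, e} : Finset V) := by simpa using hx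
        have := mem_or_mem_nb hx' (mem_univ y) hxy
        rw [hv] at this
        simpa using this.resolve_right hyv
    exact hC5' v C hC

end Bridge
end EdgeRoman

/-- Let `G` be a graph on `n` vertices containing no subgraph isomorphic to a subdivision
of `K_{2,3}`. If no connected component of `G` is isomorphic to the 5-cycle `C₅` and there
is no vertex `v` such that `G − v` has a connected component isomorphic to `C₅`, then
`γ'_R(G) ≤ (3/4)·n`. -/
theorem edgeRomanNumber_le_of_no_K23_subdivision_no_C5 {V : Type*} [Fintype V]
    [DecidableEq V] (G : SimpleGraph V)
    (hK23 : ¬ ContainsSubdivision G (completeBipartiteGraph (Fin 2) (Fin 3)))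
    (hC5 : ∀ c : G.ConnectedComponent,
      ¬ Nonempty (G.induce c.supp ≃g cycleGraph 5))
    (hC5' : ∀ v : V, ∀ c : (deleteVerts G {v}).ConnectedComponent,
      ¬ Nonempty ((deleteVerts G {v}).induce c.supp ≃g cycleGraph 5)) :
    (edgeRomanNumber V G : ℝ) ≤ 3 / 4 * Fintype.card V := by
  obtain ⟨c, hc, hle⟩ := (EdgeRoman.noTheta_of_not_containsSubdivision hK23).good univ
  rw [EdgeRoman.poor_univ_eq_empty hC5 hC5', card_empty, add_zero, card_univ] at hle
  have h : 4 * edgeRomanNumber V G ≤ 3 * Fintype.card V :=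
    (Nat.mul_le_mul_left 4 hc.edgeRomanNumber_le).trans hle
  have h' : (4 : ℝ) * edgeRomanNumber V G ≤ 3 * Fintype.card V := by exact_mod_cast h
  linarith
end

section
/- If G is a graph on n vertices that does not contain any subgraph isomorphic to a subdivision of K_{2,3}, then γ'_R(G) ≤ (4/5)·n. -/
open Finset SimpleGraph

/-- `u` and `v` are the branch vertices of degree three of a subdivided `K_{2,3}`, the three
internally disjoint `u`-`v` paths running through `w i` and otherwise inside `T i`. -/
lemma containsSubdivision_completeBipartiteGraph_two_three {V : Type*} {G : SimpleGraph V}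
    {u v : V} (w : Fin 3 → V) (T : Fin 3 → Set V) (hvu : v ≠ u)
    (huw : ∀ i, G.Adj u (w i)) (hwv : ∀ i, w i ≠ v) (huT : ∀ i, u ∉ T i)
    (hq : ∀ i, ∃ q : G.Walk (w i) v, ∀ x ∈ q.support, x ∈ T i)
    (hT : ∀ i j, i ≠ j → ∀ x, x ∈ T i → x ∈ T j → x = v) :
    ContainsSubdivision G (completeBipartiteGraph (Fin 2) (Fin 3)) := by
  classical
  have hwT : ∀ i, w i ∈ T i := fun i => by
    obtain ⟨q, hq⟩ := hq i
    exact hq _ q.start_mem_support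
  have hvT : ∀ i, v ∈ T i := fun i => by
    obtain ⟨q, hq⟩ := hq i
    exact hq _ q.end_mem_support
  let f : Fin 2 ⊕ Fin 3 → V := Sum.elim ![u, v] w
  let S : Fin 2 → Fin 3 → Set V := fun a i => if a = 0 then {u, w i} else T i
  have hS : ∀ a i, ∃ q : G.Walk (f (.inl a)) (f (.inr i)),
      q.IsPath ∧ ∀ x ∈ q.support, x ∈ S a i := by
    intro a i
    fin_cases a
    · refine ⟨.cons (huw i) .nil, ?_, ?_⟩
      · exact Walk.IsPath.of_adj (huw i)
      · simp [S, f]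
    · obtain ⟨q, hq⟩ := hq i
      refine ⟨q.reverse.bypass, q.reverse.bypass_isPath, fun x hx => ?_⟩
      have := q.reverse.support_bypass_subset_support hx
      simpa [S] using hq x (by simpa using this)
  choose Q hQp hQS using hS
  have hwi : ∀ i j, w i = w j → i = j := by
    intro i j h
    by_contra hij
    exact hwv i (hT i j hij _ (hwT i) (h ▸ hwT j))
  have hfS : ∀ a i c, f c ∈ S a i → f c = f (.inl a) ∨ f c = f (.inr i) := by
    intro a i c hc
    fin_cases a
    · simpa [S, f] using hc
    · simp only [S, Fin.mk_one, one_ne_zero, if_false] at hc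
      rcases c with c | j
      · fin_cases c
        · exact absurd hc (huT i)
        · left; rfl
      · right
        by_contra hne
        have hij : j ≠ i := fun h => hne (by rw [h])
        exact hwv j (hT j i hij _ (hwT j) hc)
  have hSS : ∀ a i b j, (a ≠ b ∨ i ≠ j) → ∀ x, x ∈ S a i → x ∈ S b j → x ∈ Set.range f := by
    intro a i b j hne x hx hy
    have hu : u ∈ Set.range f := ⟨.inl 0, rfl⟩
    have hv : v ∈ Set.range f := ⟨.inl 1, rfl⟩
    have hw : ∀ i, w i ∈ Set.range f := fun i => ⟨.inr i, rfl⟩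
    have key : ∀ i, x ∈ S 0 i → x ∈ Set.range f := by
      intro i hx
      simp only [S, if_true, Set.mem_insert_iff, Set.mem_singleton_iff] at hx
      rcases hx with rfl | rfl
      · exact hu
      · exact hw i
    by_cases ha : a = 0
    · subst ha; exact key i hx
    by_cases hb : b = 0
    · subst hb; exact key j hy
    have hab : a = b := by omega
    have hij : i ≠ j := by tauto
    simp only [S, ha, hb, if_false] at hx hy
    rw [hT i j hij x hx hy]
    exact hv
  have hP : ∀ c d : Fin 2 ⊕ Fin 3, (completeBipartiteGraph (Fin 2) (Fin 3)).Adj c d →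
      ∃ a i, s(c, d) = s(.inl a, .inr i) ∧ ∃ q : G.Walk (f c) (f d),
        q.IsPath ∧ ∀ x ∈ q.support, x ∈ S a i := by
    rintro (a | i) (b | j) h
    · simp at h
    · exact ⟨a, j, rfl, Q a j, hQp a j, hQS a j⟩
    · exact ⟨b, i, Sym2.eq_swap, (Q b i).reverse, (hQp b i).reverse,
        fun x hx => hQS b i x (by simpa using hx)⟩
    · simp at h
  choose a i hai q hqp hqS using hP
  refine ⟨f, ?_, q, fun c d h => hqp c d h, ?_, ?_⟩
  · have huwne : ∀ i, u ≠ w i := fun i => (huw i).ne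
    rintro (c | c) (d | d) h
    · fin_cases c <;> fin_cases d
      · rfl
      · exact absurd h.symm hvu
      · exact absurd h hvu
      · rfl
    · fin_cases c
      · exact absurd h (huwne d)
      · exact absurd h.symm (hwv d)
    · fin_cases d
      · exact absurd h.symm (huwne c)
      · exact absurd h (hwv c)
    · rw [hwi c d h]
  · rintro c d h x hx ⟨e, rfl⟩
    have := hfS _ _ e (hqS c d h _ hx)
    have h2 := hai c d h
    rw [Sym2.eq_iff] at h2
    rcases h2 with ⟨h1, h2⟩ | ⟨h1, h2⟩
    · rwa [← h1, ← h2] at this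
    · rw [← h1, ← h2] at this
      exact this.symm
  · intro c d h c' d' h' hne x hx hx'
    refine hSS _ _ _ _ ?_ x (hqS c d h x hx) (hqS c' d' h' x hx')
    by_contra hcon
    push Not at hcon
    apply hne
    rw [hai c d h, hai c' d' h', hcon.1, hcon.2]

/-- The first `k + 1` values of `p` are the successive vertices of a path of `G` inside `A`. -/
structure IsPathSeq {V : Type*} (G : SimpleGraph V) (A : Finset V) (k : ℕ) (p : ℕ → V) :
    Prop where
  mem : ∀ t ≤ k, p t ∈ A
  inj : ∀ s ≤ k, ∀ t ≤ k, p s = p t → s = t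
  adj : ∀ t < k, G.Adj (p t) (p (t + 1))

namespace IsPathSeq

variable {V : Type*} {G : SimpleGraph V} {A : Finset V} {k : ℕ} {p : ℕ → V}

lemma lt_card (h : IsPathSeq G A k p) : k < A.card := by
  have := Finset.card_le_card_of_injOn (s := Finset.range (k + 1)) (t := A) p
    (fun t ht => h.mem t (by simp at ht; omega))
    (fun s hs t ht hst => h.inj s (by simp at hs; omega) t (by simp at ht; omega) hst)
  simp at this
  omega

lemma cons (h : IsPathSeq G A k p) {y : V} (hy : y ∈ A) (hyp : ∀ t ≤ k, y ≠ p t)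
    (hadj : G.Adj (p 0) y) : IsPathSeq G A (k + 1) (fun t => if t = 0 then y else p (t - 1)) where
  mem t ht := by
    split_ifs
    · exact hy
    · exact h.mem _ (by omega)
  inj s hs t ht hst := by
    split_ifs at hst with h1 h2 h2
    · omega
    · exact absurd hst (hyp _ (by omega))
    · exact absurd hst.symm (hyp _ (by omega))
    · have := h.inj _ (by omega) _ (by omega) hst
      omega
  adj t ht := by
    rcases t with _ | t
    · simpa using hadj.symm
    · simpa using h.adj t (by omega)

/-- Pósa rotation at the initial vertex, along the edge joining it to `p i`. -/
lemma rotate (h : IsPathSeq G A k p) {i : ℕ} (hik : i ≤ k)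
    (hadj : G.Adj (p 0) (p i)) :
    IsPathSeq G A k (fun t => if t < i then p (i - 1 - t) else p t) where
  mem t ht := by
    split_ifs
    · exact h.mem _ (by omega)
    · exact h.mem _ ht
  inj s hs t ht hst := by
    split_ifs at hst with h1 h2 h2
    all_goals
      have := h.inj _ (by omega) _ (by omega) hst
      omega
  adj t ht := by
    split_ifs with h1 h2 h2
    · have := h.adj (i - 1 - (t + 1)) (by omega)
      rw [show i - 1 - (t + 1) + 1 = i - 1 - t by omega] at this
      exact this.symm
    · rw [show i - 1 - t = 0 by omega, show t + 1 = i by omega]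
      exact hadj
    · omega
    · exact h.adj t ht

lemma exists_walk (h : IsPathSeq G A k p) {s t : ℕ} (hst : s ≤ t) (htk : t ≤ k) :
    ∃ q : G.Walk (p s) (p t), ∀ x ∈ q.support, x ∈ p '' Set.Icc s t := by
  induction t, hst using Nat.le_induction with
  | base => exact ⟨.nil, by simp⟩
  | succ t hst ih =>
    obtain ⟨q, hq⟩ := ih (by omega)
    refine ⟨q.concat (h.adj t (by omega)), fun x hx => ?_⟩
    rw [Walk.support_concat] at hx
    simp only [List.mem_append, List.mem_singleton] at hx
    rcases hx with hx | rfl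
    · obtain ⟨r, hr, rfl⟩ := hq x hx
      exact ⟨r, ⟨hr.1, by have := hr.2; omega⟩, rfl⟩
    · exact ⟨t + 1, ⟨by omega, le_rfl⟩, rfl⟩

lemma exists_walk_uIcc (h : IsPathSeq G A k p) {s t : ℕ} (hsk : s ≤ k) (htk : t ≤ k) :
    ∃ q : G.Walk (p s) (p t), ∀ x ∈ q.support, x ∈ p '' Set.uIcc s t := by
  rcases le_total s t with hst | hst
  · rw [Set.uIcc_of_le hst]
    exact h.exists_walk hst htk
  · obtain ⟨q, hq⟩ := h.exists_walk hst hsk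
    rw [Set.uIcc_of_ge hst]
    exact ⟨q.reverse, fun x hx => hq x (by simpa using hx)⟩

/-- Three index sets, carried by disjoint stretches of a path, which yield a subdivided
`K_{2,3}` with branch vertices `p a` and `p b`. -/
lemma containsSubdivision (h : IsPathSeq G A k p) {a b : ℕ} (ha : a ≤ k) (hb : b ≤ k)
    (hab : b ≠ a) (w : Fin 3 → ℕ) (T : Fin 3 → Set ℕ) (hTk : ∀ i, ∀ t ∈ T i, t ≤ k)
    (haw : ∀ i, G.Adj (p a) (p (w i)))
    (hwk : ∀ i, w i ≤ k) (hwb : ∀ i, w i ≠ b) (haT : ∀ i, a ∉ T i)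
    (hq : ∀ i, ∃ q : G.Walk (p (w i)) (p b), ∀ x ∈ q.support, x ∈ p '' T i)
    (hT : ∀ i j, i ≠ j → ∀ t, t ∈ T i → t ∈ T j → t = b) :
    ContainsSubdivision G (completeBipartiteGraph (Fin 2) (Fin 3)) := by
  refine containsSubdivision_completeBipartiteGraph_two_three (fun i => p (w i))
    (fun i => p '' T i) (fun e => hab (h.inj _ hb _ ha e)) haw
    (fun i e => hwb i (h.inj _ (hwk i) _ hb e)) ?_ hq ?_
  · rintro i ⟨t, ht, e⟩
    exact haT i (h.inj _ (hTk i t ht) _ ha e ▸ ht)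
  · rintro i j hij _ ⟨s, hs, rfl⟩ ⟨t, ht, e⟩
    have := h.inj _ (hTk j t ht) _ (hTk i s hs) e
    subst this
    rw [hT i j hij t hs ht]


/-- A path whose first `i ≥ 3` vertices span a cycle with `p i`, both ends of that stretch having
neighbours beyond `p i`, yields a subdivided `K_{2,3}`. -/
lemma containsSubdivision_of_three_le (h : IsPathSeq G A k p) {i j m : ℕ} (hi : 3 ≤ i)
    (hij : i < j) (hjk : j ≤ k) (him : i < m) (hmk : m ≤ k) (hai : G.Adj (p 0) (p i))
    (haj : G.Adj (p 0) (p j)) (hbm : G.Adj (p (i - 1)) (p m)) :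
    ContainsSubdivision G (completeBipartiteGraph (Fin 2) (Fin 3)) := by
  have hadj := h.adj (i - 1) (by omega)
  rw [show i - 1 + 1 = i by omega] at hadj
  have hw : ∃ q : G.Walk (p j) (p (i - 1)),
      ∀ x ∈ q.support, x ∈ p '' insert (i - 1) (Set.uIcc j m) := by
    obtain ⟨q, hq⟩ := h.exists_walk_uIcc hjk hmk
    refine ⟨q.concat hbm.symm, fun x hx => ?_⟩
    rw [Walk.support_concat] at hx
    simp only [List.mem_append, List.mem_singleton] at hx
    rcases hx with hx | rfl
    · exact Set.image_mono (Set.subset_insert _ _) (hq x hx)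
    · exact ⟨i - 1, Set.mem_insert _ _, rfl⟩
  refine h.containsSubdivision (a := 0) (b := i - 1) (by omega) (by omega) (by omega) ![1, i, j]
    ![Set.Icc 1 (i - 1), {i, i - 1}, insert (i - 1) (Set.uIcc j m)] ?_ ?_ ?_ ?_ ?_ ?_ ?_
  · simp [Fin.forall_fin_succ, Set.uIcc]
    grind
  · simpa [Fin.forall_fin_succ, hai, haj] using h.adj 0 (by omega)
  · simp [Fin.forall_fin_succ]
    omega
  · simp [Fin.forall_fin_succ]
    omega
  · simp [Fin.forall_fin_succ, Set.uIcc]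
    omega
  · intro r
    fin_cases r
    · exact h.exists_walk (s := 1) (t := i - 1) (by omega) (by omega)
    · exact ⟨.cons hadj.symm .nil, by simp⟩
    · exact hw
  · simp [Fin.forall_fin_succ, Set.uIcc]
    grind

/-- A path starting in a triangle, two of whose vertices have distinct neighbours further on, yields
a subdivided `K_{2,3}`. -/
lemma containsSubdivision_of_triangle (h : IsPathSeq G A k p) {j m : ℕ} (hj : 2 < j)
    (hjk : j ≤ k) (hm : 2 < m) (hmk : m ≤ k) (hjm : j ≠ m) (h02 : G.Adj (p 0) (p 2))
    (haj : G.Adj (p 0) (p j)) (hbm : G.Adj (p 1) (p m)) :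
    ContainsSubdivision G (completeBipartiteGraph (Fin 2) (Fin 3)) := by
  have h01 : G.Adj (p 0) (p 1) := h.adj 0 (by omega)
  have h12 : G.Adj (p 1) (p 2) := h.adj 1 (by omega)
  have key : ∀ a c j m : ℕ, a < 2 → c < 2 → a ≠ c → 2 < m → m < j → j ≤ k →
      G.Adj (p a) (p c) → G.Adj (p a) (p 2) → G.Adj (p a) (p j) → G.Adj (p c) (p m) →
      ContainsSubdivision G (completeBipartiteGraph (Fin 2) (Fin 3)) := by
    intro a c j m ha hc hac hm hmj hjk hadjc hadj2 hadjj hcm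
    refine h.containsSubdivision (a := a) (b := m) (by omega) (by omega) (by omega) ![c, 2, j]
      ![{c, m}, Set.Icc 2 m, Set.Icc m j] ?_ ?_ ?_ ?_ ?_ ?_ ?_
    · simp [Fin.forall_fin_succ]
      grind
    · simp [Fin.forall_fin_succ, hadjc, hadj2, hadjj]
    · simp [Fin.forall_fin_succ]
      omega
    · simp [Fin.forall_fin_succ]
      omega
    · simp [Fin.forall_fin_succ]
      omega
    · intro r
      fin_cases r
      · exact ⟨.cons hcm .nil, by simp⟩
      · exact h.exists_walk (s := 2) (t := m) (by omega) (by omega)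
      · have := h.exists_walk_uIcc (s := j) (t := m) (by omega) (by omega)
        rwa [Set.uIcc_of_ge (by omega)] at this
    · simp [Fin.forall_fin_succ]
      grind
  rcases lt_or_gt_of_ne hjm with hlt | hlt
  · exact key 1 0 m j (by omega) (by omega) (by omega) hj hlt hmk h01.symm h12 hbm haj
  · exact key 0 1 j m (by omega) (by omega) (by omega) hm hlt hjk h01 h02 haj hbm

end IsPathSeq

/-- A nonempty graph of minimum degree at least three without a subdivided `K_{2,3}` has a vertex
of degree three that lies in a triangle. -/
lemma exists_triangle_of_not_containsSubdivision {V : Type*} {G : SimpleGraph V} {A : Finset V}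
    (hK : ¬ ContainsSubdivision G (completeBipartiteGraph (Fin 2) (Fin 3)))
    (hA : A.Nonempty) (hdeg : ∀ v ∈ A, ∀ a b, ∃ y ∈ A, G.Adj v y ∧ y ≠ a ∧ y ≠ b) :
    ∃ v ∈ A, ∃ x ∈ A, ∃ y ∈ A, G.Adj v x ∧ G.Adj v y ∧ G.Adj x y ∧
      ∀ z ∈ A, ∀ z' ∈ A, G.Adj v z → G.Adj v z' → z ≠ x → z ≠ y → z' ≠ x → z' ≠ y → z = z' := by
  classical
  obtain ⟨k, ⟨p₀, hp₀⟩, hmax⟩ : ∃ k, (∃ p, IsPathSeq G A k p) ∧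
      ∀ p, ¬ IsPathSeq G A (k + 1) p := by
    by_contra! hcon
    have hall : ∀ k, ∃ p, IsPathSeq G A k p := by
      intro k
      induction k with
      | zero =>
        obtain ⟨v, hv⟩ := hA
        exact ⟨fun _ => v, fun _ _ => hv, fun s hs t ht _ => by omega, fun t ht => by omega⟩
      | succ k ih => exact hcon k ih
    obtain ⟨p, hp⟩ := hall A.card
    exact lt_irrefl _ hp.lt_card
  have hnbr : ∀ p, IsPathSeq G A k p → ∀ y ∈ A, G.Adj (p 0) y → ∃ t, 1 ≤ t ∧ t ≤ k ∧ y = p t := by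
    intro p hp y hy hadj
    by_contra! hcon
    refine hmax _ (hp.cons hy (fun t ht => ?_) hadj)
    rcases t with _ | t
    · exact hadj.ne'
    · exact hcon _ (by omega) ht
  have hex : ∃ i, 2 ≤ i ∧ i ≤ k ∧ ∃ p, IsPathSeq G A k p ∧ G.Adj (p 0) (p i) := by
    obtain ⟨y, hy, hadj, hy1, -⟩ := hdeg _ (hp₀.mem 0 (by omega)) (p₀ 1) (p₀ 1)
    obtain ⟨t, ht1, htk, rfl⟩ := hnbr p₀ hp₀ y hy hadj
    refine ⟨t, ?_, htk, p₀, hp₀, hadj⟩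
    by_contra hlt
    exact hy1 (by rw [show t = 1 by omega])
  obtain ⟨hi2, hik, p, hp, hadj⟩ := Nat.find_spec hex
  have hmin := fun m => Nat.find_min hex (m := m)
  generalize Nat.find hex = i at *
  have hfar : ∀ q, IsPathSeq G A k q → ∃ j, i < j ∧ j ≤ k ∧ G.Adj (q 0) (q j) := by
    intro q hq
    obtain ⟨y, hy, hadj, hy1, hyi⟩ := hdeg _ (hq.mem 0 (by omega)) (q 1) (q i)
    obtain ⟨t, ht1, htk, rfl⟩ := hnbr q hq y hy hadj
    refine ⟨t, ?_, htk, hadj⟩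
    by_contra hlt
    have h1 : t ≠ 1 := fun h => hy1 (by rw [h])
    have h2 : t ≠ i := fun h => hyi (by rw [h])
    exact hmin t (by omega) ⟨by omega, htk, q, hq, hadj⟩
  obtain ⟨j, hij, hjk, haj⟩ := hfar p hp
  obtain ⟨m, him, hmk, hbm⟩ := hfar _ (hp.rotate hik hadj)
  rw [if_pos (by omega), if_neg (by omega), Nat.sub_zero] at hbm
  have hi : i = 2 := by
    by_contra hne
    exact hK (hp.containsSubdivision_of_three_le (by omega) hij hjk him hmk hadj haj hbm)
  subst hi
  have huniq : ∀ z ∈ A, G.Adj (p 0) z → z ≠ p 1 → z ≠ p 2 → z = p m := by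
    intro z hz hadjz h1 h2
    obtain ⟨t, ht1, htk, rfl⟩ := hnbr p hp z hz hadjz
    by_contra hne
    have h1 : t ≠ 1 := fun h => h1 (by rw [h])
    have h2 : t ≠ 2 := fun h => h2 (by rw [h])
    exact hK (hp.containsSubdivision_of_triangle (by omega) htk him hmk
      (fun h => hne (by rw [h])) hadj hadjz hbm)
  refine ⟨p 0, hp.mem _ (by omega), p 1, hp.mem _ (by omega), p 2, hp.mem _ (by omega),
    hp.adj 0 (by omega), hadj, hp.adj 1 (by omega), fun z hz z' hz' h h' h1 h2 h1' h2' => ?_⟩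
  rw [huniq z hz h h1 h2, huniq z' hz' h' h1' h2']

/-- `W` can be deleted from the graph induced on `A` at a cost of at most `4 / 5` per vertex: the
edges of `F` have value two, those of `H` have value one. -/
structure IsReduction {V : Type*} [DecidableEq V] (G : SimpleGraph V) (A W : Finset V)
    (F H : Finset (Sym2 V)) : Prop where
  nonempty : W.Nonempty
  subset : W ⊆ A
  edges₂ : ∀ e ∈ F, e ∈ G.edgeSet
  edges₁ : ∀ e ∈ H, e ∈ G.edgeSet
  cost : 5 * (2 * F.card + H.card) ≤ 4 * W.card
  cover : ∀ x ∈ W, ∀ y ∈ A, G.Adj x y → s(x, y) ∈ H ∨ ∃ e ∈ F, x ∈ e ∨ y ∈ e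

section Reductions

variable {V : Type*} [DecidableEq V] {G : SimpleGraph V} {A : Finset V}

/-- A vertex all of whose neighbours are ends of one edge. -/
lemma exists_isReduction_of_edge {w u t : V} (hw : w ∈ A) (hu : u ∈ A) (ht : t ∈ A)
    (hut : G.Adj u t) (hwu : w ≠ u) (hwt : w ≠ t)
    (hN : ∀ y ∈ A, G.Adj w y → y = u ∨ y = t) : ∃ W F H, IsReduction G A W F H := by
  refine ⟨{w, u, t}, {s(u, t)}, ∅, by simp, ?_, by simpa using hut, by simp, ?_, ?_⟩
  · grind
  · have : u ≠ t := hut.ne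
    simp [*]
  · intro x hx y hy hxy
    simp only [mem_insert, mem_singleton] at hx
    rcases hx with rfl | rfl | rfl
    · rcases hN y hy hxy with rfl | rfl <;> simp
    · simp
    · simp

lemma exists_isReduction_of_leaf {v u : V} (hv : v ∈ A)
    (hN : ∀ y ∈ A, G.Adj v y → y = u) : ∃ W F H, IsReduction G A W F H := by
  by_cases huA : u ∈ A ∧ G.Adj v u
  · obtain ⟨hu, hvu⟩ := huA
    by_cases hx : ∃ x ∈ A, G.Adj u x ∧ x ≠ v
    · obtain ⟨x, hx, hux, hxv⟩ := hx
      exact exists_isReduction_of_edge hv hu hx hux hvu.ne hxv.symm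
        fun y hy hvy => .inl (hN y hy hvy)
    · push Not at hx
      refine ⟨{v, u}, ∅, {s(v, u)}, by simp, ?_, by simp, by simpa using hvu, ?_, ?_⟩
      · grind
      · simp [hvu.ne]
      · intro x hxm y hy hxy
        simp only [mem_insert, mem_singleton] at hxm
        rcases hxm with rfl | rfl
        · simp [hN y hy hxy]
        · simp [hx y hy hxy, Sym2.eq_swap]
  · refine ⟨{v}, ∅, ∅, by simp, by simpa using hv, by simp, by simp, by simp, ?_⟩
    intro x hx y hy hxy
    rw [mem_singleton] at hx
    subst hx
    have := hN y hy hxy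
    subst this
    exact absurd ⟨hy, hxy⟩ huA

/-- A vertex all of whose neighbours are ends of two disjoint edges. -/
lemma exists_isReduction_of_two_edges {v x x' y y' : V} (hv : v ∈ A) (hx : x ∈ A) (hx' : x' ∈ A)
    (hy : y ∈ A) (hy' : y' ∈ A) (hxx : G.Adj x x') (hyy : G.Adj y y')
    (hnd : [v, x, x', y, y'].Nodup)
    (hN : ∀ z ∈ A, G.Adj v z → z = x ∨ z = x' ∨ z = y ∨ z = y') :
    ∃ W F H, IsReduction G A W F H := by
  refine ⟨{v, x, x', y, y'}, {s(x, x'), s(y, y')}, ∅, by simp, ?_, ?_, by simp, ?_, ?_⟩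
  · grind
  · simp [hxx, hyy]
  · have h1 : ({v, x, x', y, y'} : Finset V).card = 5 := by
      simpa using List.toFinset_card_of_nodup hnd
    have h2 := card_le_two (a := s(x, x')) (b := s(y, y'))
    rw [h1, card_empty]
    omega
  · intro a ha b hb hab
    simp only [mem_insert, mem_singleton] at ha
    right
    simp only [mem_insert, mem_singleton, exists_eq_or_imp, exists_eq_left, Sym2.mem_iff]
    rcases ha with rfl | ha
    · have := hN b hb hab
      tauto
    · tauto

/-- Four vertices covered by an edge of value two up to one edge of value one. -/
lemma exists_isReduction_of_four {a b c d : V} (hb : b ∈ A) (ha : a ∈ A)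
    (hc : c ∈ A) (hd : d ∈ A) (hab : G.Adj a b) (hcd : G.Adj c d) (hnd : [a, b, c, d].Nodup)
    (hNc : ∀ z ∈ A, G.Adj c z → z = a ∨ z = b ∨ z = d)
    (hNd : ∀ z ∈ A, G.Adj d z → z = a ∨ z = b ∨ z = c) :
    ∃ W F H, IsReduction G A W F H := by
  refine ⟨{a, b, c, d}, {s(a, b)}, {s(c, d)}, by simp, ?_, by simpa using hab,
    by simpa using hcd, ?_, ?_⟩
  · grind
  · have h1 : ({a, b, c, d} : Finset V).card = 4 := by
      simpa using List.toFinset_card_of_nodup hnd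
    rw [h1, card_singleton, card_singleton]
    omega
  · intro x hx y hy hxy
    simp only [mem_insert, mem_singleton] at hx
    simp only [mem_singleton, exists_eq_left, Sym2.mem_iff]
    rcases hx with rfl | rfl | rfl | rfl
    · simp
    · simp
    · rcases hNc y hy hxy with rfl | rfl | rfl <;> simp
    · rcases hNd y hy hxy with rfl | rfl | rfl <;> simp [Sym2.eq_swap]

lemma exists_isReduction_of_degree_le_two {v x y : V} (hv : v ∈ A)
    (hN : ∀ z ∈ A, G.Adj v z → z = x ∨ z = y) : ∃ W F H, IsReduction G A W F H := by
  by_cases hx : x ∈ A ∧ G.Adj v x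
  swap
  · exact exists_isReduction_of_leaf (u := y) hv fun z hz hvz =>
      (hN z hz hvz).resolve_left (by rintro rfl; exact hx ⟨hz, hvz⟩)
  by_cases hy : y ∈ A ∧ G.Adj v y
  swap
  · exact exists_isReduction_of_leaf (u := x) hv fun z hz hvz =>
      (hN z hz hvz).resolve_right (by rintro rfl; exact hy ⟨hz, hvz⟩)
  obtain ⟨hx, hvx⟩ := hx
  obtain ⟨hy, hvy⟩ := hy
  by_cases hxy : x = y
  · subst hxy
    exact exists_isReduction_of_leaf (u := x) hv fun z hz hvz => (hN z hz hvz).elim id id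
  by_cases hadj : G.Adj x y
  · exact exists_isReduction_of_edge hv hx hy hadj hvx.ne hvy.ne hN
  by_cases hx' : ∃ x' ∈ A, G.Adj x x' ∧ x' ≠ v
  swap
  · push Not at hx'
    exact exists_isReduction_of_leaf hx hx'
  by_cases hy' : ∃ y' ∈ A, G.Adj y y' ∧ y' ≠ v
  swap
  · push Not at hy'
    exact exists_isReduction_of_leaf hy hy'
  by_cases hsdr : ∃ x' ∈ A, ∃ y' ∈ A, G.Adj x x' ∧ G.Adj y y' ∧ x' ≠ v ∧ y' ≠ v ∧ x' ≠ y'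
  · obtain ⟨x', hx', y', hy', hxx, hyy, hxv, hyv, hne⟩ := hsdr
    refine exists_isReduction_of_two_edges hv hx hx' hy hy' hxx hyy ?_ ?_
    · have h1 := hvx.ne
      have h2 := hvy.ne
      have h3 := hxx.ne
      have h4 := hyy.ne
      have h5 : x' ≠ y := by rintro rfl; exact hadj hxx
      have h6 : x ≠ y' := by rintro rfl; exact hadj hyy.symm
      grind
    · intro z hz hvz
      have := hN z hz hvz
      tauto
  · push Not at hsdr
    obtain ⟨z, hz, hxz, hzv⟩ := hx'
    obtain ⟨z', hz', hyz, hzv'⟩ := hy'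
    have := hsdr z hz z' hz' hxz hyz hzv hzv'
    subst this
    refine exists_isReduction_of_four (a := z) (b := x) (c := v) (d := y) hx hz hv hy hxz.symm hvy
      ?_ ?_ ?_
    · have h1 := hvx.ne
      have h2 := hxz.ne
      have h3 := hvy.ne
      have h4 := hyz.ne
      grind
    · intro t ht hvt
      have := hN t ht hvt
      tauto
    · intro t ht hyt
      by_cases htv : t = v
      · tauto
      · exact .inl (hsdr z hz t ht hxz hyt hzv htv).symm

lemma exists_isReduction_of_triangle {v x y : V} (hv : v ∈ A) (hx : x ∈ A) (hy : y ∈ A)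
    (hvx : G.Adj v x) (hvy : G.Adj v y) (hxy : G.Adj x y)
    (hN : ∀ z ∈ A, ∀ z' ∈ A, G.Adj v z → G.Adj v z' → z ≠ x → z ≠ y → z' ≠ x → z' ≠ y → z = z') :
    ∃ W F H, IsReduction G A W F H := by
  by_cases hz : ∃ z ∈ A, G.Adj v z ∧ z ≠ x ∧ z ≠ y
  swap
  · push Not at hz
    refine exists_isReduction_of_edge hv hx hy hxy hvx.ne hvy.ne fun t ht hvt => ?_
    have := hz t ht hvt
    tauto
  obtain ⟨z, hz, hvz, hzx, hzy⟩ := hz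
  have hNv : ∀ t ∈ A, G.Adj v t → t = x ∨ t = y ∨ t = z := by
    intro t ht hvt
    have := hN t ht z hz hvt hvz
    tauto
  by_cases hz' : ∃ z' ∈ A, G.Adj z z' ∧ z' ≠ v ∧ z' ≠ x ∧ z' ≠ y
  · obtain ⟨z', hz', hzz, hzv', hzx', hzy'⟩ := hz'
    refine exists_isReduction_of_two_edges hv hx hy hz hz' hxy hzz ?_ ?_
    · have h1 := hvx.ne
      have h2 := hvy.ne
      have h3 := hvz.ne
      have h4 := hxy.ne
      have h5 := hzz.ne
      grind
    · intro t ht hvt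
      have := hNv t ht hvt
      tauto
  · push Not at hz'
    refine exists_isReduction_of_four hy hx hv hz hxy hvz ?_ hNv ?_
    · have h1 := hvx.ne
      have h2 := hvy.ne
      have h3 := hvz.ne
      have h4 := hxy.ne
      grind
    · intro t ht hzt
      have := hz' t ht hzt
      tauto

lemma exists_cover (hK : ¬ ContainsSubdivision G (completeBipartiteGraph (Fin 2) (Fin 3)))
    (A : Finset V) : ∃ F H : Finset (Sym2 V), (∀ e ∈ F, e ∈ G.edgeSet) ∧ (∀ e ∈ H, e ∈ G.edgeSet) ∧
      5 * (2 * F.card + H.card) ≤ 4 * A.card ∧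
      ∀ x ∈ A, ∀ y ∈ A, G.Adj x y → s(x, y) ∈ H ∨ ∃ e ∈ F, x ∈ e ∨ y ∈ e := by
  induction A using Finset.strongInduction with
  | H A ih =>
    rcases A.eq_empty_or_nonempty with rfl | hA
    · exact ⟨∅, ∅, by simp⟩
    obtain ⟨W, F₀, H₀, hW⟩ : ∃ W F H, IsReduction G A W F H := by
      by_cases hdeg : ∀ v ∈ A, ∀ a b, ∃ y ∈ A, G.Adj v y ∧ y ≠ a ∧ y ≠ b
      · obtain ⟨v, hv, x, hx, y, hy, hvx, hvy, hxy, hN⟩ :=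
          exists_triangle_of_not_containsSubdivision hK hA hdeg
        exact exists_isReduction_of_triangle hv hx hy hvx hvy hxy hN
      · push Not at hdeg
        obtain ⟨v, hv, a, b, hN⟩ := hdeg
        refine exists_isReduction_of_degree_le_two (x := a) (y := b) hv fun z hz hvz => ?_
        have := hN z hz hvz
        tauto
    obtain ⟨F, H, hF, hH, hcost, hcov⟩ := ih (A \ W) (sdiff_ssubset hW.subset hW.nonempty)
    refine ⟨F₀ ∪ F, H₀ ∪ H, ?_, ?_, ?_, ?_⟩
    · intro e he
      exact (mem_union.1 he).elim (hW.edges₂ e) (hF e)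
    · intro e he
      exact (mem_union.1 he).elim (hW.edges₁ e) (hH e)
    · have h1 := card_union_le F₀ F
      have h2 := card_union_le H₀ H
      have h3 := card_sdiff_add_card_eq_card hW.subset
      have h4 := hW.cost
      omega
    · have key : ∀ x ∈ W, ∀ y ∈ A, G.Adj x y →
          s(x, y) ∈ H₀ ∪ H ∨ ∃ e ∈ F₀ ∪ F, x ∈ e ∨ y ∈ e := by
        intro x hx y hy hxy
        rcases hW.cover x hx y hy hxy with h | ⟨e, he, h⟩
        · exact .inl (mem_union_left _ h)
        · exact .inr ⟨e, mem_union_left _ he, h⟩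
      intro x hx y hy hxy
      by_cases hxW : x ∈ W
      · exact key x hxW y hy hxy
      by_cases hyW : y ∈ W
      · rw [Sym2.eq_swap]
        simpa only [or_comm] using key y hyW x hx hxy.symm
      rcases hcov x (by simp [*]) y (by simp [*]) hxy with h | ⟨e, he, h⟩
      · exact .inl (mem_union_right _ h)
      · exact .inr ⟨e, mem_union_right _ he, h⟩

end Reductions

/-- Values two on `F` and one on the rest of `H` bound the edge Roman domination number. -/
lemma edgeRomanNumber_le_of_cover {V : Type*} [Fintype V] [DecidableEq V] {G : SimpleGraph V}
    {F H : Finset (Sym2 V)} (hF : ∀ e ∈ F, e ∈ G.edgeSet) (hH : ∀ e ∈ H, e ∈ G.edgeSet)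
    (hcov : ∀ x y, G.Adj x y → s(x, y) ∈ H ∨ ∃ e ∈ F, x ∈ e ∨ y ∈ e) :
    edgeRomanNumber V G ≤ 2 * F.card + H.card := by
  let f : Sym2 V → ℕ := fun e => if e ∈ F then 2 else if e ∈ H then 1 else 0
  have hf : EdgeRDF G f := by
    refine ⟨fun e => ?_, fun e he => ?_, fun e he h0 => ?_⟩
    · dsimp only [f]
      split_ifs <;> omega
    · have h1 : e ∉ F := fun h => he (hF e h)
      have h2 : e ∉ H := fun h => he (hH e h)
      simp [f, h1, h2]
    · have h1 : e ∉ F := fun h => by simp [f, h] at h0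
      have h2 : e ∉ H := fun h => by simp [f, h, h1] at h0
      induction e using Sym2.ind with
      | _ x y =>
        obtain ⟨e', he', h⟩ := (hcov x y he).resolve_left h2
        refine ⟨e', hF e' he', by simp [f, he'], fun h => h1 (h ▸ he'), ?_⟩
        rcases h with h | h
        · exact ⟨x, by simp, h⟩
        · exact ⟨y, by simp, h⟩
  refine le_trans (Nat.sInf_le (m := ∑ e, f e) ⟨f, hf, rfl⟩) ?_
  calc ∑ e, f e ≤ ∑ e : Sym2 V, ((if e ∈ F then 2 else 0) + if e ∈ H then 1 else 0) := by
        refine Finset.sum_le_sum fun e _ => ?_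
        dsimp only [f]
        split_ifs <;> omega
    _ = 2 * F.card + H.card := by
        rw [Finset.sum_add_distrib]
        simp [mul_comm]

/-- If `G` is a graph on `n` vertices containing no subgraph isomorphic to a subdivision
of `K_{2,3}`, then `γ'_R(G) ≤ (4/5)·n`. -/
theorem edgeRomanNumber_le_of_no_K23_subdivision {V : Type*} [Fintype V] [DecidableEq V]
    (G : SimpleGraph V)
    (hK23 : ¬ ContainsSubdivision G (completeBipartiteGraph (Fin 2) (Fin 3))) :
    (edgeRomanNumber V G : ℝ) ≤ 4 / 5 * Fintype.card V := by
  obtain ⟨F, H, hF, hH, hcost, hcov⟩ := exists_cover hK23 Finset.univ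
  have hle := edgeRomanNumber_le_of_cover hF hH
    fun x y hxy => hcov x (mem_univ x) y (mem_univ y) hxy
  rw [card_univ] at hcost
  have h : 5 * edgeRomanNumber V G ≤ 4 * Fintype.card V := by omega
  have h' : (5 : ℝ) * edgeRomanNumber V G ≤ 4 * Fintype.card V := by exact_mod_cast h
  linarith
end
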